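/- Let d ≥ 1 and 0 ≤ a < 1, and let q, r satisfy 2/q + d/r = (d+a+1)/2 with r ≥ 2; assume in addition r < 2d/(d+a−1) if d+a−1 > 0, and (q,r) ≠ (2,∞) if d+a−1 = 0. Then there exists C = C(d,a,r) > 0 such that for all u₀ ∈ 𝒮(ℝ^{d+1}_+), F ∈ 𝒮(ℝ^{d+1}_+×ℝ) and Φ ∈ 𝒮(ℝ^{d+1}), the function U = 𝕋_a^*(u₀) + 𝔻_a(F) + Θ_a^*(Φ) satisfies the Strichartz estimates: ‖U‖_{L^∞_tL²_a(ℝ^{d+1}_+)} ≤ C·[ ‖u₀‖_{L²_a} + ‖F‖_{L¹_tL²_a} + ‖Φ‖_{L^{q'}_tL^{r'}_x} ] and sup_{z>0}‖U(·,z,·)‖_{L^q_tL^r_x} ≤ C·[ ‖u₀‖_{L²_a} + ‖F‖_{L¹_{a,z}L^{q'}_tL^{r'}_x} + ‖Φ‖_{L^{q'}_tL^{r'}_x} ]. -/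

import Mathlib

open MeasureTheory Filter Complex
open scoped ENNReal NNReal Topology

noncomputable section

/-- Bessel function of the first kind of order `ν`, via its power series. -/
def besselJ (ν : ℝ) (x : ℝ) : ℝ :=
  ∑' k : ℕ, ((-1 : ℝ) ^ k / ((k.factorial : ℝ) * Real.Gamma ((k : ℝ) + ν + 1))) *
    (x / 2) ^ (2 * (k : ℝ) + ν)

/-- The half-line Schrödinger–Bessel kernel `S_a(z,ζ,t)`. -/
def SaK (a : ℝ) (z ζ t : ℝ) : ℂ :=
  (Complex.exp (-Complex.I * ((Real.sign t : ℝ) : ℂ) * (((a + 1) * Real.pi / 4 : ℝ) : ℂ)) /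
      (((2 * |t|) ^ ((a + 1) / 2) : ℝ) : ℂ)) *
    (((z * ζ / (2 * |t|)) ^ ((1 - a) / 2) : ℝ) : ℂ) *
    ((besselJ ((a - 1) / 2) (z * ζ / (2 * |t|)) : ℝ) : ℂ) *
    Complex.exp (Complex.I * ((z ^ 2 + ζ ^ 2 : ℝ) : ℂ) / ((4 * t : ℝ) : ℂ))

/-- The boundary kernel `S_a(z,0,t)`. -/
def Sa0 (a : ℝ) (z t : ℝ) : ℂ :=
  ((((2 : ℝ) ^ (-a) / Real.Gamma ((a + 1) / 2) : ℝ)) : ℂ) *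
    Complex.exp (-Complex.I * ((Real.sign t : ℝ) : ℂ) * (((a + 1) * Real.pi / 4 : ℝ) : ℂ)) *
    (((|t| ^ (-((a + 1) / 2)) : ℝ)) : ℂ) *
    Complex.exp (Complex.I * ((z ^ 2 : ℝ) : ℂ) / ((4 * t : ℝ) : ℂ))

/-- The free Schrödinger kernel on `ℝ^d` (principal branch of the power). -/
def Sfree (d : ℕ) (x y : Fin d → ℝ) (t : ℝ) : ℂ :=
  (4 * (Real.pi : ℂ) * Complex.I * (t : ℂ)) ^ (-(d : ℂ) / 2) *
    Complex.exp (Complex.I * ((∑ i, (x i - y i) ^ 2 : ℝ) : ℂ) / ((4 * t : ℝ) : ℂ))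

/-- The full half-space kernel `𝕊_a(X,Y,t) = S_a(z,ζ,t)·S(x,y,t)`. -/
def SK (d : ℕ) (a : ℝ) (X Y : (Fin d → ℝ) × ℝ) (t : ℝ) : ℂ :=
  SaK a X.2 Y.2 t * Sfree d X.1 Y.1 t

/-- The weighted measure `dω_a = z^a dx dz` on the half-space `ℝ^d × (0,∞)`. -/
def ωa (d : ℕ) (a : ℝ) : Measure ((Fin d → ℝ) × ℝ) :=
  (volume : Measure (Fin d → ℝ)).prod
    (((volume : Measure ℝ).restrict (Set.Ioi 0)).withDensity fun z => ENNReal.ofReal (z ^ a))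

/-- The mixed norm `‖Φ‖_{L^q_t L^r_x}`. -/
def mixNorm (d : ℕ) (q r : ℝ) (Φ : (Fin d → ℝ) → ℝ → ℂ) : ℝ≥0∞ :=
  (∫⁻ t : ℝ, (∫⁻ x : Fin d → ℝ, (‖Φ x t‖₊ : ℝ≥0∞) ^ r) ^ (q / r)) ^ (1 / q)

/-- The mixed norm `‖Φ‖_{L^q_T L^r_x}` over the time interval `[0,T]`. -/
def mixNormT (d : ℕ) (T q r : ℝ) (Φ : (Fin d → ℝ) → ℝ → ℂ) : ℝ≥0∞ :=
  (∫⁻ t in Set.Ioc (0 : ℝ) T, (∫⁻ x : Fin d → ℝ, (‖Φ x t‖₊ : ℝ≥0∞) ^ r) ^ (q / r)) ^ (1 / q)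

/-- The homogeneous propagator `𝕋_a^*(u₀)`. -/
def Tstar (d : ℕ) (a : ℝ) (u₀ : (Fin d → ℝ) × ℝ → ℂ) (X : (Fin d → ℝ) × ℝ) (t : ℝ) : ℂ :=
  if t = 0 then u₀ X else ∫ Y, SK d a X Y t * u₀ Y ∂(ωa d a)

/-- The inhomogeneous Duhamel term `𝔻_a(F)`. -/
def Dop (d : ℕ) (a : ℝ) (F : (Fin d → ℝ) × ℝ → ℝ → ℂ) (X : (Fin d → ℝ) × ℝ) (t : ℝ) : ℂ :=
  ∫ τ in (0 : ℝ)..t, ∫ Y, SK d a X Y (t - τ) * F Y τ ∂(ωa d a)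

/-- The boundary-data operator `Θ_a^*(Φ)`. -/
def ThetaStar (d : ℕ) (a : ℝ) (Φ : (Fin d → ℝ) → ℝ → ℂ) (X : (Fin d → ℝ) × ℝ) (t : ℝ) : ℂ :=
  Complex.I *
    ∫ τ in (0 : ℝ)..t, ∫ y : Fin d → ℝ, Sa0 a X.2 (t - τ) * Sfree d X.1 y (t - τ) * Φ y τ

/-- The weight `k(z) = min{1, z^{a/2}}`. -/
def kwt (a z : ℝ) : ℝ := min 1 (z ^ (a / 2))

/-- The weight `k^{-1}(z) = max{1, z^{-a/2}}`. -/
def kinv (a z : ℝ) : ℝ := max 1 (z ^ (-a / 2))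


local notation:max "Ed" d:max => Fin d → ℝ
local notation "eo" => ENNReal.ofReal
local notation "RR" => ℝ
local notation "CC" => ℂ

section helpers
open Function

def ma (a : RR) : Measure RR :=
  ((volume : Measure RR).restrict (Set.Ioi 0)).withDensity fun z => eo (z ^ a)

instance ma_sfinite (a : RR) : SFinite (ma a) := by unfold ma; infer_instance

lemma ωa_eq (d : ℕ) (a : RR) : ωa d a = (volume : Measure (Ed d)).prod (ma a) := rfl

lemma meas_w (a : RR) : Measurable (fun z : RR => eo (z ^ a)) := by fun_prop

lemma ae_ma_pos (a : RR) : ∀ᵐ z ∂(ma a), 0 < z := by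
  have : ma a ≪ (volume : Measure RR).restrict (Set.Ioi 0) := withDensity_absolutelyContinuous _ _
  exact this.ae_le (ae_restrict_mem measurableSet_Ioi)

lemma integral_ma {E : Type*} [NormedAddCommGroup E] [NormedSpace RR E] (a : RR) (f : RR → E) :
    ∫ z, f z ∂(ma a) = ∫ z in Set.Ioi (0:RR), (z ^ a) • f z := by
  unfold ma
  rw [integral_withDensity_eq_integral_toReal_smul₀ (meas_w a).aemeasurable (by simp)]
  refine setIntegral_congr_fun measurableSet_Ioi fun z hz => ?_
  rw [ENNReal.toReal_ofReal (Real.rpow_nonneg (le_of_lt hz) _)]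

lemma integrable_ma {E : Type*} [NormedAddCommGroup E] [NormedSpace RR E] (a : RR) (f : RR → E) :
    Integrable f (ma a) ↔ IntegrableOn (fun z => (z ^ a) • f z) (Set.Ioi (0:RR)) := by
  unfold ma
  rw [integrable_withDensity_iff_integrable_smul' (meas_w a) (by simp)]
  refine integrableOn_congr_fun (fun z hz => ?_) measurableSet_Ioi
  rw [ENNReal.toReal_ofReal (Real.rpow_nonneg (le_of_lt hz) _)]

lemma integrable_gauss_ma {s : RR} (hs : -1 < s) {ε : RR} (hε : 0 < ε) :
    Integrable (fun z : RR => Real.exp (-ε * z ^ 2)) (ma s) := by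
  rw [integrable_ma]
  exact integrableOn_rpow_mul_exp_neg_mul_sq hε hs

lemma integral_gauss_ma {s : RR} (hs : -1 < s) {ε : RR} (hε : 0 < ε) :
    ∫ z : RR, Real.exp (-ε * z ^ 2) ∂(ma s) = Real.Gamma ((s+1)/2) / 2 * ε ^ (-((s+1)/2)) := by
  rw [integral_ma]
  have := integral_rpow_mul_exp_neg_mul_rpow (p := 2) (q := s) (b := ε) (by norm_num) hs hε
  simp only [smul_eq_mul]
  simp only [Real.rpow_two] at this
  rw [this, neg_div]; ring

open ProbabilityTheory in
lemma integral_cgauss_ma {s : RR} (hs : -1 < s) {p : CC} (hp : 0 < p.re) :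
    ∫ z : RR, cexp (-p * (z:CC) ^ 2) ∂(ma s)
      = (Real.Gamma ((s+1)/2) / 2 : RR) * p ^ (-(((s+1)/2 : RR) : CC)) := by
  set X : RR → RR := fun z => z ^ 2 with hX
  have hset : Set.Iio (0:RR) ⊆ interior (integrableExpSet X (ma s)) := by
    apply interior_maximal _ isOpen_Iio
    intro t ht
    have := integrable_gauss_ma hs (ε := -t) (by simpa using ht)
    simpa [integrableExpSet, hX] using this
  set U : Set CC := {z | z.re < 0} with hU
  have h1 : AnalyticOnNhd CC (complexMGF X (ma s)) U := fun z hz =>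
    analyticAt_complexMGF (hset hz)
  have h2 : AnalyticOnNhd CC (fun z : CC => (Real.Gamma ((s+1)/2) / 2 : RR) *
      (-z) ^ (-(((s+1)/2 : RR) : CC))) U := by
    apply DifferentiableOn.analyticOnNhd _ (isOpen_lt Complex.continuous_re continuous_const)
    intro z hz
    apply DifferentiableAt.differentiableWithinAt
    apply DifferentiableAt.const_mul
    apply DifferentiableAt.cpow (by fun_prop) (by fun_prop)
    left
    simpa using hz
  have hc : IsPreconnected U := (convex_halfSpace_re_lt 0).isPreconnected
  have key := h1.eqOn_of_preconnected_of_frequently_eq h2 hc (z₀ := -1) (by simp [hU]) (by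
    have hreal : ∀ x : RR, 0 < x → complexMGF X (ma s) ((-x : RR):CC) = (Real.Gamma ((s+1)/2) / 2 : RR) *
      (-((-x : RR):CC)) ^ (-(((s+1)/2 : RR) : CC)) := by
      intro x hx
      rw [complexMGF_ofReal, mgf]
      simp only [hX]
      rw [integral_gauss_ma hs hx]
      push_cast
      rw [Complex.ofReal_cpow hx.le]
      simp
    have ht : Tendsto (fun n : ℕ => ((-(1 + 1 / ((n:RR) + 1)) : RR) : CC)) atTop (𝓝[≠] (-1)) := by
      apply tendsto_nhdsWithin_iff.2 ⟨?_, ?_⟩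
      · have h0 := tendsto_one_div_add_atTop_nhds_zero_nat (𝕜 := RR)
        have h3 : Tendsto (fun n : ℕ => (-(1 + 1 / ((n:RR) + 1)) : RR)) atTop (𝓝 (-(1+0))) :=
          (h0.const_add 1).neg
        have := (Complex.continuous_ofReal.tendsto _).comp h3
        simpa [Function.comp_def] using this
      · refine Eventually.of_forall fun n => ?_
        simp only [Set.mem_compl_iff, Set.mem_singleton_iff]
        intro h
        have h' : (-(1 + 1 / ((n:RR) + 1)) : RR) = -1 := by exact_mod_cast h
        have : (0:RR) < 1 / ((n:RR) + 1) := by positivity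
        linarith
    refine ht.frequently (Frequently.of_forall fun n => ?_)
    exact hreal _ (by positivity))
  have := key (show -p ∈ U by simpa [hU] using hp)
  simp only [complexMGF, hX, neg_neg] at this
  rw [← this]
  congr 1; ext z; push_cast; rfl

lemma smul_pow_ma (a : RR) (n : ℕ) {z : RR} (hz : 0 < z) : z ^ (a + 2 * n) = z ^ a * z ^ (2 * n) := by
  rw [Real.rpow_add hz, ← Real.rpow_natCast z (2*n)]; push_cast; rfl

lemma integral_pow_cgauss_ma {a : RR} (ha : -1 < a) (n : ℕ) {p : CC} (hp : 0 < p.re) :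
    ∫ z : RR, (z:CC) ^ (2 * n) * cexp (-p * (z:CC) ^ 2) ∂(ma a)
      = (Real.Gamma (n + (a+1)/2) / 2 : RR) * p ^ (-((n + (a+1)/2 : RR) : CC)) := by
  have h := integral_cgauss_ma (s := a + 2 * n) (by have : (0:RR) ≤ n := by positivity
                                                    linarith) hp
  rw [show (a + 2 * n + 1) / 2 = n + (a+1)/2 by ring] at h
  rw [← h, integral_ma, integral_ma]
  refine setIntegral_congr_fun measurableSet_Ioi fun z hz => ?_
  simp only [Complex.real_smul, smul_pow_ma a n hz]
  push_cast; ring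

lemma integral_pow_gauss_ma {a : RR} (ha : -1 < a) (n : ℕ) {ε : RR} (hε : 0 < ε) :
    ∫ z : RR, z ^ (2 * n) * Real.exp (-ε * z ^ 2) ∂(ma a)
      = (Real.Gamma (n + (a+1)/2) / 2 : RR) * ε ^ (-(n + (a+1)/2)) := by
  have h := integral_gauss_ma (s := a + 2 * n) (by have : (0:RR) ≤ n := by positivity
                                                   linarith) hε
  rw [show (a + 2 * n + 1) / 2 = n + (a+1)/2 by ring] at h
  rw [← h, integral_ma, integral_ma]
  refine setIntegral_congr_fun measurableSet_Ioi fun z hz => ?_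
  simp only [smul_eq_mul, smul_pow_ma a n hz]
  ring

lemma integrable_pow_gauss_ma {a : RR} (ha : -1 < a) (n : ℕ) {ε : RR} (hε : 0 < ε) :
    Integrable (fun z : RR => z ^ (2 * n) * Real.exp (-ε * z ^ 2)) (ma a) := by
  have h := integrable_gauss_ma (s := a + 2 * n) (by have : (0:RR) ≤ n := by positivity
                                                     linarith) hε
  rw [integrable_ma] at h ⊢
  refine h.congr_fun (fun z hz => ?_) measurableSet_Ioi
  simp only [smul_eq_mul, smul_pow_ma a n hz]
  ring

def be (b : RR) (k : ℕ) : RR := Real.Gamma b / (k.factorial * Real.Gamma (k + b))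

lemma be_pos {b : RR} (hb : 0 < b) (k : ℕ) : 0 < be b k := by
  unfold be
  have h1 := Real.Gamma_pos_of_pos hb
  have h2 : 0 < Real.Gamma (k + b) := Real.Gamma_pos_of_pos (by positivity)
  positivity

lemma be_zero {b : RR} (hb : 0 < b) : be b 0 = 1 := by
  unfold be
  have h1 := Real.Gamma_pos_of_pos hb
  simp [h1.ne']

lemma be_succ {b : RR} (hb : 0 < b) (k : ℕ) : be b (k+1) = be b k / ((k+1) * (k + b)) := by
  unfold be
  have h2 : 0 < Real.Gamma (k + b) := Real.Gamma_pos_of_pos (by positivity)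
  have h3 : (0:RR) < k + b := by positivity
  have : Real.Gamma ((k+1:ℕ) + b) = (k + b) * Real.Gamma (k + b) := by
    rw [← Real.Gamma_add_one h3.ne']; congr 1; push_cast; ring
  rw [this, Nat.factorial_succ]; push_cast
  field_simp

lemma be_le {b : RR} (hb : 1/2 ≤ b) (k : ℕ) : be b k ≤ 2 ^ k / k.factorial := by
  have hb0 : 0 < b := by linarith
  induction k with
  | zero => simp [be_zero hb0]
  | succ k ih =>
    rw [be_succ hb0, Nat.factorial_succ]
    have h3 : (1/2:RR) ≤ k + b := by
      have : (0:RR) ≤ k := by positivity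
      linarith
    have h4 := (be_pos hb0 k).le
    push_cast
    rw [div_le_div_iff₀ (by positivity) (by positivity)]
    rw [le_div_iff₀ (by positivity)] at ih
    have h5 : be b k * ((k+1) * k.factorial) ≤ 2 ^ k * (k+1) := by
      calc _ = (be b k * k.factorial) * (k+1) := by ring
        _ ≤ _ := by gcongr
    calc _ ≤ (2:RR)^k * (k+1) := h5
      _ = 2 ^ k * (k+1) * 2 * (1/2) := by ring
      _ ≤ 2 ^ k * (k+1) * 2 * (k+b) := by gcongr
      _ = _ := by ring

lemma be_summable {b : RR} (hb : 1/2 ≤ b) (u : CC) : Summable (fun k => ‖(be b k : CC) * u ^ k‖) := by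
  have hb0 : 0 < b := by linarith
  refine Summable.of_nonneg_of_le (fun _ => norm_nonneg _) (fun k => ?_)
    (Real.summable_pow_div_factorial (2 * ‖u‖))
  rw [norm_mul, norm_pow, Complex.norm_real, Real.norm_of_nonneg (be_pos hb0 k).le, mul_pow,
    mul_div_right_comm]
  gcongr
  exact be_le hb k

def Phi (b : RR) (u : CC) : CC := ∑' k, (be b k : CC) * u ^ k

lemma Phi_hasSum {b : RR} (hb : 1/2 ≤ b) (u : CC) : HasSum (fun k => (be b k : CC) * u ^ k) (Phi b u) :=
  (be_summable hb u).of_norm.hasSum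

lemma Phi_measurable {b : RR} (hb : 1/2 ≤ b) : Measurable (Phi b) := by
  refine measurable_of_tendsto_metrizable (f := fun n u => ∑ k ∈ Finset.range n, (be b k : CC) * u ^ k)
    (fun n => by fun_prop) ?_
  rw [tendsto_pi_nhds]
  intro u
  exact (Phi_hasSum hb u).tendsto_sum_nat

def mom (b : RR) (k : ℕ) : RR := be b k * (2*k).factorial / 4 ^ k

lemma mom_succ {b : RR} (hb : 0 < b) (k : ℕ) : mom b (k+1) = mom b k * ((k + 1/2) / (k + b)) := by
  unfold mom
  rw [be_succ hb, show 2 * (k+1) = 2*k+1+1 by ring, Nat.factorial_succ, Nat.factorial_succ]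
  have h3 : (0:RR) < k + b := by positivity
  push_cast
  field_simp
  ring

open ProbabilityTheory in
lemma exists_mom {b : RR} (hb : 1/2 ≤ b) : ∃ μ : Measure RR, IsProbabilityMeasure μ ∧
    (∀ᵐ s ∂μ, 0 ≤ s ∧ s ≤ 1) ∧ ∀ k : ℕ, ∫ s, s ^ k ∂μ = mom b k := by
  have hb0 : 0 < b := by linarith
  rcases hb.eq_or_lt with h | h
  · refine ⟨Measure.dirac 1, inferInstance, ?_, fun k => ?_⟩
    · rw [ae_dirac_iff (by measurability)]; norm_num
    · rw [integral_dirac, one_pow]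
      induction k with
      | zero => simp [mom, be_zero hb0]
      | succ k ih => rw [mom_succ hb0, ← ih, ← h, div_self (by positivity)]; simp
  · have hβ : 0 < b - 1/2 := by linarith
    have hsupp : ∀ᵐ s ∂(betaMeasure (1/2) (b-1/2)), 0 < s ∧ s < 1 := by
      rw [betaMeasure, ae_withDensity_iff (by unfold betaPDF; fun_prop)]
      refine ae_of_all _ fun s hs => ?_
      by_contra hcon
      apply hs
      rw [betaPDF_eq, if_neg hcon, ENNReal.ofReal_zero]
    refine ⟨betaMeasure (1/2) (b-1/2), isProbabilityMeasureBeta (by norm_num) hβ, ?_, fun k => ?_⟩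
    · filter_upwards [hsupp] with s hs using ⟨hs.1.le, hs.2.le⟩
    · have hbk : ∀ k : ℕ, beta (1/2 + k) (b-1/2) = mom b k * beta (1/2) (b-1/2) := by
        intro k
        induction k with
        | zero => simp [mom, be_zero hb0]
        | succ k ih =>
          rw [mom_succ hb0, mul_right_comm, ← ih]
          unfold beta
          have e1 : Real.Gamma (1/2 + (k+1:ℕ)) = (k+1/2) * Real.Gamma (1/2 + k) := by
            rw [show (k:RR) + 1/2 = 1/2 + k by ring, ← Real.Gamma_add_one (by positivity)]
            congr 1; push_cast; ring
          have e2 : Real.Gamma (1/2 + (k+1:ℕ) + (b-1/2)) = (k+b) * Real.Gamma (1/2 + k + (b - 1/2)) := by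
            rw [show (1/2:RR) + k + (b-1/2) = k + b by ring, ← Real.Gamma_add_one (by positivity)]
            congr 1; push_cast; ring
          rw [e1, e2]
          have h2 : 0 < Real.Gamma (1/2 + k + (b-1/2)) :=
            Real.Gamma_pos_of_pos (by rw [show (1/2:RR) + k + (b-1/2) = k + b by ring]; positivity)
          have h3 : (0:RR) < k + b := by positivity
          field_simp
      have hmom0 : 0 ≤ mom b k := by
        unfold mom; have := (be_pos hb0 k).le; positivity
      rw [integral_eq_lintegral_of_nonneg_ae (by filter_upwards [hsupp] with s hs using pow_nonneg hs.1.le k)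
        (by fun_prop), betaMeasure, lintegral_withDensity_eq_lintegral_mul _ (by unfold betaPDF; fun_prop)
          (by fun_prop)]
      have : ∀ s, (betaPDF (1/2) (b-1/2) * fun s => eo (s^k)) s =
          eo (mom b k) * betaPDF (1/2 + k) (b-1/2) s := by
        intro s
        simp only [Pi.mul_apply, betaPDF_eq]
        split_ifs with hs
        · rw [← ENNReal.ofReal_mul' (pow_nonneg hs.1.le _), ← ENNReal.ofReal_mul hmom0, hbk]
          congr 1
          have hp : s ^ ((1:RR)/2 + k - 1) = s ^ ((1:RR)/2 - 1) * s ^ k := by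
            rw [← Real.rpow_natCast, ← Real.rpow_add hs.1]; congr 1; ring
          rw [hp]
          have h5 : 0 < mom b k := by
            unfold mom; have := (be_pos hb0 k); positivity
          have h6 := beta_pos (α := 1/2) (by norm_num) hβ
          field_simp
        · simp
      simp_rw [this]
      rw [lintegral_const_mul _ (by unfold betaPDF; fun_prop), lintegral_betaPDF_eq_one (by positivity) hβ]
      simp [hmom0]

lemma norm_cosh_le (w : CC) : ‖Complex.cosh w‖ ≤ Real.exp |w.re| := by
  rw [Complex.cosh, norm_div]
  have h1 : ‖cexp w‖ ≤ Real.exp |w.re| := by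
    rw [Complex.norm_exp]; exact Real.exp_le_exp.2 (le_abs_self _)
  have h2 : ‖cexp (-w)‖ ≤ Real.exp |w.re| := by
    rw [Complex.norm_exp]; exact Real.exp_le_exp.2 (by simpa using neg_le_abs w.re)
  have := norm_add_le (cexp w) (cexp (-w))
  simp only [Complex.norm_ofNat]
  linarith

lemma Phi_bound {b : RR} (hb : 1/2 ≤ b) (w : CC) : ‖Phi b (w^2/4)‖ ≤ Real.exp |w.re| := by
  obtain ⟨μ, hμ, hs, hm⟩ := exists_mom hb
  set f : ℕ → RR → CC := fun k s => ((s ^ k : RR) : CC) * (w ^ (2*k) / (2*k).factorial) with hf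
  have hint : ∀ k, Integrable (fun s : RR => s ^ k) μ := fun k => by
    refine Integrable.of_bound (by fun_prop) 1 ?_
    filter_upwards [hs] with s hs
    rw [norm_pow, Real.norm_of_nonneg hs.1]
    exact pow_le_one₀ hs.1 hs.2
  have h2 : Summable (fun k : ℕ => ‖w‖ ^ (2*k) / (2*k).factorial) :=
    (Real.summable_pow_div_factorial ‖w‖).comp_injective (fun a b h => by simpa using h)
  have h1 := hasSum_integral_of_summable_integral_norm (μ := μ) (F := f)
    (fun k => (hint k).ofReal.mul_const _) (by
      refine Summable.of_nonneg_of_le (fun k => integral_nonneg fun _ => norm_nonneg _) (fun k => ?_) h2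
      have : ∫ s, ‖f k s‖ ∂μ ≤ ∫ s, ‖w‖ ^ (2*k) / (2*k).factorial ∂μ := by
        refine integral_mono_ae ((hint k).ofReal.mul_const _).norm (integrable_const _) ?_
        filter_upwards [hs] with s hs
        simp only [hf, norm_mul, Complex.norm_real, norm_pow, norm_div, Complex.norm_natCast,
          Real.norm_of_nonneg hs.1]
        exact mul_le_of_le_one_left (by positivity) (pow_le_one₀ hs.1 hs.2)
      simpa using this)
  have h3 : ∀ k, ∫ s, f k s ∂μ = (be b k : CC) * (w^2/4)^k := by
    intro k
    simp only [hf]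
    rw [integral_mul_const, integral_complex_ofReal, hm, mom]
    push_cast
    have : ((2*k).factorial : CC) ≠ 0 := by exact_mod_cast Nat.factorial_ne_zero _
    rw [div_pow, ← pow_mul]
    field_simp
  simp_rw [h3] at h1
  rw [(Phi_hasSum hb _).unique h1]
  have h4 : ∀ᵐ s ∂μ, ‖∑' k, f k s‖ ≤ Real.exp |w.re| := by
    filter_upwards [hs] with s hs
    have : HasSum (fun k => f k s) (Complex.cosh (w * (Real.sqrt s : CC))) := by
      convert! Complex.hasSum_cosh (w * (Real.sqrt s : CC)) using 2 with k
      simp only [hf]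
      rw [mul_pow, ← Complex.ofReal_pow (Real.sqrt s), pow_mul (Real.sqrt s), Real.sq_sqrt hs.1]
      push_cast; ring
    rw [this.tsum_eq]
    refine (norm_cosh_le _).trans (Real.exp_le_exp.2 ?_)
    rw [Complex.re_mul_ofReal, abs_mul, abs_of_nonneg (Real.sqrt_nonneg s)]
    exact mul_le_of_le_one_right (abs_nonneg _) (Real.sqrt_le_one.2 hs.2)
  simpa using norm_integral_le_of_norm_le_const h4

lemma Phi_neg_bound {b : RR} (hb : 1/2 ≤ b) (x : RR) : ‖Phi b (-((x^2/4 : RR):CC))‖ ≤ 1 := by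
  have := Phi_bound hb (Complex.I * x)
  rw [mul_pow, Complex.I_sq] at this
  simpa [neg_div] using this

lemma vander1 (k : ℕ) : ∀ (l : ℕ) (b : RR), 0 < b →
    ∑ m ∈ Finset.range (k+1), (k.choose m : RR) * (l.descFactorial m : RR) * (Real.Gamma (b+k) / Real.Gamma (b+m))
      = Real.Gamma (b+l+k) / Real.Gamma (b+l) := by
  induction k with
  | zero =>
    intro l b hb
    have h1 := (Real.Gamma_pos_of_pos hb).ne'
    have h2 : Real.Gamma (b+l) ≠ 0 := (Real.Gamma_pos_of_pos (by positivity)).ne'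
    simp [h1, h2]
  | succ k ih =>
    intro l b hb
    have hG : ∀ c : RR, 0 < c → Real.Gamma (c + (k+1:ℕ)) = (c + k) * Real.Gamma (c + k) := by
      intro c hc
      rw [← Real.Gamma_add_one (by positivity)]; push_cast; congr 1; ring
    have h1 : ∀ m ∈ Finset.range (k+1), ((k+1).choose (m+1) : RR) * (l.descFactorial (m+1) : RR) *
          (Real.Gamma (b+(k+1:ℕ)) / Real.Gamma (b+(m+1:ℕ))) =
        (k.choose m : RR) * (l.descFactorial (m+1) : RR) *
          (Real.Gamma (b+1+k) / Real.Gamma (b+1+m)) +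
        (b + k) * ((k.choose (m+1) : RR) * (l.descFactorial (m+1) : RR) *
          (Real.Gamma (b+k) / Real.Gamma (b+(m+1:ℕ)))) := by
      intro m _
      rw [Nat.choose_succ_succ, show b + 1 + (m:RR) = b + (m+1:ℕ) by push_cast; ring,
        show b + 1 + (k:RR) = b + (k+1:ℕ) by push_cast; ring, hG b hb]
      push_cast; ring
    rw [Finset.sum_range_succ', Finset.sum_congr rfl h1, Finset.sum_add_distrib, ← Finset.mul_sum]
    have h2 := ih l b hb
    rw [Finset.sum_range_succ'] at h2
    have h3 : ∑ m ∈ Finset.range (k+1), (k.choose (m+1) : RR) * (l.descFactorial (m+1) : RR) *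
          (Real.Gamma (b+k) / Real.Gamma (b+(m+1:ℕ))) = ∑ m ∈ Finset.range k, (k.choose (m+1) : RR) * (l.descFactorial (m+1) : RR) *
          (Real.Gamma (b+k) / Real.Gamma (b+(m+1:ℕ))) := by
      rw [Finset.sum_range_succ, Nat.choose_succ_self]; simp
    rw [h3]
    have h4 : ∑ m ∈ Finset.range (k+1), (k.choose m : RR) * (l.descFactorial (m+1) : RR) *
          (Real.Gamma (b+1+k) / Real.Gamma (b+1+m)) = l * (Real.Gamma (b+l+k) / Real.Gamma (b+l)) := by
      cases l with
      | zero => simp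
      | succ l =>
        have := ih l (b+1) (by positivity)
        rw [show b + (l+1:ℕ) = b+1+l by push_cast; ring, ← this, Finset.mul_sum]
        refine Finset.sum_congr rfl fun m _ => ?_
        rw [Nat.succ_descFactorial_succ]; push_cast; ring
    rw [h4, hG (b+l) (by positivity), mul_div_assoc]
    rw [show b + (l:RR) + k = l + (b + k) by ring] at *
    rw [add_mul, ← h2, hG b hb, mul_add]
    simp only [Nat.choose_zero_right, Nat.descFactorial_zero]
    ring

lemma vander {b : RR} (hb : 0 < b) (k l : ℕ) :
    ∑ m ∈ Finset.range (l+1), (if m ≤ k then be b m / (k-m).factorial else 0) * (1 / (l-m).factorial : RR)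
      = be b k * be b l * Real.Gamma (k+l+b) / Real.Gamma b := by
  have h := vander1 l k b hb
  have e1 := Real.Gamma_pos_of_pos hb
  have e2 : 0 < Real.Gamma (b+k) := Real.Gamma_pos_of_pos (by positivity)
  have e3 : 0 < Real.Gamma (b+l) := Real.Gamma_pos_of_pos (by positivity)
  have h1 : be b k * be b l * Real.Gamma (k+l+b) / Real.Gamma b =
      Real.Gamma b / (k.factorial * l.factorial * Real.Gamma (b+l)) * (Real.Gamma (b+k+l) / Real.Gamma (b+k)) := by
    unfold be
    rw [add_comm (k:RR) b, add_comm (l:RR) b, show (k:RR)+l+b = b+k+l by ring]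
    field_simp
  rw [h1, ← h, Finset.mul_sum]
  refine Finset.sum_congr rfl fun m hm => ?_
  have hml : m ≤ l := by simpa [Nat.lt_succ_iff] using hm
  have e4 : 0 < Real.Gamma (b+m) := Real.Gamma_pos_of_pos (by positivity)
  split_ifs with hmk
  · rw [Nat.cast_choose RR hml]
    have h5 : ((k-m).factorial : RR) * (k.descFactorial m) = k.factorial := by
      exact_mod_cast Nat.factorial_mul_descFactorial hmk
    rw [← h5]
    have h6 : (0:RR) < k.descFactorial m := by exact_mod_cast Nat.pos_of_ne_zero (by simpa using hmk)
    unfold be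
    rw [add_comm (m:RR) b]
    field_simp
  · rw [Nat.descFactorial_of_lt (by omega)]; simp

lemma exp_cexp_hasSum (y : CC) : HasSum (fun n : ℕ => ((1 / n.factorial : RR) : CC) * y ^ n) (cexp y) := by
  have := NormedSpace.expSeries_div_hasSum_exp (𝔸 := CC) y
  rw [← Complex.exp_eq_exp_ℂ] at this
  convert! this using 2 with n
  push_cast; ring

lemma exp_norm_summable (y : CC) : Summable (fun n : ℕ => ‖((1 / n.factorial : RR) : CC) * y ^ n‖) := by
  convert Real.summable_pow_div_factorial ‖y‖ using 2 with n
  simp; ring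

lemma kummer {b : RR} (hb : 1/2 ≤ b) (k : ℕ) (y : CC) :
    Summable (fun l : ℕ => ‖((be b k * be b l * Real.Gamma (k+l+b) / Real.Gamma b : RR) : CC) * y ^ l‖) ∧
    HasSum (fun l : ℕ => ((be b k * be b l * Real.Gamma (k+l+b) / Real.Gamma b : RR) : CC) * y ^ l)
      (cexp y * ∑ m ∈ Finset.range (k+1), ((be b m / (k-m).factorial : RR) : CC) * y ^ m) := by
  have hb0 : 0 < b := by linarith
  set f : ℕ → CC := fun m => ((if m ≤ k then be b m / (k-m).factorial else 0 : RR) : CC) * y ^ m with hf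
  set g : ℕ → CC := fun n => ((1 / n.factorial : RR) : CC) * y ^ n with hg
  have hfs : ∀ m ∉ Finset.range (k+1), f m = 0 := by
    intro m hm
    have : ¬ m ≤ k := by simpa [Nat.lt_succ_iff] using hm
    simp [hf, this]
  have hF : Summable (fun m => ‖f m‖) := summable_of_ne_finset_zero (s := Finset.range (k+1))
    (fun m hm => by rw [hfs m hm, norm_zero])
  have hG : Summable (fun n => ‖g n‖) := exp_norm_summable y
  have hterm : ∀ l, ∑ m ∈ Finset.range (l+1), f m * g (l-m) =
      ((be b k * be b l * Real.Gamma (k+l+b) / Real.Gamma b : RR) : CC) * y ^ l := by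
    intro l
    rw [← vander hb0, Complex.ofReal_sum, Finset.sum_mul]
    refine Finset.sum_congr rfl fun m hm => ?_
    have hml : m ≤ l := by simpa [Nat.lt_succ_iff] using hm
    simp only [hf, hg]
    rw [← pow_mul_pow_sub y hml]
    push_cast; ring
  have s1 := summable_norm_sum_mul_range_of_summable_norm hF hG
  have s2 := tsum_mul_tsum_eq_tsum_sum_range_of_summable_norm hF hG
  simp_rw [hterm] at s1 s2
  refine ⟨s1, ?_⟩
  have : HasSum (fun l : ℕ => ((be b k * be b l * Real.Gamma (k+l+b) / Real.Gamma b : RR) : CC) * y ^ l) _ := s1.of_norm.hasSum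
  rw [← s2, (exp_cexp_hasSum y).tsum_eq, tsum_eq_sum hfs, mul_comm _ (cexp y)] at this
  convert this using 2
  refine Finset.sum_congr rfl fun m hm => ?_
  have hml : m ≤ k := by simpa [Nat.lt_succ_iff] using hm
  simp [hf, hml]

lemma kummer2 {b : RR} (hb : 1/2 ≤ b) (x y : CC) :
    HasSum (fun k : ℕ => x ^ k * ∑ m ∈ Finset.range (k+1), ((be b m / (k-m).factorial : RR) : CC) * y ^ m)
      (cexp x * Phi b (x * y)) := by
  set g : ℕ → CC := fun n => ((1 / n.factorial : RR) : CC) * x ^ n with hg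
  have hF := be_summable hb (x*y)
  have hG := exp_norm_summable x
  have s1 := summable_norm_sum_mul_range_of_summable_norm hF hG
  have s2 := tsum_mul_tsum_eq_tsum_sum_range_of_summable_norm hF hG
  have := s1.of_norm.hasSum
  rw [← s2, (exp_cexp_hasSum x).tsum_eq, mul_comm _ (cexp x)] at this
  convert! this using 2 with k
  rw [Finset.mul_sum]
  refine Finset.sum_congr rfl fun m hm => ?_
  have hml : m ≤ k := by simpa [Nat.lt_succ_iff] using hm
  rw [mul_pow, ← pow_mul_pow_sub x hml]
  push_cast; ring

lemma integrable_pow_cgauss_ma {a : RR} (ha : -1 < a) (n : ℕ) {p : CC} (hp : 0 < p.re) :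
    Integrable (fun z : RR => (z:CC) ^ (2 * n) * cexp (-p * (z:CC) ^ 2)) (ma a) := by
  refine (integrable_pow_gauss_ma ha n hp).mono' (by fun_prop) (ae_of_all _ fun z => ?_)
  rw [norm_mul, Complex.norm_exp, norm_pow, Complex.norm_real, pow_mul, pow_mul, Real.norm_eq_abs, sq_abs]
  apply le_of_eq
  congr 2
  have : ((z:CC)^2) = ((z^2 : RR):CC) := by push_cast; rfl
  rw [this, Complex.re_mul_ofReal]; simp

lemma norm_pow_cgauss (n : ℕ) (p : CC) (z : RR) : ‖(z:CC) ^ (2 * n) * cexp (-p * (z:CC) ^ 2)‖ =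
    z ^ (2*n) * Real.exp (-p.re * z^2) := by
  rw [norm_mul, Complex.norm_exp, norm_pow, Complex.norm_real, pow_mul, pow_mul, Real.norm_eq_abs, sq_abs]
  congr 2
  have : ((z:CC)^2) = ((z^2 : RR):CC) := by push_cast; rfl
  rw [this, Complex.re_mul_ofReal]; simp

lemma weberJ {a : RR} (ha : 0 ≤ a) (k : ℕ) (β : RR) {p : CC} (hp : 0 < p.re) :
    (be ((a+1)/2) k : CC) * ∫ ζ : RR, (ζ:CC)^(2*k) * cexp (-p * (ζ:CC)^2) *
        Phi ((a+1)/2) (-(((β*ζ)^2/4 : RR):CC)) ∂(ma a) =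
      (Real.Gamma ((a+1)/2) / 2 : RR) * p ^ (-(((a+1)/2 : RR):CC)) * (p⁻¹ ^ k *
        (cexp (-((β^2/4:RR):CC)/p) * ∑ m ∈ Finset.range (k+1),
          ((be ((a+1)/2) m / (k-m).factorial : RR) : CC) * (-((β^2/4:RR):CC)/p) ^ m)) := by
  set b := (a+1)/2 with hbd
  have hb : 1/2 ≤ b := by rw [hbd]; linarith
  have hb0 : 0 < b := by linarith
  have ha' : -1 < a := by linarith
  have hp0 : p ≠ 0 := by rintro rfl; simp at hp
  have hG := Real.Gamma_pos_of_pos hb0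
  have hk := be_pos hb0 k
  set B : CC := -((β^2/4:RR):CC) with hB
  set F : ℕ → RR → CC := fun l ζ => ((be b l : CC) * B ^ l) * ((ζ:CC)^(2*(k+l)) * cexp (-p * (ζ:CC)^2)) with hF
  have hFi : ∀ l, Integrable (F l) (ma a) := fun l => (integrable_pow_cgauss_ma ha' _ hp).const_mul _
  have hFn : ∀ l, ∫ ζ, ‖F l ζ‖ ∂(ma a) = (Real.Gamma b / be b k / 2 * p.re ^ (-((k:RR)+b))) *
      ‖((be b k * be b l * Real.Gamma (k+l+b) / Real.Gamma b : RR) : CC) * (B / (p.re:CC)) ^ l‖ := by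
    intro l
    simp only [hF, norm_mul (_ * _), norm_pow_cgauss, integral_const_mul]
    rw [integral_pow_gauss_ma ha' _ hp, ← hbd]
    have h1 := be_pos hb0 l
    have hG2 : 0 < Real.Gamma (k+l+b) := Real.Gamma_pos_of_pos (by positivity)
    rw [norm_mul, norm_mul, norm_pow, norm_pow, norm_div, Complex.norm_real, Complex.norm_real, Complex.norm_real,
      Real.norm_of_nonneg h1.le, Real.norm_of_nonneg hp.le, Real.norm_of_nonneg (by positivity), div_pow]
    rw [show -(((k+l:ℕ):RR) + b) = -((k:RR)+b) - l by push_cast; ring, Real.rpow_sub hp, Real.rpow_natCast]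
    push_cast
    field_simp
  have hs := hasSum_integral_of_summable_integral_norm (μ := ma a) (F := F) hFi (by
    simp_rw [hFn]
    exact (kummer hb k _).1.mul_left _)
  have h2 : ∀ ζ : RR, ∑' l, F l ζ = (ζ:CC)^(2*k) * cexp (-p * (ζ:CC)^2) * Phi b (-(((β*ζ)^2/4 : RR):CC)) := by
    intro ζ
    rw [← ((Phi_hasSum hb (-(((β*ζ)^2/4 : RR):CC))).mul_left ((ζ:CC)^(2*k) * cexp (-p * (ζ:CC)^2))).tsum_eq]
    congr 1; ext l
    simp only [hF, hB]
    rw [show -(((β*ζ)^2/4 : RR):CC) = -((β^2/4:RR):CC) * (ζ:CC)^2 by push_cast; ring, mul_pow _ ((ζ:CC)^2),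
      ← pow_mul, mul_add 2 k l, pow_add]
    ring
  simp_rw [h2] at hs
  have h3 : ∀ l, ∫ ζ, F l ζ ∂(ma a) = ((Real.Gamma b / 2 : RR) * p ^ (-(b:CC)) * p⁻¹ ^ k / (be b k:CC)) *
      (((be b k * be b l * Real.Gamma (k+l+b) / Real.Gamma b : RR) : CC) * (B / p) ^ l) := by
    intro l
    simp only [hF, integral_const_mul]
    rw [integral_pow_cgauss_ma ha' _ hp, ← hbd]
    rw [show (-(((k+l:ℕ):RR) + b : RR):CC) = -(b:CC) - ((k+l:ℕ):CC) by push_cast; ring, Complex.cpow_sub _ _ hp0,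
      Complex.cpow_natCast, div_pow, pow_add, inv_pow]
    have hG' : (Real.Gamma b : CC) ≠ 0 := by exact_mod_cast hG.ne'
    have hk' : (be b k : CC) ≠ 0 := by exact_mod_cast hk.ne'
    push_cast
    field_simp
  simp_rw [h3] at hs
  have h4 := hs.unique ((kummer hb k (B/p)).2.mul_left _)
  rw [h4]
  have hk' : (be b k : CC) ≠ 0 := by exact_mod_cast hk.ne'
  field_simp

/-- Weber's second exponential integral. -/
lemma weber {a : RR} (ha : 0 ≤ a) (α β : RR) {p : CC} (hp : 0 < p.re) :
    ∫ ζ : RR, Phi ((a+1)/2) (-(((α*ζ)^2/4 : RR):CC)) * Phi ((a+1)/2) (-(((β*ζ)^2/4 : RR):CC)) *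
        cexp (-p * (ζ:CC)^2) ∂(ma a) =
      (Real.Gamma ((a+1)/2) / 2 : RR) * p ^ (-(((a+1)/2 : RR):CC)) *
        (cexp (-(((α^2+β^2)/4:RR):CC)/p) * Phi ((a+1)/2) ((((α*β/2 : RR):CC)/p)^2/4)) := by
  set b := (a+1)/2 with hbd
  have hb : 1/2 ≤ b := by rw [hbd]; linarith
  have hb0 : 0 < b := by linarith
  have ha' : -1 < a := by linarith
  have hp0 : p ≠ 0 := by rintro rfl; simp at hp
  have hG := Real.Gamma_pos_of_pos hb0
  set A : CC := -((α^2/4:RR):CC) with hA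
  set F : ℕ → RR → CC := fun k ζ => ((be b k : CC) * A ^ k) * ((ζ:CC)^(2*k) * cexp (-p * (ζ:CC)^2) *
    Phi b (-(((β*ζ)^2/4 : RR):CC))) with hF
  have hPm : ∀ β : RR, Measurable (fun ζ : RR => Phi b (-(((β*ζ)^2/4 : RR):CC))) := fun β =>
    (Phi_measurable hb).comp (by fun_prop)
  have hFi : ∀ l, Integrable (F l) (ma a) := fun l =>
    (((integrable_pow_cgauss_ma ha' _ hp).mul_bdd (c := 1) (hPm β).aestronglyMeasurable
      (ae_of_all _ fun ζ => Phi_neg_bound hb _))).const_mul _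
  have hFn : ∀ k, ∫ ζ, ‖F k ζ‖ ∂(ma a) ≤ (Real.Gamma b / 2 * p.re ^ (-b)) *
      ((α^2/4/p.re)^k / k.factorial) := by
    intro k
    have hk := be_pos hb0 k
    have : ∫ ζ, ‖F k ζ‖ ∂(ma a) ≤ ∫ ζ, (be b k * (α^2/4)^k) * (ζ ^ (2*k) * Real.exp (-p.re * ζ^2)) ∂(ma a) := by
      refine integral_mono (hFi k).norm ((integrable_pow_gauss_ma ha' _ hp).const_mul _) fun ζ => ?_
      simp only [hF]
      rw [norm_mul, norm_mul (_ * _) (Phi _ _), norm_pow_cgauss, norm_mul, norm_pow, hA, norm_neg,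
        Complex.norm_real, Complex.norm_real, Real.norm_of_nonneg hk.le, Real.norm_of_nonneg (by positivity)]
      have h0 : 0 ≤ ζ ^ (2*k) * Real.exp (-p.re * ζ^2) := by rw [pow_mul]; positivity
      exact mul_le_mul_of_nonneg_left (mul_le_of_le_one_right h0 (Phi_neg_bound hb _)) (by positivity)
    refine this.trans (le_of_eq ?_)
    rw [integral_const_mul, integral_pow_gauss_ma ha' _ hp, ← hbd]
    have hG2 : 0 < Real.Gamma (k+b) := Real.Gamma_pos_of_pos (by positivity)
    rw [show -((k:RR) + b) = -b - k by ring, Real.rpow_sub hp, Real.rpow_natCast, be, div_pow _ p.re]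
    field_simp
  have hs := hasSum_integral_of_summable_integral_norm (μ := ma a) (F := F) hFi
    (Summable.of_nonneg_of_le (fun _ => integral_nonneg fun _ => norm_nonneg _) hFn
      ((Real.summable_pow_div_factorial _).mul_left _))
  have h2 : ∀ ζ : RR, ∑' l, F l ζ = Phi b (-(((α*ζ)^2/4 : RR):CC)) * Phi b (-(((β*ζ)^2/4 : RR):CC)) *
        cexp (-p * (ζ:CC)^2) := by
    intro ζ
    have := ((Phi_hasSum hb (-(((α*ζ)^2/4 : RR):CC))).mul_left
      (cexp (-p * (ζ:CC)^2) * Phi b (-(((β*ζ)^2/4 : RR):CC)))).tsum_eq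
    rw [show Phi b (-(((α*ζ)^2/4 : RR):CC)) * Phi b (-(((β*ζ)^2/4 : RR):CC)) *
        cexp (-p * (ζ:CC)^2) = (cexp (-p * (ζ:CC)^2) * Phi b (-(((β*ζ)^2/4 : RR):CC))) * Phi b (-(((α*ζ)^2/4 : RR):CC)) by ring,
      ← this]
    congr 1; ext l
    simp only [hF, hA]
    rw [show -(((α*ζ)^2/4 : RR):CC) = -((α^2/4:RR):CC) * (ζ:CC)^2 by push_cast; ring, mul_pow _ ((ζ:CC)^2),
      ← pow_mul]
    ring
  simp_rw [h2] at hs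
  have h3 : ∀ k, ∫ ζ, F k ζ ∂(ma a) = ((Real.Gamma b / 2 : RR) * p ^ (-(b:CC)) * cexp (-((β^2/4:RR):CC)/p)) *
      ((A/p) ^ k * ∑ m ∈ Finset.range (k+1),
          ((be b m / (k-m).factorial : RR) : CC) * (-((β^2/4:RR):CC)/p) ^ m) := by
    intro k
    simp only [hF, integral_const_mul]
    rw [mul_right_comm, weberJ ha k β hp, ← hbd, div_pow A, inv_pow]
    ring
  simp_rw [h3] at hs
  have h4 := hs.unique ((kummer2 hb (A/p) _).mul_left _)
  rw [h4, show -(((α^2+β^2)/4:RR):CC)/p = -((β^2/4:RR):CC)/p + A/p by rw [hA]; push_cast; ring, Complex.exp_add,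
    show (((α*β/2 : RR):CC)/p)^2/4 = A / p * (-((β^2/4:RR):CC)/p) by rw [hA]; push_cast; field_simp; norm_num]
  ring

lemma weber_bound {a : RR} (ha : 0 ≤ a) (α β : RR) {p : CC} (hp : 0 < p.re) :
    ‖∫ ζ : RR, Phi ((a+1)/2) (-(((α*ζ)^2/4 : RR):CC)) * Phi ((a+1)/2) (-(((β*ζ)^2/4 : RR):CC)) *
        cexp (-p * (ζ:CC)^2) ∂(ma a)‖ ≤ Real.Gamma ((a+1)/2) / 2 * ‖p‖ ^ (-((a+1)/2)) := by
  have hb : 1/2 ≤ (a+1)/2 := by linarith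
  have hb0 : 0 < (a+1)/2 := by linarith
  have hG := Real.Gamma_pos_of_pos hb0
  have hp0 : p ≠ 0 := by rintro rfl; simp at hp
  rw [weber ha α β hp, norm_mul, norm_mul, Complex.norm_real, Real.norm_of_nonneg (by positivity),
    ← Complex.ofReal_neg, Complex.norm_cpow_real]
  refine mul_le_of_le_one_right (by positivity) ?_
  rw [norm_mul, Complex.norm_exp]
  refine (mul_le_mul_of_nonneg_left (Phi_bound hb _) (Real.exp_nonneg _)).trans ?_
  rw [← Real.exp_add]
  refine Real.exp_le_one_iff.2 ?_
  set c := (p⁻¹).re with hc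
  have hc0 : 0 < c := by
    rw [hc, Complex.inv_re]; exact div_pos hp (Complex.normSq_pos.2 hp0)
  rw [div_eq_mul_inv _ p, div_eq_mul_inv _ p, ← Complex.ofReal_neg, Complex.re_ofReal_mul, Complex.re_ofReal_mul, ← hc, abs_mul, abs_of_pos hc0]
  have : |α * β / 2| ≤ (α^2+β^2)/4 := by
    rw [abs_le]; constructor <;> nlinarith [sq_nonneg (α-β), sq_nonneg (α+β)]
  nlinarith

lemma weber_mass {a : RR} (ha : 0 ≤ a) (α : RR) {ε κ : RR} (hε : 0 < ε) (hκ : 0 < κ) :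
    ∫⁻ β, ‖∫ ζ : RR, Phi ((a+1)/2) (-(((α*ζ)^2/4 : RR):CC)) * Phi ((a+1)/2) (-(((κ*β*ζ)^2/4 : RR):CC)) *
        cexp (-(ε:CC) * (ζ:CC)^2) ∂(ma a)‖ₑ ∂(ma a) ≤
      eo ((Real.Gamma ((a+1)/2) / 2)^2 * 4 ^ ((a+1)/2) * κ ^ (-(a+1))) := by
  set b := (a+1)/2 with hbd
  have hb : 1/2 ≤ b := by rw [hbd]; linarith
  have hb0 : 0 < b := by linarith
  have hG := Real.Gamma_pos_of_pos hb0
  have ha' : -1 < a := by linarith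
  set η := κ^2/(4*ε) with hη
  have hη0 : 0 < η := by positivity
  set D := (Real.Gamma b / 2) * ε ^ (-b) * Real.exp (-α^2/4/ε) with hD
  have hD0 : 0 ≤ D := by positivity
  have h1 : ∀ β : RR, ‖∫ ζ : RR, Phi b (-(((α*ζ)^2/4 : RR):CC)) * Phi b (-(((κ*β*ζ)^2/4 : RR):CC)) *
        cexp (-(ε:CC) * (ζ:CC)^2) ∂(ma a)‖ₑ ≤ ∑' k : ℕ, eo (D * (be b k * (κ^2*α^2/(16*ε^2))^k) *
          (β ^ (2*k) * Real.exp (-η * β^2))) := by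
    intro β
    have hh : HasSum (fun k : ℕ => ((D * (be b k * (κ^2*α^2/(16*ε^2))^k) *
          (β ^ (2*k) * Real.exp (-η * β^2)) : RR):CC)) (∫ ζ : RR, Phi b (-(((α*ζ)^2/4 : RR):CC)) * Phi b (-(((κ*β*ζ)^2/4 : RR):CC)) *
        cexp (-(ε:CC) * (ζ:CC)^2) ∂(ma a)) := by
      rw [weber ha α (κ*β) (p := (ε:CC)) (by simpa using hε), ← hbd]
      have := (Phi_hasSum hb ((((α*(κ*β)/2 : RR):CC)/(ε:CC))^2/4)).mul_left (((Real.Gamma b / 2 : RR):CC) * (ε:CC) ^ (-(b:CC)) * cexp (-(((α^2+(κ*β)^2)/4:RR):CC)/(ε:CC)))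
      rw [← mul_assoc]
      convert! this using 2 with k
      have e1 : (ε:CC) ^ (-(b:CC)) = ((ε ^ (-b) : RR):CC) := by
        rw [Complex.ofReal_cpow hε.le]; simp
      rw [e1, show -(((α^2+(κ*β)^2)/4:RR):CC)/(ε:CC) = ((-α^2/4/ε + -η * β^2 : RR):CC) by
          rw [hη]; push_cast; field_simp; ring,
        show (((α*(κ*β)/2 : RR):CC)/(ε:CC))^2/4 = ((κ^2*α^2/(16*ε^2) * β^2 : RR):CC) by push_cast; field_simp; norm_num; ring,
        ← Complex.ofReal_exp, Real.exp_add]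
      rw [hD, pow_mul]
      push_cast
      ring
    rw [← hh.tsum_eq]
    refine (enorm_tsum_le_tsum_enorm).trans (ENNReal.tsum_le_tsum fun k => ?_)
    have hk := be_pos hb0 k
    rw [← ofReal_norm, Complex.norm_real, Real.norm_of_nonneg (by rw [pow_mul]; positivity)]
  refine (lintegral_mono h1).trans ?_
  rw [lintegral_tsum (fun k => by fun_prop)]
  have h2 : ∀ k : ℕ, ∫⁻ β, eo (D * (be b k * (κ^2*α^2/(16*ε^2))^k) *
          (β ^ (2*k) * Real.exp (-η * β^2))) ∂(ma a) =
      eo ((D * (Real.Gamma b / 2) * η ^ (-b)) * ((α^2/4/ε)^k / k.factorial)) := by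
    intro k
    have hk := be_pos hb0 k
    have hG2 : 0 < Real.Gamma (k+b) := Real.Gamma_pos_of_pos (by positivity)
    rw [← ofReal_integral_eq_lintegral_ofReal ((integrable_pow_gauss_ma ha' k hη0).const_mul _)
      (ae_of_all _ fun β => by simp only [Pi.zero_apply]; rw [pow_mul]; positivity), integral_const_mul,
      integral_pow_gauss_ma ha' k hη0, ← hbd]
    congr 1
    rw [show -((k:RR) + b) = -b - k by ring, Real.rpow_sub hη0, Real.rpow_natCast, be,
      show α^2/4/ε = (κ^2*α^2/(16*ε^2)) / η by rw [hη]; field_simp; norm_num, div_pow _ η]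
    field_simp
  simp_rw [h2]
  rw [← ENNReal.ofReal_tsum_of_nonneg (fun k => by positivity)
    ((Real.summable_pow_div_factorial _).mul_left _), tsum_mul_left]
  have h3 : ∑' k : ℕ, (α^2/4/ε)^k / (k.factorial:RR) = Real.exp (α^2/4/ε) := by
    rw [Real.exp_eq_exp_ℝ, NormedSpace.exp_eq_tsum_div]
  rw [h3]
  apply le_of_eq
  congr 1
  rw [hD, hη, div_eq_mul_inv (κ^2) (4*ε), Real.mul_rpow (by positivity) (by positivity), Real.inv_rpow (by positivity), Real.rpow_neg (x := 4*ε) (by positivity) b, inv_inv, Real.mul_rpow (by norm_num) hε.le,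
    Real.rpow_neg hε.le, neg_div, neg_div, Real.exp_neg]
  have := Real.rpow_pos_of_pos hε b
  rw [← Real.rpow_natCast κ 2, ← Real.rpow_mul hκ.le, show (((2:ℕ):RR) * (-b)) = -(a+1) by rw [hbd]; push_cast; ring]
  field_simp

def cS (a : RR) : RR := 2 ^ (-a) / Real.Gamma ((a+1)/2)

def Sh (a z ζ t : RR) : CC :=
  (cS a : CC) * cexp (-Complex.I * ((Real.sign t : RR) : CC) * (((a + 1) * Real.pi / 4 : RR) : CC)) *
    ((|t| ^ (-((a + 1) / 2)) : RR) : CC) * Phi ((a+1)/2) (-(((z*ζ/(2*|t|))^2/4 : RR):CC)) *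
    cexp (Complex.I * ((z ^ 2 + ζ ^ 2 : RR) : CC) / ((4 * t : RR) : CC))

lemma cS_pos {a : RR} (ha : 0 ≤ a) : 0 < cS a := by
  have := Real.Gamma_pos_of_pos (show 0 < (a+1)/2 by linarith)
  unfold cS; positivity

lemma Sh_symm (a z ζ t : RR) : Sh a z ζ t = Sh a ζ z t := by
  unfold Sh; rw [mul_comm z ζ, add_comm (z^2)]

lemma Phi_zero {b : RR} (hb : 1/2 ≤ b) : Phi b 0 = 1 := by
  unfold Phi
  rw [tsum_eq_single 0 (fun k hk => by simp [hk])]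
  simp [be_zero (show 0 < b by linarith)]

lemma Sa0_eq {a : RR} (ha : 0 ≤ a) (z t : RR) : Sa0 a z t = Sh a z 0 t := by
  unfold Sa0 Sh cS
  have h : Phi ((a+1)/2) (-(((z*0/(2*|t|))^2/4 : RR):CC)) = 1 := by
    rw [← Phi_zero (b := (a+1)/2) (by linarith)]; congr 1; simp
  rw [h]; simp

lemma SaK_eq {a : RR} (ha : 0 ≤ a) {z ζ : RR} (hz : 0 < z) (hζ : 0 < ζ) (t : RR) : SaK a z ζ t = Sh a z ζ t := by
  have hb : 1/2 ≤ (a+1)/2 := by linarith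
  have hG := Real.Gamma_pos_of_pos (show 0 < (a+1)/2 by linarith)
  unfold SaK Sh cS
  rcases eq_or_ne t 0 with rfl | ht
  · rw [abs_zero, mul_zero, Real.zero_rpow (by linarith), Real.zero_rpow (by linarith)]; simp
  have ht' : 0 < |t| := abs_pos.2 ht
  set x := z * ζ / (2 * |t|) with hx
  have hx0 : 0 < x := by positivity
  have h1 : (((x ^ ((1-a)/2) : RR)):CC) * ((besselJ ((a-1)/2) x : RR):CC) =
      ((2 ^ ((1-a)/2) / Real.Gamma ((a+1)/2) : RR):CC) * Phi ((a+1)/2) (-((x^2/4 : RR):CC)) := by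
    unfold besselJ Phi
    rw [Complex.ofReal_tsum, ← tsum_mul_left, ← tsum_mul_left]
    congr 1; ext k
    rw [show (k:RR) + (a-1)/2 + 1 = k + (a+1)/2 by ring, Real.rpow_add (by positivity), be,
      show ((x/2) ^ (2*(k:RR)) : RR) = (x^2/4)^k by
        rw [show (2*(k:RR)) = ((2*k:ℕ):RR) by push_cast; rfl, Real.rpow_natCast, pow_mul]; congr 1; ring,
      show (a-1)/2 = -((1-a)/2) by ring, Real.rpow_neg (by positivity), Real.div_rpow hx0.le (by norm_num),
      neg_pow (((x^2/4 : RR):CC))]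
    have hG2 : 0 < Real.Gamma (k+(a+1)/2) := Real.Gamma_pos_of_pos (by positivity)
    have h2 := Real.rpow_pos_of_pos hx0 ((1-a)/2)
    have h3 := Real.rpow_pos_of_pos (show (0:RR) < 2 by norm_num) ((1-a)/2)
    rw [← Complex.ofReal_mul, ← Complex.ofReal_pow (x^2/4), show (-1:CC)^k = (((-1:RR)^k : RR):CC) by push_cast; rfl,
      ← Complex.ofReal_mul, ← Complex.ofReal_mul, ← Complex.ofReal_mul]
    congr 1
    field_simp
  rw [mul_assoc (_ / _), h1, Real.mul_rpow (by norm_num) ht'.le, Real.rpow_neg ht'.le]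
  have h4 : (2:RR) ^ ((1-a)/2) = 2 ^ (-a) * 2 ^ ((a+1)/2) := by
    rw [← Real.rpow_add (by norm_num)]; congr 1; ring
  rw [h4]
  have h3 := Real.rpow_pos_of_pos (show (0:RR) < 2 by norm_num) ((a+1)/2)
  have h5 := Real.rpow_pos_of_pos ht' ((a+1)/2)
  have h3' : ((2 ^ ((a+1)/2) : RR):CC) ≠ 0 := by exact_mod_cast h3.ne'
  have h5' : ((|t| ^ ((a+1)/2) : RR):CC) ≠ 0 := by exact_mod_cast h5.ne'
  have h6' : ((Real.Gamma ((a+1)/2) : RR):CC) ≠ 0 := by exact_mod_cast hG.ne'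
  simp only [Complex.ofReal_mul, Complex.ofReal_div, Complex.ofReal_inv]
  field_simp

lemma norm_exp_I1 (t a : RR) :
    ‖cexp (-Complex.I * ((Real.sign t : RR) : CC) * (((a + 1) * Real.pi / 4 : RR) : CC))‖ = 1 := by
  rw [show -Complex.I * ((Real.sign t : RR) : CC) * (((a + 1) * Real.pi / 4 : RR) : CC) =
    ((-(Real.sign t * ((a+1)*Real.pi/4)) : RR):CC) * Complex.I by push_cast; ring]
  exact Complex.norm_exp_ofReal_mul_I _

lemma norm_exp_I2 (x y : RR) : ‖cexp (Complex.I * (x:CC) / (y:CC))‖ = 1 := by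
  rw [show Complex.I * (x:CC) / (y:CC) = ((x/y : RR):CC) * Complex.I by push_cast; ring]
  exact Complex.norm_exp_ofReal_mul_I _

lemma norm_Sh_le {a : RR} (ha : 0 ≤ a) (z ζ t : RR) : ‖Sh a z ζ t‖ ≤ cS a * |t| ^ (-((a+1)/2)) := by
  unfold Sh
  have := cS_pos ha
  rw [norm_mul, norm_mul, norm_mul, norm_mul, norm_exp_I1, norm_exp_I2, Complex.norm_real, Complex.norm_real,
    Real.norm_of_nonneg this.le, Real.norm_of_nonneg (by positivity), mul_one, mul_one]
  exact mul_le_of_le_one_right (by positivity) (Phi_neg_bound (by linarith) _)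

lemma Sh_measurable {a : RR} (ha : 0 ≤ a) {T : Type*} [MeasurableSpace T] {f g h : T → RR} (hf : Measurable f)
    (hg : Measurable g) (hh : Measurable h) : Measurable (fun x => Sh a (f x) (g x) (h x)) := by
  unfold Sh
  have hs : Measurable Real.sign := by
    have : Real.sign = fun r : RR => if r < 0 then -1 else if 0 < r then (1:RR) else 0 := rfl
    rw [this]
    exact Measurable.ite measurableSet_Iio measurable_const (Measurable.ite measurableSet_Ioi measurable_const measurable_const)
  have hP := (Phi_measurable (b := (a+1)/2) (by linarith))
  have h1 : Measurable fun x => Real.sign (h x) := hs.comp hh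
  have h2 : Measurable fun x => Phi ((a+1)/2) (-(((f x*g x/(2*|h x|))^2/4 : RR):CC)) :=
    hP.comp (by fun_prop)
  fun_prop

lemma Sh_cross_norm {a : RR} (ha : 0 ≤ a) (u v τ σ ε : RR) :
    ‖∫ w, Sh a w u τ * (starRingEnd CC) (Sh a w v σ) * cexp (-(ε:CC) * (w:CC)^2) ∂(ma a)‖ =
     (cS a)^2 * |τ| ^ (-((a+1)/2)) * |σ| ^ (-((a+1)/2)) *
    ‖∫ w : RR, Phi ((a+1)/2) (-(((u/(2*|τ|)*w)^2/4 : RR):CC)) * Phi ((a+1)/2) (-(((v/(2*|σ|)*w)^2/4 : RR):CC)) *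
        cexp (-((ε:CC) - Complex.I * ((1/τ - 1/σ : RR):CC)/4) * (w:CC)^2) ∂(ma a)‖ := by
  have hc := cS_pos ha
  have hconj : ∀ x : RR, (starRingEnd CC) (Phi ((a+1)/2) (x:CC)) = Phi ((a+1)/2) (x:CC) := by
    intro x
    unfold Phi
    rw [show (fun k => ((be ((a+1)/2) k : CC) * (x:CC)^k)) = fun k => ((be ((a+1)/2) k * x^k : RR):CC) by
      ext k; push_cast; rfl, ← Complex.ofReal_tsum, Complex.conj_ofReal]
  set θ : CC := (cS a : CC) * cexp (-Complex.I * ((Real.sign τ : RR) : CC) * (((a + 1) * Real.pi / 4 : RR) : CC)) *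
    ((|τ| ^ (-((a + 1) / 2)) : RR) : CC) * cexp (Complex.I * ((u^2 : RR):CC) / ((4*τ:RR):CC)) *
    ((cS a : CC) * (starRingEnd CC) (cexp (-Complex.I * ((Real.sign σ : RR) : CC) * (((a + 1) * Real.pi / 4 : RR) : CC))) *
    ((|σ| ^ (-((a + 1) / 2)) : RR) : CC) * (starRingEnd CC) (cexp (Complex.I * ((v^2 : RR):CC) / ((4*σ:RR):CC)))) with hθ
  have hθn : ‖θ‖ = (cS a)^2 * |τ| ^ (-((a+1)/2)) * |σ| ^ (-((a+1)/2)) := by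
    rw [hθ]
    simp only [norm_mul, RCLike.norm_conj, norm_exp_I1, norm_exp_I2, Complex.norm_real]
    rw [Real.norm_of_nonneg hc.le, Real.norm_of_nonneg (by positivity), Real.norm_of_nonneg (by positivity)]
    ring
  rw [← hθn, ← norm_mul, ← integral_const_mul]
  congr 2; ext w
  unfold Sh
  have e1 : ∀ c s : RR, cexp (Complex.I * ((w^2 + c^2 : RR):CC) / ((4*s:RR):CC)) =
    cexp (Complex.I * ((w^2:RR):CC) / ((4*s:RR):CC)) * cexp (Complex.I * ((c^2:RR):CC) / ((4*s:RR):CC)) := by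
    intro c s
    rw [← Complex.exp_add]; congr 1; push_cast; ring
  have e2 : cexp (-((ε:CC) - Complex.I * ((1/τ - 1/σ : RR):CC)/4) * (w:CC)^2) =
      cexp (Complex.I * ((w^2:RR):CC) / ((4*τ:RR):CC)) * (starRingEnd CC) (cexp (Complex.I * ((w^2:RR):CC) / ((4*σ:RR):CC))) *
        cexp (-(ε:CC) * (w:CC)^2) := by
    rw [← Complex.exp_conj, ← Complex.exp_add, ← Complex.exp_add]; congr 1
    simp only [map_div₀, map_mul, Complex.conj_I, Complex.conj_ofReal]
    push_cast
    rw [mul_comm (4:CC) (τ:CC), mul_comm (4:CC) (σ:CC), ← div_div, ← div_div, div_eq_mul_inv _ (τ:CC), div_eq_mul_inv _ (σ:CC)]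
    ring
  rw [e1, e1, e2]
  have e3 : ∀ c s : RR, w * c / (2*|s|) = c/(2*|s|)*w := by intro c s; ring
  rw [e3, e3]
  simp only [map_mul, Complex.conj_ofReal]
  rw [show ∀ x : RR, -(x:CC) = ((-x:RR):CC) from fun x => by push_cast; rfl,
   show -((((v/(2*|σ|)*w)^2/4 : RR):CC)) = (((-((v/(2*|σ|)*w)^2/4)) : RR):CC) by push_cast; rfl, hconj, hθ]
  ring

lemma Sh_cross_bound {a : RR} (ha : 0 ≤ a) (u v : RR) {τ σ ε : RR} (hτ : τ ≠ 0) (hσ : σ ≠ 0) (hne : τ ≠ σ) (hε : 0 < ε) :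
    ‖∫ w, Sh a w u τ * (starRingEnd CC) (Sh a w v σ) * cexp (-(ε:CC) * (w:CC)^2) ∂(ma a)‖ ≤
     (cS a)^2 * (Real.Gamma ((a+1)/2) / 2 * 4 ^ ((a+1)/2)) * |τ - σ| ^ (-((a+1)/2)) := by
  have hc := cS_pos ha
  have hG := Real.Gamma_pos_of_pos (show 0 < (a+1)/2 by linarith)
  set p : CC := (ε:CC) - Complex.I * ((1/τ - 1/σ : RR):CC)/4 with hp
  have hp4 : p = (ε:CC) - Complex.I * (((1/τ - 1/σ)/4 : RR):CC) := by rw [hp]; push_cast; ring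
  have hpre : p.re = ε := by rw [hp4]; simp
  have hpim : p.im = -((1/τ - 1/σ)/4) := by rw [hp4]; simp
  rw [Sh_cross_norm ha, ← hp]
  have h1 := weber_bound ha (u/(2*|τ|)) (v/(2*|σ|)) (p := p) (by rw [hpre]; exact hε)
  refine (mul_le_mul_of_nonneg_left h1 (by positivity)).trans ?_
  have h2 : |τ - σ| / (4 * (|τ| * |σ|)) ≤ ‖p‖ := by
    refine le_trans (le_of_eq ?_) (Complex.abs_im_le_norm p)
    rw [hpim, show -((1/τ - 1/σ)/4) = (τ - σ)/(4*(τ*σ)) by field_simp; ring, abs_div, abs_mul, abs_mul]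
    norm_num
  have hτ' := abs_pos.2 hτ
  have hσ' := abs_pos.2 hσ
  have hd' := abs_pos.2 (sub_ne_zero.2 hne)
  have h3 : ‖p‖ ^ (-((a+1)/2)) ≤ (|τ - σ| / (4 * (|τ| * |σ|))) ^ (-((a+1)/2)) :=
    Real.rpow_le_rpow_of_nonpos (by positivity) h2 (by linarith)
  refine (mul_le_mul_of_nonneg_left (mul_le_mul_of_nonneg_left h3 (by positivity)) (by positivity)).trans (le_of_eq ?_)
  rw [Real.div_rpow hd'.le (by positivity), Real.mul_rpow (by norm_num) (by positivity), Real.mul_rpow hτ'.le hσ'.le,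
    Real.rpow_neg (x := 4) (by norm_num)]
  have := Real.rpow_pos_of_pos hτ' (-((a+1)/2))
  have := Real.rpow_pos_of_pos hσ' (-((a+1)/2))
  field_simp

lemma Sh_mass {a : RR} (ha : 0 ≤ a) (u : RR) {t ε : RR} (ht : t ≠ 0) (hε : 0 < ε) :
    ∫⁻ v, ‖∫ w, Sh a w u t * (starRingEnd CC) (Sh a w v t) * cexp (-(ε:CC) * (w:CC)^2) ∂(ma a)‖ₑ ∂(ma a) ≤
     eo ((cS a)^2 * ((Real.Gamma ((a+1)/2) / 2)^2 * 4 ^ ((a+1)/2) * 2 ^ (a+1))) := by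
  have hc := cS_pos ha
  have hG := Real.Gamma_pos_of_pos (show 0 < (a+1)/2 by linarith)
  have ht' := abs_pos.2 ht
  have h1 : ∀ v, ‖∫ w, Sh a w u t * (starRingEnd CC) (Sh a w v t) * cexp (-(ε:CC) * (w:CC)^2) ∂(ma a)‖ₑ =
      eo ((cS a)^2 * |t| ^ (-((a+1)/2)) * |t| ^ (-((a+1)/2))) *
      ‖∫ ζ : RR, Phi ((a+1)/2) (-(((u/(2*|t|)*ζ)^2/4 : RR):CC)) * Phi ((a+1)/2) (-((((1/(2*|t|))*v*ζ)^2/4 : RR):CC)) *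
        cexp (-(ε:CC) * (ζ:CC)^2) ∂(ma a)‖ₑ := by
    intro v
    rw [← ofReal_norm, Sh_cross_norm ha, ENNReal.ofReal_mul (by positivity), ofReal_norm]
    congr 3; ext w
    rw [sub_self, Complex.ofReal_zero, mul_zero, zero_div, sub_zero, one_div_mul_eq_div]
  simp_rw [h1]
  rw [lintegral_const_mul' _ _ (by simp)]
  refine (mul_le_mul_right (weber_mass ha (u/(2*|t|)) hε (κ := 1/(2*|t|)) (by positivity)) _).trans (le_of_eq ?_)
  rw [← ENNReal.ofReal_mul (by positivity)]
  congr 1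
  rw [one_div, Real.inv_rpow (by positivity), Real.rpow_neg (x := 2*|t|) (by positivity), inv_inv, Real.mul_rpow (by norm_num) ht'.le,
    show |t| ^ (a+1) = |t| ^ ((a+1)/2) * |t| ^ ((a+1)/2) by rw [← Real.rpow_add ht']; congr 1; ring,
    Real.rpow_neg ht'.le]
  have := Real.rpow_pos_of_pos ht' ((a+1)/2)
  field_simp

lemma norm_Sfree (d : ℕ) (x y : Ed d) {t : RR} (_ht : t ≠ 0) :
    ‖Sfree d x y t‖ = (4 * Real.pi * |t|) ^ (-(d:RR)/2) := by
  unfold Sfree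
  rw [norm_mul, norm_exp_I2, mul_one, show (-(d:CC)/2) = ((-(d:RR)/2 : RR):CC) by push_cast; rfl, Complex.norm_cpow_real]
  congr 1
  simp [abs_of_pos Real.pi_pos]

lemma Sfree_zero {d : ℕ} (hd : 1 ≤ d) (x y : Ed d) : Sfree d x y 0 = 0 := by
  unfold Sfree
  have : (-(d:CC)/2) ≠ 0 := by
    have : (d:CC) ≠ 0 := by exact_mod_cast (by omega : d ≠ 0)
    simpa using this
  simp only [Complex.ofReal_zero, mul_zero, Complex.zero_cpow this, zero_mul]

lemma norm_Sfree_le {d : ℕ} (hd : 1 ≤ d) (x y : Ed d) (t : RR) :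
    ‖Sfree d x y t‖ ≤ |t| ^ (-(d:RR)/2) := by
  rcases eq_or_ne t 0 with rfl | ht
  · rw [Sfree_zero hd, norm_zero]; positivity
  · rw [norm_Sfree d x y ht]
    refine Real.rpow_le_rpow_of_nonpos (abs_pos.2 ht) ?_ (by have : (0:RR) ≤ d := by positivity
                                                             linarith)
    have := Real.pi_gt_three
    nlinarith [abs_nonneg t]

lemma Sfree_symm (d : ℕ) (x y : Ed d) (t : RR) : Sfree d x y t = Sfree d y x t := by
  unfold Sfree
  simp only [fun i => show (x i - y i)^2 = (y i - x i)^2 by ring]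

lemma Sfree_measurable (d : ℕ) {T : Type*} [MeasurableSpace T] {f g : T → Ed d} {h : T → RR}
    (hf : Measurable f) (hg : Measurable g) (hh : Measurable h) :
    Measurable (fun x => Sfree d (f x) (g x) (h x)) := by
  unfold Sfree
  have hf' : ∀ i, Measurable fun x => f x i := fun i => (measurable_pi_apply i).comp hf
  have hg' : ∀ i, Measurable fun x => g x i := fun i => (measurable_pi_apply i).comp hg
  fun_prop

lemma integrable_gauss_E (d : ℕ) {ε : RR} (hε : 0 < ε) :
    Integrable (fun x : Ed d => Real.exp (-ε * ∑ i, x i ^ 2)) := by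
  have := GaussianFourier.integrable_cexp_neg_mul_sum_add (ι := Fin d) (b := (ε:CC)) (by simpa using hε) 0
  refine this.norm.congr (ae_of_all _ fun x => ?_)
  simp only [Complex.norm_exp]
  congr 1
  rw [show -(ε:CC) * ∑ i, (x i:CC)^2 + ∑ i, (0 : Fin d → CC) i * (x i:CC) = ((-ε * ∑ i, x i^2 : RR):CC) by push_cast; simp, Complex.ofReal_re]

lemma integral_gauss_E (d : ℕ) {ε : RR} (hε : 0 < ε) :
    ∫ x : Ed d, Real.exp (-ε * ∑ i, x i ^ 2) = (Real.pi / ε) ^ ((d:RR)/2) := by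
  have := GaussianFourier.integral_cexp_neg_mul_sum_add (ι := Fin d) (b := (ε:CC)) (by simpa using hε) 0
  rw [← Complex.ofReal_inj, ← integral_complex_ofReal]
  rw [Complex.ofReal_cpow (by positivity)]
  simp at this
  push_cast
  simp only [neg_mul]
  exact this

lemma free_cross_norm (d : ℕ) (y y' : Ed d) {τ σ ε : RR} (hτ : τ ≠ 0) (hσ : σ ≠ 0) (hε : 0 < ε) :
    ‖∫ x : Ed d, Sfree d x y τ * (starRingEnd CC) (Sfree d x y' σ) * cexp (-(ε:CC) * ((∑ i, x i ^ 2 : RR):CC))‖ =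
      (4 * Real.pi * |τ|) ^ (-(d:RR)/2) * (4 * Real.pi * |σ|) ^ (-(d:RR)/2) *
      ((Real.pi / ‖(ε:CC) - Complex.I * ((1/τ - 1/σ : RR):CC)/4‖) ^ ((d:RR)/2) *
        Real.exp (-(∑ i, (y i/τ - y' i/σ)^2)/16 * (((ε:CC) - Complex.I * ((1/τ - 1/σ : RR):CC)/4)⁻¹).re)) := by
  set p : CC := (ε:CC) - Complex.I * ((1/τ - 1/σ : RR):CC)/4 with hp
  have hp4 : p = (ε:CC) - Complex.I * (((1/τ - 1/σ)/4 : RR):CC) := by rw [hp]; push_cast; ring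
  have hpre : p.re = ε := by rw [hp4]; simp
  have hp0 : p ≠ 0 := by intro h; rw [h] at hpre; simp at hpre; linarith
  set c : Fin d → CC := fun i => -Complex.I/2 * ((y i/τ - y' i/σ : RR):CC) with hc
  set θ : CC := (4 * (Real.pi : CC) * Complex.I * (τ : CC)) ^ (-(d : CC) / 2) *
    (starRingEnd CC) ((4 * (Real.pi : CC) * Complex.I * (σ : CC)) ^ (-(d : CC) / 2)) *
    (cexp (Complex.I * ((∑ i, y i^2 : RR):CC)/((4*τ:RR):CC)) *
    (starRingEnd CC) (cexp (Complex.I * ((∑ i, y' i^2 : RR):CC)/((4*σ:RR):CC)))) with hθ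
  have hn : ∀ s : RR, ‖(4 * (Real.pi : CC) * Complex.I * (s : CC)) ^ (-(d : CC) / 2)‖ = (4 * Real.pi * |s|) ^ (-(d:RR)/2) := by
    intro s
    rw [show (-(d:CC)/2) = ((-(d:RR)/2 : RR):CC) by push_cast; rfl, Complex.norm_cpow_real]
    congr 1
    simp [abs_of_pos Real.pi_pos]
  have hθn : ‖θ‖ = (4 * Real.pi * |τ|) ^ (-(d:RR)/2) * (4 * Real.pi * |σ|) ^ (-(d:RR)/2) := by
    rw [hθ]
    simp only [norm_mul, RCLike.norm_conj, hn, norm_exp_I2, mul_one]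
  have h1 : ∀ x : Ed d, Sfree d x y τ * (starRingEnd CC) (Sfree d x y' σ) * cexp (-(ε:CC) * ((∑ i, x i ^ 2 : RR):CC)) =
      θ * cexp (-p * ∑ i, (x i:CC)^2 + ∑ i, c i * x i) := by
    intro x
    unfold Sfree
    rw [hθ, map_mul]
    have : cexp (Complex.I * ((∑ i, (x i - y i) ^ 2 : RR) : CC) / ((4 * τ : RR) : CC)) *
        (starRingEnd CC) (cexp (Complex.I * ((∑ i, (x i - y' i) ^ 2 : RR) : CC) / ((4 * σ : RR) : CC))) *
        cexp (-(ε:CC) * ((∑ i, x i ^ 2 : RR):CC)) =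
        cexp (Complex.I * ((∑ i, y i^2 : RR):CC)/((4*τ:RR):CC)) *
        (starRingEnd CC) (cexp (Complex.I * ((∑ i, y' i^2 : RR):CC)/((4*σ:RR):CC))) *
        cexp (-p * ∑ i, (x i:CC)^2 + ∑ i, c i * x i) := by
      simp only [← Complex.exp_conj, ← Complex.exp_add]
      congr 1
      simp only [map_div₀, map_mul, Complex.conj_I, Complex.conj_ofReal]
      have key : ∀ w : Ed d, (((∑ i, (x i - w i)^2 : RR)):CC) = ∑ i, (x i:CC)^2 - 2 * ∑ i, (w i:CC) * x i + ((∑ i, (w i)^2 : RR):CC) := by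
        intro w
        push_cast
        rw [Finset.mul_sum, ← Finset.sum_sub_distrib, ← Finset.sum_add_distrib]
        refine Finset.sum_congr rfl fun i _ => by ring
      have kc : ∑ i, c i * x i = -Complex.I/2 * ((∑ i, (y i:CC) * x i)/τ - (∑ i, (y' i:CC) * x i)/σ) := by
        rw [Finset.sum_div, Finset.sum_div, ← Finset.sum_sub_distrib, Finset.mul_sum]
        refine Finset.sum_congr rfl fun i _ => ?_
        simp only [hc]; push_cast; ring
      rw [key y, key y', kc, hp]
      push_cast
      have : (τ:CC) ≠ 0 := by exact_mod_cast hτ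
      have : (σ:CC) ≠ 0 := by exact_mod_cast hσ
      field_simp
      ring
    linear_combination ((4 * (Real.pi : CC) * Complex.I * (τ : CC)) ^ (-(d : CC) / 2) *
    (starRingEnd CC) ((4 * (Real.pi : CC) * Complex.I * (σ : CC)) ^ (-(d : CC) / 2))) * this
  simp_rw [h1]
  rw [integral_const_mul, norm_mul, hθn, GaussianFourier.integral_cexp_neg_mul_sum_add (by rw [hpre]; exact hε) c, norm_mul]
  congr 2
  · rw [show ((Fintype.card (Fin d) : CC)/2) = (((d:RR)/2 : RR):CC) by simp, Complex.norm_cpow_real]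
    simp [abs_of_pos Real.pi_pos]
  · rw [Complex.norm_exp]
    congr 1
    have : (∑ i, c i^2)/(4*p) = ((-(∑ i, (y i/τ - y' i/σ)^2)/16 : RR):CC) * p⁻¹ := by
      have : ∑ i, c i ^2 = -((∑ i, (y i/τ - y' i/σ)^2 : RR):CC)/4 := by
        push_cast
        rw [← Finset.sum_neg_distrib, Finset.sum_div]
        refine Finset.sum_congr rfl fun i _ => ?_
        simp only [hc]; rw [mul_pow, div_pow, neg_pow, Complex.I_sq]; push_cast; ring
      rw [this]; push_cast; field_simp; ring
    rw [this, Complex.re_ofReal_mul]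

lemma free_cross_bound (d : ℕ) (y y' : Ed d) {τ σ ε : RR} (hτ : τ ≠ 0) (hσ : σ ≠ 0) (hne : τ ≠ σ) (hε : 0 < ε) :
    ‖∫ x : Ed d, Sfree d x y τ * (starRingEnd CC) (Sfree d x y' σ) * cexp (-(ε:CC) * ((∑ i, x i ^ 2 : RR):CC))‖ ≤
      |τ - σ| ^ (-(d:RR)/2) := by
  rw [free_cross_norm d y y' hτ hσ hε]
  set p : CC := (ε:CC) - Complex.I * ((1/τ - 1/σ : RR):CC)/4 with hp
  have hp4 : p = (ε:CC) - Complex.I * (((1/τ - 1/σ)/4 : RR):CC) := by rw [hp]; push_cast; ring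
  have hpre : p.re = ε := by rw [hp4]; simp
  have hpim : p.im = -((1/τ - 1/σ)/4) := by rw [hp4]; simp
  have hp0 : p ≠ 0 := by intro h; rw [h] at hpre; simp at hpre; linarith
  have h2 : |τ - σ| / (4 * (|τ| * |σ|)) ≤ ‖p‖ := by
    refine le_trans (le_of_eq ?_) (Complex.abs_im_le_norm p)
    rw [hpim, show -((1/τ - 1/σ)/4) = (τ - σ)/(4*(τ*σ)) by field_simp; ring, abs_div, abs_mul, abs_mul]
    norm_num
  have hτ' := abs_pos.2 hτ
  have hσ' := abs_pos.2 hσ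
  have hd' := abs_pos.2 (sub_ne_zero.2 hne)
  have hpi := Real.pi_pos
  have h3 : Real.pi / ‖p‖ ≤ Real.pi / (|τ - σ| / (4 * (|τ| * |σ|))) := by gcongr
  have h4 : Real.exp (-(∑ i, (y i/τ - y' i/σ)^2)/16 * (p⁻¹).re) ≤ 1 := by
    rw [Real.exp_le_one_iff, Complex.inv_re]
    have : 0 < p.re / Complex.normSq p := div_pos (by rw [hpre]; exact hε) (Complex.normSq_pos.2 hp0)
    have h5 : 0 ≤ ∑ i, (y i/τ - y' i/σ)^2 := Finset.sum_nonneg fun i _ => sq_nonneg _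
    nlinarith
  calc _ ≤ (4 * Real.pi * |τ|) ^ (-(d:RR)/2) * (4 * Real.pi * |σ|) ^ (-(d:RR)/2) *
      ((Real.pi / (|τ - σ| / (4 * (|τ| * |σ|)))) ^ ((d:RR)/2) * 1) := by gcongr
    _ = ((4 * Real.pi * |τ|) * (4 * Real.pi * |σ|) * (Real.pi / (|τ - σ| / (4 * (|τ| * |σ|))))⁻¹) ^ (-(d:RR)/2) := by
      rw [mul_one, ← Real.mul_rpow (by positivity) (by positivity), Real.mul_rpow (x := 4 * Real.pi * |τ| * (4 * Real.pi * |σ|)) (by positivity) (by positivity),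
        Real.inv_rpow (by positivity), neg_div, Real.rpow_neg (x := Real.pi / _) (by positivity), inv_inv]
    _ ≤ _ := by
      refine Real.rpow_le_rpow_of_nonpos hd' ?_ (by have : (0:RR) ≤ d := by positivity
                                                    linarith)
      rw [inv_div, show (4 * Real.pi * |τ|) * (4 * Real.pi * |σ|) * (|τ - σ| / (4 * (|τ| * |σ|)) / Real.pi) = 4 * Real.pi * |τ - σ| by
        field_simp]
      have := Real.pi_gt_three
      nlinarith

lemma free_mass (d : ℕ) (y : Ed d) {t ε : RR} (ht : t ≠ 0) (hε : 0 < ε) :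
    ∫⁻ y', ‖∫ x : Ed d, Sfree d x y t * (starRingEnd CC) (Sfree d x y' t) * cexp (-(ε:CC) * ((∑ i, x i ^ 2 : RR):CC))‖ₑ
      ≤ 1 := by
  have ht' := abs_pos.2 ht
  have hpi := Real.pi_pos
  have hη : 0 < 1/(16*t^2*ε) := by positivity
  have h1 : ∀ y' : Ed d, ‖∫ x : Ed d, Sfree d x y t * (starRingEnd CC) (Sfree d x y' t) * cexp (-(ε:CC) * ((∑ i, x i ^ 2 : RR):CC))‖ₑ =
      eo ((4 * Real.pi * |t|) ^ (-(d:RR)/2) * (4 * Real.pi * |t|) ^ (-(d:RR)/2) * (Real.pi/ε) ^ ((d:RR)/2)) *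
      eo (Real.exp (-(1/(16*t^2*ε)) * ∑ i, ((y - y') i)^2)) := by
    intro y'
    rw [← ofReal_norm, free_cross_norm d y y' ht ht hε, ← ENNReal.ofReal_mul (by positivity), ← mul_assoc]
    congr 2
    · rw [sub_self, Complex.ofReal_zero, mul_zero, zero_div, sub_zero, Complex.norm_real, Real.norm_of_nonneg hε.le]
    · congr 1
      rw [sub_self, Complex.ofReal_zero, mul_zero, zero_div, sub_zero, ← Complex.ofReal_inv, Complex.ofReal_re]
      rw [show ∑ i, (y i / t - y' i / t)^2 = (∑ i, ((y - y') i)^2)/t^2 by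
        rw [Finset.sum_div]; refine Finset.sum_congr rfl fun i _ => ?_
        simp only [Pi.sub_apply]; rw [← sub_div, div_pow]]
      field_simp
  simp_rw [h1]
  rw [lintegral_const_mul' _ _ (by simp), lintegral_sub_left_eq_self (fun x : Ed d => eo (Real.exp (-(1/(16*t^2*ε)) * ∑ i, (x i)^2))) y,
    ← ofReal_integral_eq_lintegral_ofReal (integrable_gauss_E d hη) (ae_of_all _ fun x => (Real.exp_nonneg _)),
    integral_gauss_E d hη, ← ENNReal.ofReal_mul (by positivity)]
  rw [ENNReal.ofReal_le_one]
  apply le_of_eq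
  rw [neg_div, Real.rpow_neg (by positivity), ← Real.inv_rpow (by positivity), ← Real.mul_rpow (by positivity) (by positivity),
    ← Real.mul_rpow (by positivity) (by positivity), ← Real.mul_rpow (by positivity) (by positivity)]
  rw [show ((4 * Real.pi * |t|)⁻¹ * (4 * Real.pi * |t|)⁻¹ * (Real.pi / ε) * (Real.pi / (1 / (16 * t ^ 2 * ε)))) = 1 by
    rw [← sq_abs t]; field_simp; norm_num]
  exact Real.one_rpow _

section core
variable {X Y : Type*} [MeasurableSpace X] [MeasurableSpace Y]

lemma core (m : Measure X) (n : Measure Y) [SFinite m] [SFinite n] (k : X → Y → CC) (hk : Measurable (uncurry k))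
    (g : Y → RR) (hg : Integrable g n) (hkg : ∀ x y, ‖k x y‖ ≤ g y)
    (w : X → RR) (hw : Integrable w m) (hwm : Measurable w) (hw0 : ∀ x, 0 ≤ w x) :
    ∫⁻ x, ‖∫ y, k x y ∂n‖ₑ ^ 2 * eo (w x) ∂m ≤
      ∫⁻ y, ∫⁻ y', ‖∫ x, k x y * (starRingEnd CC) (k x y') * (w x : CC) ∂m‖ₑ ∂n ∂n := by
  set V : X → CC := fun x => ∫ y, k x y ∂n with hV
  have hVm : Measurable V := (hk.stronglyMeasurable.integral_prod_right).measurable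
  have hg0 : ∀ x : X, ∀ y, 0 ≤ g y := fun x y => (norm_nonneg _).trans (hkg x y)
  have hki : ∀ x, Integrable (k x) n := fun x => hg.mono' (hk.of_uncurry_left.aestronglyMeasurable) (ae_of_all _ (hkg x))
  set G : X → Y × Y → CC := fun x p => k x p.1 * (starRingEnd CC) (k x p.2) * (w x : CC) with hG
  have hGm : Measurable (uncurry G) := by
    have h1 : Measurable (fun q : X × (Y × Y) => k q.1 q.2.1) := hk.comp (by fun_prop : Measurable fun q : X × (Y × Y) => (q.1, q.2.1))
    have h2 : Measurable (fun q : X × (Y × Y) => k q.1 q.2.2) := hk.comp (by fun_prop : Measurable fun q : X × (Y × Y) => (q.1, q.2.2))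
    have h3 : Measurable (fun q : X × (Y × Y) => (starRingEnd CC) (k q.1 q.2.2)) :=
      (Complex.continuous_conj.measurable).comp h2
    simp only [hG, uncurry_def]
    fun_prop
  have hGi : Integrable (uncurry G) (m.prod (n.prod n)) := by
    have := hw.mul_prod (hg.mul_prod hg)
    refine this.mono' hGm.aestronglyMeasurable (ae_of_all _ fun q => ?_)
    simp only [hG, uncurry_def, norm_mul, RCLike.norm_conj, Complex.norm_real, Real.norm_of_nonneg (hw0 _)]
    rw [mul_comm (w q.1)]
    have := hg0 q.1
    gcongr
    · exact hw0 _
    · exact this _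
    · exact hkg _ _
    · exact hkg _ _
  have h1 : ∀ x, ∫ p, G x p ∂(n.prod n) = ((‖V x‖^2 * w x : RR):CC) := by
    intro x
    simp only [hG]
    rw [integral_mul_const, integral_prod_mul (fun y => k x y) (fun y => (starRingEnd CC) (k x y)), integral_conj]
    rw [Complex.mul_conj, Complex.normSq_eq_norm_sq]
    push_cast; rfl
  have h2 : ∫ x, ‖V x‖^2 * w x ∂m = ‖∫ p, ∫ x, G x p ∂m ∂(n.prod n)‖ := by
    rw [← integral_integral_swap hGi]
    simp_rw [h1]
    rw [integral_complex_ofReal, Complex.norm_real, Real.norm_of_nonneg]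
    exact integral_nonneg fun x => mul_nonneg (sq_nonneg _) (hw0 x)
  have h3 : Integrable (fun x => ‖V x‖^2 * w x) m := by
    have := hGi.integral_prod_left
    simp only [uncurry_def, h1] at this
    simpa only [RCLike.re_to_complex, Complex.ofReal_re] using this.re
  have h4 : ∫⁻ x, ‖V x‖ₑ ^ 2 * eo (w x) ∂m = eo (∫ x, ‖V x‖^2 * w x ∂m) := by
    rw [ofReal_integral_eq_lintegral_ofReal h3 (ae_of_all _ fun x => mul_nonneg (sq_nonneg _) (hw0 x))]
    refine lintegral_congr fun x => ?_
    rw [ENNReal.ofReal_mul (sq_nonneg _), ENNReal.ofReal_pow (norm_nonneg _), ofReal_norm]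
  rw [h4, h2, ofReal_norm]
  refine (enorm_integral_le_lintegral_enorm _).trans (le_of_eq ?_)
  have hm2 : Measurable (fun p : Y × Y => ∫ x, G x p ∂m) :=
    (hGm.stronglyMeasurable.integral_prod_left').measurable
  rw [lintegral_prod _ hm2.enorm.aemeasurable]

lemma two_mul_le_sqE (a b : ℝ≥0∞) : a * b ≤ 2⁻¹ * a^2 + 2⁻¹ * b^2 := by
  have h2 : (2:ℝ≥0∞)⁻¹ ≠ 0 := by simp
  rcases eq_or_ne a ⊤ with rfl | ha
  · simp [ENNReal.mul_top h2]
  rcases eq_or_ne b ⊤ with rfl | hb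
  · simp [ENNReal.mul_top h2]
  lift a to ℝ≥0 using ha
  lift b to ℝ≥0 using hb
  rw [show (2:ℝ≥0∞)⁻¹ = ((2⁻¹ : ℝ≥0) : ℝ≥0∞) by simp]
  norm_cast
  rw [← NNReal.coe_le_coe]
  push_cast
  nlinarith [sq_nonneg ((a:RR) - b)]

lemma schurE (n : Measure Y) [SFinite n] (K : Y → Y → ℝ≥0∞) (hK : Measurable (uncurry K))
    (hs : ∀ y y', K y y' = K y' y) (M : ℝ≥0∞) (hM : ∀ y, ∫⁻ y', K y y' ∂n ≤ M) (F : Y → ℝ≥0∞) (hF : Measurable F) :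
    ∫⁻ y, ∫⁻ y', F y * F y' * K y y' ∂n ∂n ≤ M * ∫⁻ y, F y ^ 2 ∂n := by
  have hm1 : Measurable (fun q : Y × Y => 2⁻¹ * F q.1^2 * K q.1 q.2) :=
    (((hF.comp measurable_fst).pow_const 2).const_mul _).mul hK
  have hm2 : Measurable (fun q : Y × Y => 2⁻¹ * F q.2^2 * K q.2 q.1) := hm1.comp measurable_swap
  have a1 : ∫⁻ y, ∫⁻ y', 2⁻¹ * F y^2 * K y y' ∂n ∂n ≤ 2⁻¹ * (M * ∫⁻ y, F y ^ 2 ∂n) := by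
    rw [mul_comm M, ← lintegral_mul_const _ (hF.pow_const 2), ← lintegral_const_mul _ ((hF.pow_const 2).mul_const _)]
    refine lintegral_mono fun y => ?_
    have : Measurable (K y) := hK.of_uncurry_left
    rw [lintegral_const_mul _ this, mul_assoc]
    gcongr
    exact hM y
  have a2 : ∫⁻ y, ∫⁻ y', 2⁻¹ * F y'^2 * K y' y ∂n ∂n ≤ 2⁻¹ * (M * ∫⁻ y, F y ^ 2 ∂n) := by
    rw [lintegral_lintegral_swap hm2.aemeasurable]; exact a1
  have e : ∀ y y', F y * F y' * K y y' ≤ 2⁻¹ * F y^2 * K y y' + 2⁻¹ * F y'^2 * K y' y := by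
    intro y y'
    rw [hs y' y, ← add_mul]
    exact mul_le_mul_left (two_mul_le_sqE _ _) _
  calc _ ≤ ∫⁻ y, ∫⁻ y', (2⁻¹ * F y^2 * K y y' + 2⁻¹ * F y'^2 * K y' y) ∂n ∂n :=
        lintegral_mono fun y => lintegral_mono fun y' => e y y'
    _ = ∫⁻ y, ((∫⁻ y', 2⁻¹ * F y^2 * K y y' ∂n) + ∫⁻ y', 2⁻¹ * F y'^2 * K y' y ∂n) ∂n :=
        lintegral_congr fun y => lintegral_add_left ((hK.of_uncurry_left (x := y)).const_mul _) _
    _ = _ := lintegral_add_left (hm1.lintegral_prod_right') _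
    _ ≤ 2⁻¹ * (M * ∫⁻ y, F y ^ 2 ∂n) + 2⁻¹ * (M * ∫⁻ y, F y ^ 2 ∂n) := add_le_add a1 a2
    _ = _ := by rw [← add_mul, ENNReal.inv_two_add_inv_two, one_mul]

lemma schur (m : Measure X) (n : Measure Y) [SFinite m] [SFinite n] (k : X → Y → CC) (hk : Measurable (uncurry k))
    (c : RR) (hkc : ∀ x y, ‖k x y‖ ≤ c)
    (w : ℕ → X → RR) (hw : ∀ j, Integrable (w j) m) (hwm : ∀ j, Measurable (w j)) (hw0 : ∀ j x, 0 ≤ w j x)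
    (hw1 : ∀ x, Tendsto (fun j => w j x) atTop (𝓝 1)) (M : ℝ≥0∞)
    (hM : ∀ j y, ∫⁻ y', ‖∫ x, k x y * (starRingEnd CC) (k x y') * (w j x : CC) ∂m‖ₑ ∂n ≤ M)
    (f : Y → CC) (hfm : Measurable f) (hf : Integrable f n) :
    ∫⁻ x, ‖∫ y, k x y * f y ∂n‖ₑ ^ 2 ∂m ≤ M * ∫⁻ y, ‖f y‖ₑ ^ 2 ∂n := by
  set V : X → CC := fun x => ∫ y, k x y * f y ∂n with hV
  have hkf : Measurable (uncurry fun x y => k x y * f y) := by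
    simp only [uncurry_def]
    exact (hk.comp (by fun_prop : Measurable fun p : X × Y => (p.1, p.2))).mul (hfm.comp measurable_snd)
  have hVm : Measurable V := (hkf.stronglyMeasurable.integral_prod_right).measurable
  have step : ∀ j, ∫⁻ x, ‖V x‖ₑ ^ 2 * eo (w j x) ∂m ≤ M * ∫⁻ y, ‖f y‖ₑ ^ 2 ∂n := by
    intro j
    refine (core m n (fun x y => k x y * f y) hkf (fun y => c * ‖f y‖) (hf.norm.const_mul c) (fun x y => by
      rw [norm_mul]; exact mul_le_mul_of_nonneg_right (hkc x y) (norm_nonneg _)) (w j) (hw j) (hwm j) (hw0 j)).trans ?_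
    set K : Y → Y → ℝ≥0∞ := fun y y' => ‖∫ x, k x y * (starRingEnd CC) (k x y') * (w j x : CC) ∂m‖ₑ with hK
    have hKs : ∀ y y', K y y' = K y' y := by
      intro y y'
      simp only [hK]
      rw [← ofReal_norm, ← ofReal_norm, ← RCLike.norm_conj, ← integral_conj]
      congr 3; ext x
      simp only [map_mul, Complex.conj_conj, Complex.conj_ofReal]; ring
    have hKm : Measurable (uncurry K) := by
      have h1 : Measurable (fun q : (Y × Y) × X => k q.2 q.1.1) := hk.comp (by fun_prop : Measurable fun q : (Y × Y) × X => (q.2, q.1.1))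
      have h2 : Measurable (fun q : (Y × Y) × X => k q.2 q.1.2) := hk.comp (by fun_prop : Measurable fun q : (Y × Y) × X => (q.2, q.1.2))
      have h3 : Measurable (fun q : (Y × Y) × X => (starRingEnd CC) (k q.2 q.1.2)) :=
        (Complex.continuous_conj.measurable).comp h2
      have h5 := hwm j
      have h4 : Measurable (fun q : (Y × Y) × X => k q.2 q.1.1 * (starRingEnd CC) (k q.2 q.1.2) * (w j q.2 : CC)) := by fun_prop
      exact (h4.stronglyMeasurable.integral_prod_right' (ν := m)).measurable.enorm
    have e1 : ∀ y y', ‖∫ x, k x y * f y * (starRingEnd CC) (k x y' * f y') * (w j x : CC) ∂m‖ₑ =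
        ‖f y‖ₑ * ‖f y'‖ₑ * K y y' := by
      intro y y'
      have : ∫ x, k x y * f y * (starRingEnd CC) (k x y' * f y') * (w j x : CC) ∂m =
        (f y * (starRingEnd CC) (f y')) * ∫ x, k x y * (starRingEnd CC) (k x y') * (w j x : CC) ∂m := by
        rw [← integral_const_mul]; congr 1; ext x; rw [map_mul]; ring
      rw [this, enorm_mul, enorm_mul, show ‖(starRingEnd CC) (f y')‖ₑ = ‖f y'‖ₑ by rw [← ofReal_norm, RCLike.norm_conj, ofReal_norm]]
    simp_rw [e1]
    exact schurE n K hKm hKs M (hM j) _ hfm.enorm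
  have hlim : ∀ x, Tendsto (fun j => ‖V x‖ₑ ^ 2 * eo (w j x)) atTop (𝓝 (‖V x‖ₑ^2)) := by
    intro x
    have h1 : Tendsto (fun j => eo (w j x)) atTop (𝓝 1) := by
      simpa using (ENNReal.tendsto_ofReal (hw1 x))
    simpa using ENNReal.Tendsto.const_mul h1 (Or.inr (by simp : ‖V x‖ₑ^2 ≠ ⊤))
  calc ∫⁻ x, ‖V x‖ₑ ^ 2 ∂m = ∫⁻ x, liminf (fun j => ‖V x‖ₑ ^ 2 * eo (w j x)) atTop ∂m :=
        lintegral_congr fun x => (hlim x).liminf_eq.symm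
    _ ≤ liminf (fun j => ∫⁻ x, ‖V x‖ₑ ^ 2 * eo (w j x) ∂m) atTop :=
        lintegral_liminf_le fun j => by have := hwm j; fun_prop
    _ ≤ _ := liminf_le_of_frequently_le' (Frequently.of_forall step)

end core

lemma gauss_cast (ε x : RR) : ((Real.exp (-ε * x) : RR):CC) = cexp (-(ε:CC) * (x:CC)) := by push_cast; rfl

def ep (j : ℕ) : RR := 1/((j:RR)+1)

lemma ep_pos (j : ℕ) : 0 < ep j := by unfold ep; positivity

lemma ep_tendsto (x : RR) : Tendsto (fun j => Real.exp (-ep j * x)) atTop (𝓝 1) := by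
  have h1 : Tendsto (fun j => -ep j * x) atTop (𝓝 (-0 * x)) :=
    (tendsto_one_div_add_atTop_nhds_zero_nat (𝕜 := RR)).neg.mul_const x
  have := (Real.continuous_exp.tendsto _).comp h1
  simpa [Function.comp_def] using this

lemma free_L2 {d : ℕ} (hd : 1 ≤ d) {s : RR} (hs : s ≠ 0) (f : (Ed d) → CC) (hfm : Measurable f) (hf : Integrable f) :
    ∫⁻ x, ‖∫ y, Sfree d x y s * f y‖ₑ ^ 2 ≤ ∫⁻ y, ‖f y‖ₑ ^ 2 := by
  have := schur (volume : Measure (Ed d)) (volume : Measure (Ed d)) (fun x y => Sfree d x y s)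
    (Sfree_measurable d measurable_fst measurable_snd measurable_const) _ (fun x y => norm_Sfree_le hd x y s)
    (fun j x => Real.exp (-ep j * ∑ i, x i ^ 2)) (fun j => integrable_gauss_E d (ep_pos j)) (fun j => by fun_prop)
    (fun j x => Real.exp_nonneg _) (fun x => ep_tendsto _) 1 (fun j y => by
      simp_rw [gauss_cast]
      exact free_mass d y hs (ep_pos j)) f hfm hf
  simpa using this

def CT (a : RR) : RR := (cS a)^2 * ((Real.Gamma ((a+1)/2) / 2)^2 * 4 ^ ((a+1)/2) * 2 ^ (a+1))

instance ωa_sfinite (d : ℕ) (a : RR) : SFinite (ωa d a) := by rw [ωa_eq]; infer_instance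

lemma T_L2 {d : ℕ} (hd : 1 ≤ d) {a : RR} (ha : 0 ≤ a) {t : RR} (ht : t ≠ 0) (f : (Ed d) × RR → CC) (hfm : Measurable f)
    (hf : Integrable f (ωa d a)) :
    ∫⁻ X, ‖∫ Y, (Sh a X.2 Y.2 t * Sfree d X.1 Y.1 t) * f Y ∂(ωa d a)‖ₑ ^ 2 ∂(ωa d a) ≤
      eo (CT a) * ∫⁻ Y, ‖f Y‖ₑ ^ 2 ∂(ωa d a) := by
  refine schur (ωa d a) (ωa d a) (fun X Y => Sh a X.2 Y.2 t * Sfree d X.1 Y.1 t)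
    ((Sh_measurable ha (measurable_snd.comp measurable_fst) (measurable_snd.comp measurable_snd) measurable_const).mul
      (Sfree_measurable d (measurable_fst.comp measurable_fst) (measurable_fst.comp measurable_snd) measurable_const))
    (cS a * |t| ^ (-((a+1)/2)) * |t| ^ (-(d:RR)/2)) (fun X Y => ?_)
    (fun j X => Real.exp (-ep j * ∑ i, X.1 i ^ 2) * Real.exp (-ep j * X.2^2))
    (fun j => ?_) (fun j => by fun_prop) (fun j x => by positivity) (fun X => ?_) (eo (CT a)) (fun j Y => ?_) f hfm hf
  · rw [norm_mul]
    have := cS_pos ha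
    exact mul_le_mul (norm_Sh_le ha _ _ _) (norm_Sfree_le hd _ _ _) (norm_nonneg _) (by positivity)
  · rw [ωa_eq]
    exact (integrable_gauss_E d (ep_pos j)).mul_prod (integrable_gauss_ma (by linarith) (ep_pos j))
  · simpa using (ep_tendsto (∑ i, X.1 i ^ 2)).mul (ep_tendsto (X.2^2))
  · have h1 : ∀ Y' : (Ed d) × RR, ‖∫ X, (Sh a X.2 Y.2 t * Sfree d X.1 Y.1 t) * (starRingEnd CC) (Sh a X.2 Y'.2 t * Sfree d X.1 Y'.1 t) *
        ((Real.exp (-ep j * ∑ i, X.1 i ^ 2) * Real.exp (-ep j * X.2^2) : RR):CC) ∂(ωa d a)‖ₑ =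
        ‖∫ x : Ed d, Sfree d x Y.1 t * (starRingEnd CC) (Sfree d x Y'.1 t) * cexp (-(ep j:CC) * ((∑ i, x i ^ 2 : RR):CC))‖ₑ *
        ‖∫ w, Sh a w Y.2 t * (starRingEnd CC) (Sh a w Y'.2 t) * cexp (-(ep j:CC) * (w:CC)^2) ∂(ma a)‖ₑ := by
      intro Y'
      rw [← enorm_mul, ωa_eq, ← integral_prod_mul]
      congr 2; ext X
      rw [Complex.ofReal_mul, gauss_cast, gauss_cast, map_mul]
      push_cast; ring
    simp_rw [h1]
    have hm1 : Measurable fun y' : Ed d => ‖∫ x : Ed d, Sfree d x Y.1 t * (starRingEnd CC) (Sfree d x y' t) * cexp (-(ep j:CC) * ((∑ i, x i ^ 2 : RR):CC))‖ₑ := by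
      have : Measurable fun q : (Ed d) × (Ed d) => Sfree d q.2 Y.1 t * (starRingEnd CC) (Sfree d q.2 q.1 t) * cexp (-(ep j:CC) * ((∑ i, q.2 i ^ 2 : RR):CC)) := by
        refine ((Sfree_measurable d measurable_snd measurable_const measurable_const).mul
          (Complex.continuous_conj.measurable.comp (Sfree_measurable d measurable_snd measurable_fst measurable_const))).mul ?_
        fun_prop
      exact (this.stronglyMeasurable.integral_prod_right' (ν := volume)).measurable.enorm
    have hm2 : Measurable fun v => ‖∫ w, Sh a w Y.2 t * (starRingEnd CC) (Sh a w v t) * cexp (-(ep j:CC) * (w:CC)^2) ∂(ma a)‖ₑ := by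
      have : Measurable fun q : RR × RR => Sh a q.2 Y.2 t * (starRingEnd CC) (Sh a q.2 q.1 t) * cexp (-(ep j:CC) * (q.2:CC)^2) := by
        refine ((Sh_measurable ha measurable_snd measurable_const measurable_const).mul
          (Complex.continuous_conj.measurable.comp (Sh_measurable ha measurable_snd measurable_fst measurable_const))).mul ?_
        fun_prop
      exact (this.stronglyMeasurable.integral_prod_right' (ν := ma a)).measurable.enorm
    rw [ωa_eq, lintegral_prod_mul hm1.aemeasurable hm2.aemeasurable]
    calc _ ≤ 1 * eo (CT a) := mul_le_mul' (free_mass d Y.1 ht (ep_pos j)) (Sh_mass ha Y.2 ht (ep_pos j))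
      _ = _ := one_mul _

section interp
variable {X Y : Type*} [MeasurableSpace X] [MeasurableSpace Y]

def lv (f : X → CC) (α : RR) (x : X) : CC := if α < ‖f x‖ then f x / ‖f x‖ else 0

lemma lv_measurable (f : X → CC) (hf : Measurable f) : Measurable (fun p : X × RR => lv f p.2 p.1) := by
  unfold lv
  refine Measurable.ite (measurableSet_lt measurable_snd (hf.comp measurable_fst).norm) ?_ measurable_const
  have := hf.comp (measurable_fst : Measurable (Prod.fst : X × RR → X))
  exact this.div (Complex.measurable_ofReal.comp this.norm)

lemma lv_measurable' (f : X → CC) (hf : Measurable f) (α : RR) : Measurable (lv f α) :=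
  (lv_measurable f hf).comp (measurable_id.prodMk measurable_const)

lemma lv_enorm (f : X → CC) {α : RR} (hα : 0 < α) (x : X) : ‖lv f α x‖ₑ = {x | α < ‖f x‖}.indicator 1 x := by
  unfold lv
  split_ifs with h
  · have h0 : f x ≠ 0 := by intro h1; simp [h1] at h; linarith
    simp only [Set.indicator, Set.mem_ofPred_eq, h, if_true, Pi.one_apply]
    rw [← ofReal_norm, norm_div, Complex.norm_real, norm_norm, div_self (norm_ne_zero_iff.2 h0)]; simp
  · simp [h]

lemma lv_lint (f : X → CC) (hf : Measurable f) (μ : Measure X) {α : RR} (hα : 0 < α) : ∫⁻ x, ‖lv f α x‖ₑ ∂μ = μ {x | α < ‖f x‖} := by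
  simp_rw [lv_enorm f hα]
  rw [lintegral_indicator_one (measurableSet_lt measurable_const hf.norm)]

lemma lv_lint2 (f : X → CC) (hf : Measurable f) (μ : Measure X) {α : RR} (hα : 0 < α) : ∫⁻ x, ‖lv f α x‖ₑ^2 ∂μ = μ {x | α < ‖f x‖} := by
  rw [← lv_lint f hf μ hα]
  refine lintegral_congr fun x => ?_
  rw [lv_enorm f hα]
  by_cases h : x ∈ {x | α < ‖f x‖} <;> simp [h]

lemma lv_int_eq (f : X → CC) (x : X) : ∫ α in Set.Ioi (0:RR), lv f α x = f x := by
  have : ∀ α, lv f α x = (Set.Iio ‖f x‖).indicator (fun _ => f x / ‖f x‖) α := by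
    intro α; simp [lv, Set.indicator]
  simp_rw [this]
  rw [setIntegral_indicator measurableSet_Iio]
  by_cases h0 : f x = 0
  · simp [h0]
  · rw [Set.Ioi_inter_Iio, setIntegral_const]
    have : (‖f x‖ : CC) ≠ 0 := by simpa using h0
    simp [Measure.real, Real.volume_Ioo]
    field_simp

lemma lv_lint_α (f : X → CC) (x : X) : ∫⁻ α in Set.Ioi (0:RR), ‖lv f α x‖ₑ = ‖f x‖ₑ := by
  have : ∀ α ∈ Set.Ioi (0:RR), ‖lv f α x‖ₑ = (Set.Iio ‖f x‖).indicator 1 α := by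
    intro α hα; rw [lv_enorm f hα]; simp [Set.indicator]
  rw [setLIntegral_congr_fun measurableSet_Ioi this, lintegral_indicator_one measurableSet_Iio, Measure.restrict_apply measurableSet_Iio]
  rw [Set.Iio_inter_Ioi, Real.volume_Ioo, sub_zero, ofReal_norm]

lemma layer (μ : Measure X) [SFinite μ] (f h : X → CC) (hf : Measurable f) (hfi : Integrable f μ) (hh : Measurable h)
    (c : ℝ≥0) (hc : ∀ x, ‖h x‖ₑ ≤ c) :
    ‖∫ x, f x * h x ∂μ‖ₑ ≤ ∫⁻ α in Set.Ioi (0:RR), ‖∫ x, lv f α x * h x ∂μ‖ₑ := by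
  have hm : Measurable (fun p : X × RR => lv f p.2 p.1 * h p.1) := (lv_measurable f hf).mul (hh.comp measurable_fst)
  have hi : Integrable (uncurry fun x α => lv f α x * h x) (μ.prod (volume.restrict (Set.Ioi (0:RR)))) := by
    refine ⟨hm.aestronglyMeasurable, ?_⟩
    show ∫⁻ p : X × RR, ‖lv f p.2 p.1 * h p.1‖ₑ ∂_ < ⊤
    rw [lintegral_prod _ hm.enorm.aemeasurable]
    calc _ ≤ ∫⁻ x, ‖f x‖ₑ * c ∂μ := by
          refine lintegral_mono fun x => ?_
          simp only [enorm_mul]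
          rw [lintegral_mul_const' _ _ (by simp), lv_lint_α]
          gcongr; exact hc x
      _ < ⊤ := by
          rw [lintegral_mul_const' _ _ (by simp)]
          exact ENNReal.mul_lt_top hfi.2 (by simp)
  have e : ∫ x, f x * h x ∂μ = ∫ α in Set.Ioi (0:RR), ∫ x, lv f α x * h x ∂μ := by
    rw [← integral_integral_swap hi]
    refine integral_congr_ae (ae_of_all _ fun x => ?_)
    simp only
    rw [integral_mul_const, lv_int_eq]
  rw [e]
  exact enorm_integral_le_lintegral_enorm _

lemma lv_integrable (μ : Measure X) (f : X → CC) (hf : Measurable f) (hfi : Integrable f μ) {α : RR} (hα : 0 < α) :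
    Integrable (lv f α) μ := by
  refine ⟨(lv_measurable' f hf α).aestronglyMeasurable, ?_⟩
  unfold HasFiniteIntegral
  rw [lv_lint f hf μ hα]
  refine lt_of_le_of_lt (measure_mono (t := {x | α ≤ ‖f x‖}) (fun x hx => le_of_lt (by simpa using hx))) (hfi.measure_norm_ge_lt_top hα)

lemma bil_int (μ : Measure X) (ν : Measure Y) [SFinite μ] [SFinite ν] (K : X → Y → CC) (hK : Measurable (uncurry K))
    (A : RR) (hA : ∀ x y, ‖K x y‖ ≤ A) (f : X → CC) (g : Y → CC) (hfi : Integrable f μ) (hgi : Integrable g ν) :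
    Integrable (uncurry fun x y => K x y * f x * g y) (μ.prod ν) := by
  have := (hfi.mul_prod hgi).bdd_mul (c := A) hK.aestronglyMeasurable (ae_of_all _ fun p => hA p.1 p.2)
  refine this.congr (ae_of_all _ fun p => ?_)
  simp [uncurry, mul_assoc]

lemma layer1 (μ : Measure X) (ν : Measure Y) [SFinite μ] [SFinite ν] (K : X → Y → CC) (hK : Measurable (uncurry K))
    (A : RR) (hA : ∀ x y, ‖K x y‖ ≤ A) (f : X → CC) (g : Y → CC) (hf : Measurable f) (hg : Measurable g)
    (hfi : Integrable f μ) (hgi : Integrable g ν) :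
    ‖∫ x, ∫ y, K x y * f x * g y ∂ν ∂μ‖ₑ ≤
      ∫⁻ α in Set.Ioi (0:RR), ‖∫ x, ∫ y, K x y * lv f α x * g y ∂ν ∂μ‖ₑ := by
  have e : ∀ f : X → CC, ∀ x, ∫ y, K x y * f x * g y ∂ν = f x * ∫ y, K x y * g y ∂ν := by
    intro f x; rw [← integral_const_mul]; congr 1; ext y; ring
  simp_rw [e]
  have hm : Measurable (fun p : X × Y => K p.1 p.2 * g p.2) := hK.mul (hg.comp measurable_snd)
  refine layer μ f _ hf hfi (hm.stronglyMeasurable.integral_prod_right' (ν := ν)).measurable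
    (Real.toNNReal A * (∫⁻ y, ‖g y‖ₑ ∂ν).toNNReal) fun x => ?_
  refine (enorm_integral_le_lintegral_enorm _).trans ?_
  calc _ ≤ ∫⁻ y, eo A * ‖g y‖ₑ ∂ν := by
        refine lintegral_mono fun y => ?_
        simp only [enorm_mul]
        gcongr
        rw [← ofReal_norm]; exact ENNReal.ofReal_le_ofReal (hA x y)
    _ = _ := by
        rw [lintegral_const_mul' _ _ (by simp)]
        push_cast
        rw [ENNReal.coe_toNNReal hgi.2.ne]; rfl

lemma layer2 (μ : Measure X) (ν : Measure Y) [SFinite μ] [SFinite ν] (K : X → Y → CC) (hK : Measurable (uncurry K))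
    (A : RR) (hA : ∀ x y, ‖K x y‖ ≤ A) (f : X → CC) (g : Y → CC) (hf : Measurable f) (hg : Measurable g)
    (hfi : Integrable f μ) (hgi : Integrable g ν) :
    ‖∫ x, ∫ y, K x y * f x * g y ∂ν ∂μ‖ₑ ≤
      ∫⁻ α in Set.Ioi (0:RR), ∫⁻ β in Set.Ioi (0:RR), ‖∫ x, ∫ y, K x y * lv f α x * lv g β y ∂ν ∂μ‖ₑ := by
  refine (layer1 μ ν K hK A hA f g hf hg hfi hgi).trans ?_
  refine setLIntegral_mono' measurableSet_Ioi fun α hα => ?_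
  have hl := lv_integrable μ f hf hfi hα
  rw [integral_integral_swap (bil_int μ ν K hK A hA _ g hl hgi)]
  have := layer1 ν μ (fun y x => K x y) (hK.comp measurable_swap) A (fun y x => hA x y) g (lv f α) hg (lv_measurable' f hf α) hgi hl
  have e : ∀ y x, K x y * lv f α x * g y = K x y * g y * lv f α x := fun y x => by ring
  simp_rw [e]
  refine this.trans ?_
  refine setLIntegral_mono' measurableSet_Ioi fun β hβ => ?_
  rw [integral_integral_swap (bil_int μ ν K hK A hA _ _ hl (lv_integrable ν g hg hgi hβ))]
  refine le_of_eq ?_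
  congr 3; ext y; congr 1; ext x; ring
end interp

lemma lint_pow_Ioc {s c : RR} (hs : s < 1) (hc : 0 < c) :
    ∫⁻ β in Set.Ioc 0 c, eo (β ^ (-s)) = eo (c ^ (1 - s) / (1 - s)) := by
  have hi : IntervalIntegrable (fun x : RR => x ^ (-s)) volume 0 c := intervalIntegral.intervalIntegrable_rpow' (by linarith)
  rw [intervalIntegrable_iff_integrableOn_Ioc_of_le hc.le] at hi
  rw [← ofReal_integral_eq_lintegral_ofReal hi]
  · rw [← intervalIntegral.integral_of_le hc.le, integral_rpow (Or.inl (by linarith))]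
    congr 1
    rw [show -s + 1 = 1 - s by ring, Real.zero_rpow (by linarith), sub_zero]
  · exact (ae_restrict_iff' measurableSet_Ioc).2 (ae_of_all _ fun x hx => Real.rpow_nonneg hx.1.le _)

lemma minbound_pt {p A κ : RR} (hp : 1 < p) (hA : 0 < A) (hκ : 0 < κ) (v w Φ : ℝ≥0∞) {α β : RR} (hα : 0 < α) (hβ : 0 < β)
    (h1 : Φ ≤ eo A * (v * w)) (h2 : Φ ≤ v ^ (1/2 : RR) * w ^ (1/2:RR)) :
    Φ ≤ eo (A * κ ^ (1 - p)) * ((v * eo (α ^ (p-1))) * (w * eo (β ^ (p-1)))) +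
      (2⁻¹ * (v * eo (α ^ (p/2)) * (Set.Ioc 0 (κ/α)).indicator (fun β => eo (β ^ (-(p/2)))) β) +
       2⁻¹ * (w * eo (β ^ (p/2)) * (Set.Ioc 0 (κ/β)).indicator (fun α => eo (α ^ (-(p/2)))) α)) := by
  rcases lt_or_ge κ (α * β) with h | h
  · refine le_trans (h1.trans ?_) le_self_add
    have : (1:RR) ≤ κ ^ (1-p) * (α ^ (p-1) * β ^ (p-1)) := by
      rw [← Real.mul_rpow hα.le hβ.le, show 1 - p = -(p-1) by ring, Real.rpow_neg hκ.le, ← div_eq_inv_mul, ← Real.div_rpow (by positivity) hκ.le]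
      exact Real.one_le_rpow ((one_le_div hκ).2 h.le) (by linarith)
    calc eo A * (v * w) ≤ eo A * (v * w) * eo (κ ^ (1-p) * (α ^ (p-1) * β ^ (p-1))) := by
          conv_lhs => rw [← mul_one (eo A * (v * w))]
          gcongr
          rw [← ENNReal.ofReal_one]; exact ENNReal.ofReal_le_ofReal this
      _ = _ := by
        rw [ENNReal.ofReal_mul hA.le, ENNReal.ofReal_mul (by positivity), ENNReal.ofReal_mul (by positivity)]
        ring
  · refine le_trans (h2.trans ?_) le_add_self
    have m1 : β ∈ Set.Ioc 0 (κ/α) := ⟨hβ, by rw [le_div_iff₀ hα]; linarith⟩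
    have m2 : α ∈ Set.Ioc 0 (κ/β) := ⟨hα, by rw [le_div_iff₀ hβ]; linarith⟩
    rw [Set.indicator_of_mem m1, Set.indicator_of_mem m2]
    have h3 := two_mul_le_sqE (v ^ (1/2 : RR) * eo (α ^ (p/4) * β ^ (-(p/4)))) (w ^ (1/2:RR) * eo (β ^ (p/4) * α ^ (-(p/4))))
    have e1 : ∀ (v : ℝ≥0∞) {α β : RR}, 0 < α → 0 < β → (v ^ (1/2 : RR) * eo (α ^ (p/4) * β ^ (-(p/4)))) ^ 2 = v * eo (α ^ (p/2)) * eo (β ^ (-(p/2))) := by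
      intro v α β hα hβ
      rw [mul_pow, ← ENNReal.rpow_natCast, ← ENNReal.rpow_mul, ← ENNReal.ofReal_pow (by positivity), mul_pow, ← Real.rpow_natCast, ← Real.rpow_natCast,
        ← Real.rpow_mul hα.le, ← Real.rpow_mul hβ.le, ENNReal.ofReal_mul (by positivity), mul_assoc]
      congr 2
      · norm_num
      · congr 2; push_cast; ring
      · congr 2; push_cast; ring
    rw [e1 v hα hβ, e1 w hβ hα] at h3
    refine le_trans (le_of_eq ?_) h3
    have : eo (α ^ (p/4) * β ^ (-(p/4))) * eo (β ^ (p/4) * α ^ (-(p/4))) = 1 := by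
      rw [← ENNReal.ofReal_mul (by positivity), Real.rpow_neg hα.le, Real.rpow_neg hβ.le]
      rw [← ENNReal.ofReal_one]; congr 1
      have : 0 < α ^ (p/4) := by positivity
      have : 0 < β ^ (p/4) := by positivity
      field_simp
    calc _ = v ^ (1/2:RR) * w ^ (1/2:RR) * (eo (α ^ (p/4) * β ^ (-(p/4))) * eo (β ^ (p/4) * α ^ (-(p/4)))) := by rw [this, mul_one]
      _ = _ := by ring

lemma minbound_half {p κ : RR} (hp2 : p < 2) (hκ : 0 < κ) (v : RR → ℝ≥0∞) (hv : ∫⁻ α in Set.Ioi (0:RR), v α * eo (α ^ (p-1)) ≤ 1) :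
    ∫⁻ α in Set.Ioi (0:RR), ∫⁻ β in Set.Ioi (0:RR), 2⁻¹ * (v α * eo (α ^ (p/2)) * (Set.Ioc 0 (κ/α)).indicator (fun β => eo (β ^ (-(p/2)))) β)
      ≤ 2⁻¹ * eo (κ ^ (1 - p/2) / (1 - p/2)) := by
  calc _ = ∫⁻ α in Set.Ioi (0:RR), 2⁻¹ * eo (κ ^ (1 - p/2) / (1 - p/2)) * (v α * eo (α ^ (p-1))) := by
        refine setLIntegral_congr_fun measurableSet_Ioi fun α hα => ?_
        have hα : 0 < α := hα
        have hm : Measurable ((Set.Ioc 0 (κ/α)).indicator (fun β => eo (β ^ (-(p/2))))) := 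
          Measurable.indicator (by fun_prop) measurableSet_Ioc
        rw [lintegral_const_mul' _ _ (by simp), lintegral_const_mul _ hm, setLIntegral_indicator measurableSet_Ioc]
        rw [Set.inter_eq_left.2 (fun x hx => hx.1), lint_pow_Ioc (by linarith) (by positivity)]
        rw [mul_assoc, mul_assoc]
        congr 1
        rw [mul_left_comm (eo (κ ^ (1 - p / 2) / (1 - p / 2))), ← ENNReal.ofReal_mul (by positivity), ← ENNReal.ofReal_mul' (by positivity)]
        congr 2
        rw [Real.div_rpow hκ.le hα.le, show p - 1 = p/2 - (1 - p/2) by ring, Real.rpow_sub hα (p/2) (1 - p/2)]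
        have := Real.rpow_pos_of_pos hα (1-p/2)
        have h3 : 1 - p/2 ≠ 0 := by linarith
        generalize α ^ (1 - p/2) = A1 at *
        generalize α ^ (p/2) = A2 at *
        generalize κ ^ (1 - p/2) = A3 at *
        generalize 1 - p/2 = A4 at *
        field_simp
    _ ≤ _ := by
        rw [lintegral_const_mul' _ _ (by finiteness)]
        exact mul_le_of_le_one_right' hv

lemma minbound {p A : RR} (hp : 1 < p) (hp2 : p < 2) (hA : 0 < A) (v w : RR → ℝ≥0∞) (hvm : Measurable v) (hwm : Measurable w)
    (hv : ∫⁻ α in Set.Ioi (0:RR), v α * eo (α ^ (p-1)) ≤ 1)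
    (hw : ∫⁻ α in Set.Ioi (0:RR), w α * eo (α ^ (p-1)) ≤ 1) (Φ : RR → RR → ℝ≥0∞)
    (h1 : ∀ α > 0, ∀ β > 0, Φ α β ≤ eo A * (v α * w β)) (h2 : ∀ α > 0, ∀ β > 0, Φ α β ≤ v α ^ (1/2 : RR) * w β ^ (1/2:RR)) :
    ∫⁻ α in Set.Ioi (0:RR), ∫⁻ β in Set.Ioi (0:RR), Φ α β ≤ eo ((1 + 1/(1-p/2)) * A ^ (2/p - 1)) := by
  set κ := A ^ (2/p) with hκd
  have hκ : 0 < κ := by positivity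
  have hset : MeasurableSet {q : RR × RR | q.2 ∈ Set.Ioc 0 (κ/q.1)} := by
    refine (measurableSet_lt measurable_const measurable_snd).inter (measurableSet_le measurable_snd (by fun_prop))
  have hmI : Measurable (fun q : RR × RR => (Set.Ioc 0 (κ/q.1)).indicator (fun β => eo (β ^ (-(p/2)))) q.2) := by
    have : Measurable (fun q : RR × RR => eo (q.2 ^ (-(p/2)))) := by fun_prop
    exact this.indicator hset
  have hm1 : Measurable (fun q : RR × RR => 2⁻¹ * (v q.1 * eo (q.1 ^ (p/2)) * (Set.Ioc 0 (κ/q.1)).indicator (fun β => eo (β ^ (-(p/2)))) q.2)) := by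
    fun_prop
  have hm2 : Measurable (fun q : RR × RR => 2⁻¹ * (w q.2 * eo (q.2 ^ (p/2)) * (Set.Ioc 0 (κ/q.2)).indicator (fun β => eo (β ^ (-(p/2)))) q.1)) := by
    have := hmI.comp measurable_swap
    simp only [Function.comp_def, Prod.fst_swap, Prod.snd_swap] at this
    fun_prop
  have hm0 : Measurable (fun q : RR × RR => eo (A * κ ^ (1 - p)) * ((v q.1 * eo (q.1 ^ (p-1))) * (w q.2 * eo (q.2 ^ (p-1))))) := by
    fun_prop
  calc _ ≤ ∫⁻ α in Set.Ioi (0:RR), ∫⁻ β in Set.Ioi (0:RR), _ := 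
        setLIntegral_mono' measurableSet_Ioi fun α hα => setLIntegral_mono' measurableSet_Ioi fun β hβ =>
          minbound_pt hp hA hκ (v α) (w β) (Φ α β) hα hβ (h1 α hα β hβ) (h2 α hα β hβ)
    _ = (∫⁻ α in Set.Ioi (0:RR), ∫⁻ β in Set.Ioi (0:RR), eo (A * κ ^ (1 - p)) * ((v α * eo (α ^ (p-1))) * (w β * eo (β ^ (p-1))))) +
        ((∫⁻ α in Set.Ioi (0:RR), ∫⁻ β in Set.Ioi (0:RR), 2⁻¹ * (v α * eo (α ^ (p/2)) * (Set.Ioc 0 (κ/α)).indicator (fun β => eo (β ^ (-(p/2)))) β)) +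
        ∫⁻ α in Set.Ioi (0:RR), ∫⁻ β in Set.Ioi (0:RR), 2⁻¹ * (w β * eo (β ^ (p/2)) * (Set.Ioc 0 (κ/β)).indicator (fun α => eo (α ^ (-(p/2)))) α)) := by
        rw [← lintegral_add_left hm1.lintegral_prod_right', ← lintegral_add_left hm0.lintegral_prod_right']
        refine lintegral_congr fun α => ?_
        have a0 := hm0.comp (measurable_const.prodMk measurable_id : Measurable fun β : RR => (α, β))
        have a1 := hm1.comp (measurable_const.prodMk measurable_id : Measurable fun β : RR => (α, β))
        simp only [Function.comp_def] at a0 a1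
        rw [lintegral_add_left a0, lintegral_add_left a1]
    _ ≤ eo (A * κ ^ (1 - p)) + (2⁻¹ * eo (κ ^ (1 - p/2) / (1 - p/2)) + 2⁻¹ * eo (κ ^ (1 - p/2) / (1 - p/2))) := by
        refine add_le_add ?_ (add_le_add (minbound_half hp2 hκ v hv) ?_)
        · have : ∀ α : RR, ∫⁻ β in Set.Ioi (0:RR), eo (A * κ ^ (1 - p)) * ((v α * eo (α ^ (p-1))) * (w β * eo (β ^ (p-1)))) ≤
            eo (A * κ ^ (1 - p)) * (v α * eo (α ^ (p-1))) := by
            intro α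
            rw [lintegral_const_mul' _ _ (by simp), lintegral_const_mul _ (by fun_prop)]
            refine mul_le_mul_right ?_ _
            exact mul_le_of_le_one_right' hw
          refine (lintegral_mono this).trans ?_
          rw [lintegral_const_mul' _ _ (by simp)]
          exact mul_le_of_le_one_right' hv
        · rw [lintegral_lintegral_swap hm2.aemeasurable]
          exact minbound_half hp2 hκ w hw
    _ = _ := by
        rw [← add_mul, ENNReal.inv_two_add_inv_two, one_mul, ← ENNReal.ofReal_add (by positivity) (div_nonneg (by positivity) (by linarith))]
        congr 1
        have e1 : A * κ ^ (1-p) = A ^ (2/p - 1) := by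
          rw [hκd, ← Real.rpow_mul hA.le]
          conv_lhs => rw [← Real.rpow_one A, Real.rpow_one A, mul_comm]
          rw [← Real.rpow_add_one hA.ne']
          congr 1; field_simp; ring
        have e2 : κ ^ (1-p/2) = A ^ (2/p - 1) := by
          rw [hκd, ← Real.rpow_mul hA.le]
          congr 1; field_simp
        rw [e1, e2]; ring

section interp2
variable {X Y : Type*} [MeasurableSpace X] [MeasurableSpace Y]

def Cint (p : RR) : RR := 1 + 1/(1-p/2)

lemma Cint_pos {p : RR} (hp2 : p ≤ 2) : 0 < Cint p := by
  unfold Cint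
  have : 0 ≤ 1/(1-p/2) := by apply div_nonneg <;> linarith
  linarith

lemma dist_le (μ : Measure X) (f : X → CC) (hf : Measurable f) {p : RR} (hp : 1 < p) (h : ∫⁻ x, ‖f x‖ₑ ^ p ∂μ ≤ 1) :
    ∫⁻ α in Set.Ioi (0:RR), μ {x | α < ‖f x‖} * eo (α ^ (p-1)) ≤ 1 := by
  have := lintegral_rpow_eq_lintegral_meas_lt_mul μ (f := fun x => ‖f x‖) (ae_of_all _ fun x => norm_nonneg _) hf.norm.aemeasurable (p := p) (by linarith)
  have e : ∫⁻ x, eo (‖f x‖ ^ p) ∂μ = ∫⁻ x, ‖f x‖ₑ ^ p ∂μ := by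
    refine lintegral_congr fun x => ?_
    rw [← ENNReal.ofReal_rpow_of_nonneg (norm_nonneg _) (by linarith), ofReal_norm]
  rw [e] at this
  rw [this] at h
  refine le_trans ?_ h
  refine le_mul_of_one_le_left' ?_
  rw [← ENNReal.ofReal_one]; exact ENNReal.ofReal_le_ofReal hp.le

lemma interp_norm (μ : Measure X) (ν : Measure Y) [SFinite μ] [SFinite ν] (K : X → Y → CC) (hK : Measurable (uncurry K))
    {A : RR} (hA0 : 0 < A) (hA : ∀ x y, ‖K x y‖ ≤ A)
    (hL : ∀ (f : X → CC) (g : Y → CC), Measurable f → Measurable g → Integrable f μ → Integrable g ν →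
      ‖∫ x, ∫ y, K x y * f x * g y ∂ν ∂μ‖ₑ ≤ (∫⁻ x, ‖f x‖ₑ ^ 2 ∂μ) ^ (1/2:RR) * (∫⁻ y, ‖g y‖ₑ ^ 2 ∂ν) ^ (1/2:RR))
    {p : RR} (hp : 1 < p) (hp2 : p < 2)
    (f : X → CC) (g : Y → CC) (hf : Measurable f) (hg : Measurable g)
    (hfi : Integrable f μ) (hgi : Integrable g ν) (hf1 : ∫⁻ x, ‖f x‖ₑ ^ p ∂μ ≤ 1) (hg1 : ∫⁻ x, ‖g x‖ₑ ^ p ∂ν ≤ 1) :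
    ‖∫ x, ∫ y, K x y * f x * g y ∂ν ∂μ‖ₑ ≤ eo (Cint p * A ^ (2/p - 1)) := by
  refine (layer2 μ ν K hK A hA f g hf hg hfi hgi).trans ?_
  refine minbound hp hp2 hA0 (fun α => μ {x | α < ‖f x‖}) (fun α => ν {x | α < ‖g x‖}) ?_ ?_ (dist_le μ f hf hp hf1) (dist_le ν g hg hp hg1) _ ?_ ?_
  · exact Antitone.measurable fun α β h => measure_mono fun x hx => lt_of_le_of_lt h hx
  · exact Antitone.measurable fun α β h => measure_mono fun x hx => lt_of_le_of_lt h hx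
  · intro α hα β hβ
    refine (enorm_integral_le_lintegral_enorm _).trans ?_
    have : ∀ x, ‖∫ y, K x y * lv f α x * lv g β y ∂ν‖ₑ ≤ (eo A * ν {x | β < ‖g x‖}) * ‖lv f α x‖ₑ := by
      intro x
      refine (enorm_integral_le_lintegral_enorm _).trans ?_
      rw [← lv_lint g hg ν hβ, ← lintegral_const_mul' _ _ (by simp), ← lintegral_mul_const' _ _ (by simp)]
      refine lintegral_mono fun y => ?_
      simp only [enorm_mul]
      rw [mul_right_comm]
      gcongr
      rw [← ofReal_norm]; exact ENNReal.ofReal_le_ofReal (hA x y)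
    refine (lintegral_mono this).trans ?_
    rw [lintegral_const_mul _ (lv_measurable' f hf α).enorm, lv_lint f hf μ hα]
    refine le_of_eq ?_
    ring
  · intro α hα β hβ
    have := hL (lv f α) (lv g β) (lv_measurable' f hf α) (lv_measurable' g hg β) (lv_integrable μ f hf hfi hα) (lv_integrable ν g hg hgi hβ)
    rwa [lv_lint2 f hf μ hα, lv_lint2 g hg ν hβ] at this

lemma interp (μ : Measure X) (ν : Measure Y) [SFinite μ] [SFinite ν] (K : X → Y → CC) (hK : Measurable (uncurry K))
    {A : RR} (hA0 : 0 < A) (hA : ∀ x y, ‖K x y‖ ≤ A)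
    (hL : ∀ (f : X → CC) (g : Y → CC), Measurable f → Measurable g → Integrable f μ → Integrable g ν →
      ‖∫ x, ∫ y, K x y * f x * g y ∂ν ∂μ‖ₑ ≤ (∫⁻ x, ‖f x‖ₑ ^ 2 ∂μ) ^ (1/2:RR) * (∫⁻ y, ‖g y‖ₑ ^ 2 ∂ν) ^ (1/2:RR))
    {p : RR} (hp : 1 < p) (hp2 : p ≤ 2)
    (f : X → CC) (g : Y → CC) (hf : Measurable f) (hg : Measurable g)
    (hfi : Integrable f μ) (hgi : Integrable g ν) :
    ‖∫ x, ∫ y, K x y * f x * g y ∂ν ∂μ‖ₑ ≤ eo (Cint p * A ^ (2/p - 1)) *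
      ((∫⁻ x, ‖f x‖ₑ ^ p ∂μ) ^ (1/p) * (∫⁻ x, ‖g x‖ₑ ^ p ∂ν) ^ (1/p)) := by
  have hp0 : 0 < p := by linarith
  rcases hp2.lt_or_eq with hp2' | rfl
  swap
  · have := hL f g hf hg hfi hgi
    have e : eo (Cint 2 * A ^ ((2:RR)/2 - 1)) = 1 := by norm_num [Cint]
    rw [e, one_mul]
    simpa using this
  set N := (∫⁻ x, ‖f x‖ₑ ^ p ∂μ) ^ (1/p) with hN
  set M := (∫⁻ x, ‖g x‖ₑ ^ p ∂ν) ^ (1/p) with hM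
  rcases eq_or_ne N 0 with h0 | h0
  · have : f =ᵐ[μ] 0 := by
      have h := h0
      rw [hN, ENNReal.rpow_eq_zero_iff_of_pos (by positivity), lintegral_eq_zero_iff (hf.enorm.pow_const p)] at h
      filter_upwards [h] with x hx
      simpa [ENNReal.rpow_eq_zero_iff_of_pos hp0] using hx
    have e : ∫ x, ∫ y, K x y * f x * g y ∂ν ∂μ = 0 := by
      rw [integral_congr_ae (g := fun _ => 0)]
      · simp
      · filter_upwards [this] with x hx
        simp [hx]
    simp [e]
  rcases eq_or_ne M 0 with h1 | h1
  · have : g =ᵐ[ν] 0 := by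
      have h := h1
      rw [hM, ENNReal.rpow_eq_zero_iff_of_pos (by positivity), lintegral_eq_zero_iff (hg.enorm.pow_const p)] at h
      filter_upwards [h] with x hx
      simpa [ENNReal.rpow_eq_zero_iff_of_pos hp0] using hx
    have e : ∀ x, ∫ y, K x y * f x * g y ∂ν = 0 := by
      intro x
      rw [integral_congr_ae (g := fun _ => 0)]
      · simp
      · filter_upwards [this] with x hx
        simp [hx]
    simp [e]
  have hC : eo (Cint p * A ^ (2/p - 1)) ≠ 0 := by
    have := Cint_pos hp2
    simp only [ne_eq, ENNReal.ofReal_eq_zero, not_le]; positivity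
  rcases eq_or_ne N ⊤ with h2 | h2
  · rw [h2, ENNReal.top_mul h1, ENNReal.mul_top hC]; exact le_top
  rcases eq_or_ne M ⊤ with h3 | h3
  · rw [h3, ENNReal.mul_top h0, ENNReal.mul_top hC]; exact le_top
  have nrm : ∀ (I N : ℝ≥0∞), N = I ^ (1/p) → N ≠ 0 → N ≠ ⊤ → ‖((N.toReal⁻¹ : RR):CC)‖ₑ ^ p * I ≤ 1 := by
    intro I N h h0 h1
    have hpos := ENNReal.toReal_pos h0 h1
    have : I = N ^ p := by rw [h, ← ENNReal.rpow_mul]; simp [hp0.ne']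
    rw [this, ← ofReal_norm, Complex.norm_real, Real.norm_of_nonneg (by positivity), ENNReal.ofReal_inv_of_pos hpos, ENNReal.ofReal_toReal h1,
      ← ENNReal.mul_rpow_of_nonneg _ _ hp0.le, ENNReal.inv_mul_cancel h0 h1]
    simp
  have key := interp_norm μ ν K hK hA0 hA hL hp hp2' (fun x => ((N.toReal⁻¹ : RR):CC) * f x) (fun x => ((M.toReal⁻¹ : RR):CC) * g x)
    (hf.const_mul _) (hg.const_mul _) (hfi.const_mul _) (hgi.const_mul _) (by
      simp_rw [enorm_mul, ENNReal.mul_rpow_of_nonneg _ _ hp0.le]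
      rw [lintegral_const_mul _ (hf.enorm.pow_const p)]
      exact nrm _ _ hN h0 h2) (by
      simp_rw [enorm_mul, ENNReal.mul_rpow_of_nonneg _ _ hp0.le]
      rw [lintegral_const_mul _ (hg.enorm.pow_const p)]
      exact nrm _ _ hM h1 h3)
  have e : ∫ x, ∫ y, K x y * f x * g y ∂ν ∂μ = ((N.toReal : RR):CC) * ((M.toReal : RR):CC) * ∫ x, ∫ y, K x y * (((N.toReal⁻¹ : RR):CC) * f x) * (((M.toReal⁻¹ : RR):CC) * g y) ∂ν ∂μ := by
    rw [← integral_const_mul]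
    congr 1; ext x
    rw [← integral_const_mul]
    congr 1; ext y
    have h4 : (N.toReal:CC) ≠ 0 := by exact_mod_cast (ENNReal.toReal_pos h0 h2).ne'
    have h5 : (M.toReal:CC) ≠ 0 := by exact_mod_cast (ENNReal.toReal_pos h1 h3).ne'
    push_cast
    field_simp
  rw [e, enorm_mul, enorm_mul, mul_comm]
  have en : ∀ N : ℝ≥0∞, N ≠ ⊤ → ‖((N.toReal : RR):CC)‖ₑ = N := by
    intro N h
    rw [← ofReal_norm, Complex.norm_real, Real.norm_of_nonneg (by positivity), ENNReal.ofReal_toReal h]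
  rw [en N h2, en M h3]
  exact mul_le_mul_left key _
end interp2

lemma even_lint (φ : RR → ℝ≥0∞) : ∫⁻ u : RR, φ |u| = 2 * ∫⁻ u in Set.Ioi (0:RR), φ u := by
  have h1 : ∫⁻ u in Set.Ioi (0:RR), φ |u| = ∫⁻ u in Set.Ioi (0:RR), φ u :=
    setLIntegral_congr_fun measurableSet_Ioi fun u hu => by simp only [abs_of_pos (show (0:RR) < u from hu)]
  have h2 : ∫⁻ u in Set.Iic (0:RR), φ |u| = ∫⁻ u in Set.Ioi (0:RR), φ u := by
    rw [← h1, ← lintegral_indicator measurableSet_Iic, ← lintegral_neg_eq_self, setLIntegral_congr (Ioi_ae_eq_Ici (a := (0:RR))), ← lintegral_indicator measurableSet_Ici]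
    refine lintegral_congr fun u => ?_
    simp only [Set.indicator, Set.mem_Iic, Set.mem_Ici, abs_neg, neg_nonpos]
  rw [← lintegral_add_compl (fun u => φ |u|) (measurableSet_Ioi (a := (0:RR))), Set.compl_Ioi, h1, h2, two_mul]

def Chls (lam : RR) : RR := 2 / (1 - lam) + 2 ^ (lam/2)

lemma Chls_pos {lam : RR} (h1 : lam < 1) : 0 < Chls lam := by
  unfold Chls
  have : 0 < 2/(1-lam) := by apply div_pos <;> linarith
  positivity

lemma hls_near {lam : RR} (h1 : lam < 1) {R : RR} (hR : 0 < R) (t : RR) :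
    ∫⁻ s : RR, {s : RR | |t - s| < R}.indicator (fun s => eo (|t - s| ^ (-lam))) s ≤ eo (2 / (1-lam) * R ^ (1-lam)) := by
  have e : ∀ s : RR, {s : RR | |t - s| < R}.indicator (fun s => eo (|t - s| ^ (-lam))) s = (Set.Iio R).indicator (fun u => eo (u ^ (-lam))) |t - s| := by
    intro s; simp [Set.indicator]
  simp_rw [e]
  rw [lintegral_sub_left_eq_self (fun u => (Set.Iio R).indicator (fun u => eo (u ^ (-lam))) |u|) t, even_lint, setLIntegral_indicator measurableSet_Iio]
  calc _ ≤ 2 * ∫⁻ u in Set.Ioc 0 R, eo (u ^ (-lam)) := by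
        gcongr
        intro x hx; exact ⟨hx.2, le_of_lt hx.1⟩
    _ = _ := by
        rw [lint_pow_Ioc h1 hR]
        rw [← ENNReal.ofReal_ofNat, ← ENNReal.ofReal_mul (by norm_num)]
        congr 1; ring

lemma hls_far {lam : RR} (h0 : 0 < lam) {R : RR} (hR : 0 < R) (t : RR) :
    ∫⁻ s : RR, ({s : RR | |t - s| < R}ᶜ.indicator (fun s => eo (|t - s| ^ (-lam))) s) ^ (2/lam) ≤ eo (2 / R) := by
  have e : ∀ s : RR, ({s : RR | |t - s| < R}ᶜ.indicator (fun s => eo (|t - s| ^ (-lam))) s) ^ (2/lam) = (Set.Ici R).indicator (fun u => eo (u ^ (-2 : RR))) |t - s| := by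
    intro s
    by_cases h : |t - s| < R
    · simp [h, not_le.2 h, h0]
    · simp only [Set.indicator, Set.mem_compl_iff, Set.mem_ofPred_eq, h, not_false_eq_true, if_true, Set.mem_Ici, not_lt.1 h]
      rw [ENNReal.ofReal_rpow_of_nonneg (by positivity) (by positivity), ← Real.rpow_mul (abs_nonneg _)]
      congr 2; field_simp
  simp_rw [e]
  rw [lintegral_sub_left_eq_self (fun u => (Set.Ici R).indicator (fun u => eo (u ^ (-2:RR))) |u|) t, even_lint, setLIntegral_indicator measurableSet_Ici]
  rw [Set.inter_eq_left.2 (Set.Ici_subset_Ioi.2 hR), setLIntegral_congr Ioi_ae_eq_Ici.symm]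
  rw [← ofReal_integral_eq_lintegral_ofReal (integrableOn_Ioi_rpow_of_lt (by norm_num) hR)]
  · rw [integral_Ioi_rpow_of_lt (by norm_num) hR, ← ENNReal.ofReal_ofNat, ← ENNReal.ofReal_mul (by norm_num)]
    apply ENNReal.ofReal_le_ofReal
    norm_num [Real.rpow_neg_one]
    rw [div_eq_mul_inv]
  · exact (ae_restrict_iff' measurableSet_Ioi).2 (ae_of_all _ fun x hx => Real.rpow_nonneg (hR.le.trans (le_of_lt hx)) _)

lemma hls_inner {lam p : RR} (h0 : 0 < lam) (h1 : lam < 1) (hp : p = 2/(2-lam)) (G : RR → ℝ≥0∞) (hG : Measurable G)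
    (hG1 : ∫⁻ s, G s ^ p ≤ 1) (t : RR) (F : ℝ≥0∞) :
    F * ∫⁻ s, {s | G s ≤ F}.indicator (fun s => eo (|t - s| ^ (-lam)) * G s) s ≤ eo (Chls lam) * F ^ p := by
  have hp0 : 0 < p := by rw [hp]; apply div_pos <;> linarith
  rcases eq_or_ne F 0 with rfl | hF0
  · simp
  rcases eq_or_ne F ⊤ with rfl | hFt
  · rw [ENNReal.top_rpow_of_pos hp0, ENNReal.mul_top]; · exact le_top
    simpa using Chls_pos h1
  lift F to ℝ≥0 using hFt
  have hFp : 0 < (F:RR) := by exact_mod_cast pos_iff_ne_zero.2 (show F ≠ 0 by simpa using hF0)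
  set R : RR := (F:RR) ^ (-p) with hRd
  have hR : 0 < R := by positivity
  have hms : MeasurableSet {s : RR | |t - s| < R} := measurableSet_lt (by fun_prop) measurable_const
  have hkm : Measurable fun s => eo (|t - s| ^ (-lam)) := by fun_prop
  have hconj : (2/lam).HolderConjugate p := by
    rw [hp, Real.holderConjugate_iff]
    constructor
    · rw [lt_div_iff₀ h0]; linarith
    · have : 2 - lam ≠ 0 := by linarith
      field_simp; ring
  have key : ∫⁻ s, {s | G s ≤ F}.indicator (fun s => eo (|t - s| ^ (-lam)) * G s) s ≤ eo (Chls lam) * eo (F ^ (p - 1)) := by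
    calc _ ≤ ∫⁻ s, ({s : RR | |t - s| < R}.indicator (fun s => eo (|t - s| ^ (-lam))) s * F + 
          {s : RR | |t - s| < R}ᶜ.indicator (fun s => eo (|t - s| ^ (-lam))) s * G s) := by
          refine lintegral_mono fun s => ?_
          by_cases hs : G s ≤ F
          · by_cases h : |t - s| < R
            · simp [hs, h]; gcongr
            · simp [hs, h]
          · simp [hs]
      _ = (∫⁻ s, {s : RR | |t - s| < R}.indicator (fun s => eo (|t - s| ^ (-lam))) s) * F + 
          ∫⁻ s, {s : RR | |t - s| < R}ᶜ.indicator (fun s => eo (|t - s| ^ (-lam))) s * G s := by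
          rw [lintegral_add_left ((hkm.indicator hms).mul_const _), lintegral_mul_const _ (hkm.indicator hms)]
      _ ≤ eo (2 / (1-lam) * R ^ (1-lam)) * F + eo (2/R) ^ (lam/2) * 1 := by
          refine add_le_add (mul_le_mul_left (hls_near h1 hR t) _) ?_
          refine (ENNReal.lintegral_mul_le_Lp_mul_Lq volume hconj (hkm.indicator hms.compl).aemeasurable hG.aemeasurable).trans ?_
          rw [one_div_div]
          refine mul_le_mul' (ENNReal.rpow_le_rpow (hls_far h0 hR t) (by positivity)) ?_
          exact ENNReal.rpow_le_one hG1 (by positivity)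
      _ = _ := by
          have h2l : 0 < 2 - lam := by linarith
          have h1l : 0 < 1 - lam := by linarith
          rw [mul_one, ENNReal.ofReal_rpow_of_nonneg (by positivity) (by positivity), ← ENNReal.ofReal_coe_nnreal, ← ENNReal.ofReal_mul (by positivity),
            ← ENNReal.ofReal_add (by positivity) (by positivity), ← ENNReal.ofReal_mul (Chls_pos h1).le]
          congr 1
          have e1 : R ^ (1-lam) * F = F ^ (p-1) := by
            rw [hRd, ← Real.rpow_mul hFp.le, ← Real.rpow_add_one hFp.ne', hp]
            congr 1; field_simp; ring
          have e2 : (2/R)^(lam/2) = 2 ^ (lam/2) * F ^ (p-1) := by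
            rw [Real.div_rpow (by norm_num) hR.le, div_eq_mul_inv, ← Real.rpow_neg hR.le, hRd, ← Real.rpow_mul hFp.le, hp]
            congr 2; field_simp; ring
          rw [mul_assoc, e1, e2, Chls]; ring
  calc _ ≤ F * (eo (Chls lam) * eo (F ^ (p - 1))) := mul_le_mul_right key _
    _ = _ := by
      rw [← ENNReal.ofReal_coe_nnreal, ENNReal.ofReal_rpow_of_nonneg hFp.le hp0.le, mul_left_comm, ← ENNReal.ofReal_mul hFp.le]
      congr 2
      rw [mul_comm, ← Real.rpow_add_one hFp.ne']; congr 1; ring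

lemma hls_norm {lam p : RR} (h0 : 0 < lam) (h1 : lam < 1) (hp : p = 2/(2-lam)) (F G : RR → ℝ≥0∞) (hF : Measurable F) (hG : Measurable G)
    (hF1 : ∫⁻ s, F s ^ p ≤ 1) (hG1 : ∫⁻ s, G s ^ p ≤ 1) :
    ∫⁻ t, ∫⁻ s, eo (|t - s| ^ (-lam)) * (F t * G s) ≤ eo (2 * Chls lam) := by
  have half : ∀ (F G : RR → ℝ≥0∞) (hF : Measurable F) (hG : Measurable G)
    (hF1 : ∫⁻ s, F s ^ p ≤ 1) (hG1 : ∫⁻ s, G s ^ p ≤ 1), 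
    ∫⁻ t, ∫⁻ s, {q : RR × RR | G q.2 ≤ F q.1}.indicator (fun q => eo (|q.1 - q.2| ^ (-lam)) * (F q.1 * G q.2)) (t, s) ≤ eo (Chls lam) := by
    intro F G hF hG hF1 hG1
    calc _ = ∫⁻ t, F t * ∫⁻ s, {s | G s ≤ F t}.indicator (fun s => eo (|t - s| ^ (-lam)) * G s) s := by
          refine lintegral_congr fun t => ?_
          rw [← lintegral_const_mul _ (Measurable.indicator (by fun_prop) (measurableSet_le hG measurable_const))]
          refine lintegral_congr fun s => ?_
          by_cases h : G s ≤ F t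
          · simp [h]; ring
          · simp [h]
      _ ≤ ∫⁻ t, eo (Chls lam) * F t ^ p := lintegral_mono fun t => hls_inner h0 h1 hp G hG hG1 t (F t)
      _ ≤ _ := by
          rw [lintegral_const_mul' _ _ (by simp)]
          exact mul_le_of_le_one_right' hF1
  have hm : ∀ (F G : RR → ℝ≥0∞) (hF : Measurable F) (hG : Measurable G), Measurable ({q : RR × RR | G q.2 ≤ F q.1}.indicator (fun q => eo (|q.1 - q.2| ^ (-lam)) * (F q.1 * G q.2))) := by
    intro F G hF hG
    exact Measurable.indicator (by fun_prop) (measurableSet_le (by fun_prop) (by fun_prop))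
  calc _ ≤ ∫⁻ t, ∫⁻ s, ({q : RR × RR | G q.2 ≤ F q.1}.indicator (fun q => eo (|q.1 - q.2| ^ (-lam)) * (F q.1 * G q.2)) (t, s) +
        {q : RR × RR | F q.2 ≤ G q.1}.indicator (fun q => eo (|q.1 - q.2| ^ (-lam)) * (G q.1 * F q.2)) (s, t)) := by
        refine lintegral_mono fun t => lintegral_mono fun s => ?_
        rcases le_total (G s) (F t) with h | h
        · refine le_trans (le_of_eq ?_) le_self_add
          simp [h]
        · refine le_trans (le_of_eq ?_) le_add_self
          simp [h, abs_sub_comm, mul_comm (F t)]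
    _ = (∫⁻ t, ∫⁻ s, {q : RR × RR | G q.2 ≤ F q.1}.indicator (fun q => eo (|q.1 - q.2| ^ (-lam)) * (F q.1 * G q.2)) (t, s)) + ∫⁻ t, ∫⁻ s, {q : RR × RR | F q.2 ≤ G q.1}.indicator (fun q => eo (|q.1 - q.2| ^ (-lam)) * (G q.1 * F q.2)) (s, t) := by
        rw [← lintegral_add_left ((hm F G hF hG).lintegral_prod_right' (ν := volume))]
        refine lintegral_congr fun t => ?_
        exact lintegral_add_left ((hm F G hF hG).comp (measurable_const.prodMk measurable_id : Measurable fun β : RR => (t, β))) _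
    _ ≤ eo (Chls lam) + eo (Chls lam) := by
        refine add_le_add (half F G hF hG hF1 hG1) ?_
        rw [lintegral_lintegral_swap (f := fun t s => {q : RR × RR | F q.2 ≤ G q.1}.indicator (fun q => eo (|q.1 - q.2| ^ (-lam)) * (G q.1 * F q.2)) (s, t)) ((hm G F hG hF).comp measurable_swap).aemeasurable]
        exact half G F hG hF hG1 hF1
    _ = _ := by rw [← ENNReal.ofReal_add (Chls_pos h1).le (Chls_pos h1).le, two_mul]

lemma hls {lam p : RR} (h0 : 0 < lam) (h1 : lam < 1) (hp : p = 2/(2-lam)) (F G : RR → ℝ≥0∞) (hF : Measurable F) (hG : Measurable G) :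
    ∫⁻ t, ∫⁻ s, eo (|t - s| ^ (-lam)) * (F t * G s) ≤ eo (2 * Chls lam) * ((∫⁻ s, F s ^ p) ^ (1/p) * (∫⁻ s, G s ^ p) ^ (1/p)) := by
  have hp0 : 0 < p := by rw [hp]; apply div_pos <;> linarith
  have hz : ∀ (F : RR → ℝ≥0∞), Measurable F → (∫⁻ s, F s ^ p) ^ (1/p) = 0 → ∀ᵐ s, F s = 0 := by
    intro F hF h
    rw [ENNReal.rpow_eq_zero_iff_of_pos (by positivity), lintegral_eq_zero_iff (hF.pow_const p)] at h
    filter_upwards [h] with x hx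
    simpa [ENNReal.rpow_eq_zero_iff_of_pos hp0] using hx
  set N := (∫⁻ s, F s ^ p) ^ (1/p) with hN
  set M := (∫⁻ s, G s ^ p) ^ (1/p) with hM
  rcases eq_or_ne N 0 with hN0 | hN0
  · have e : ∫⁻ t, ∫⁻ s, eo (|t - s| ^ (-lam)) * (F t * G s) = 0 := by
      rw [lintegral_congr_ae (g := fun _ => 0)]
      · simp
      · filter_upwards [hz F hF hN0] with x hx
        simp [hx]
    rw [e]; exact zero_le
  rcases eq_or_ne M 0 with hM0 | hM0
  · have e : ∀ t, ∫⁻ s, eo (|t - s| ^ (-lam)) * (F t * G s) = 0 := by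
      intro t
      rw [lintegral_congr_ae (g := fun _ => 0)]
      · simp
      · filter_upwards [hz G hG hM0] with x hx
        simp [hx]
    simp [e]
  have hC : eo (2 * Chls lam) ≠ 0 := by
    have := Chls_pos h1
    simp only [ne_eq, ENNReal.ofReal_eq_zero, not_le]; positivity
  rcases eq_or_ne N ⊤ with h2 | h2
  · rw [h2, ENNReal.top_mul hM0, ENNReal.mul_top hC]; exact le_top
  rcases eq_or_ne M ⊤ with h3 | h3
  · rw [h3, ENNReal.mul_top hN0, ENNReal.mul_top hC]; exact le_top
  have nrm : ∀ (F : RR → ℝ≥0∞) (hF : Measurable F) (N : ℝ≥0∞), N = (∫⁻ s, F s ^ p) ^ (1/p) → N ≠ 0 → N ≠ ⊤ → ∫⁻ s, (N⁻¹ * F s) ^ p ≤ 1 := by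
    intro F hF N h h0 h1
    have : ∫⁻ s, F s ^ p = N ^ p := by rw [h, ← ENNReal.rpow_mul]; simp [hp0.ne']
    simp_rw [ENNReal.mul_rpow_of_nonneg _ _ hp0.le]
    rw [lintegral_const_mul _ (hF.pow_const p), this, ← ENNReal.mul_rpow_of_nonneg _ _ hp0.le, ENNReal.inv_mul_cancel h0 h1]
    simp
  have key := hls_norm h0 h1 hp (fun s => N⁻¹ * F s) (fun s => M⁻¹ * G s) (hF.const_mul _) (hG.const_mul _) (nrm F hF N hN hN0 h2) (nrm G hG M hM hM0 h3)
  have e : ∫⁻ t, ∫⁻ s, eo (|t - s| ^ (-lam)) * (F t * G s) = (N * M) * ∫⁻ t, ∫⁻ s, eo (|t - s| ^ (-lam)) * ((N⁻¹ * F t) * (M⁻¹ * G s)) := by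
    rw [← lintegral_const_mul' _ _ (ENNReal.mul_ne_top h2 h3)]
    refine lintegral_congr fun t => ?_
    rw [← lintegral_const_mul' _ _ (ENNReal.mul_ne_top h2 h3)]
    refine lintegral_congr fun s => ?_
    calc _ = (N * N⁻¹) * (M * M⁻¹) * (eo (|t - s| ^ (-lam)) * (F t * G s)) := by
          rw [ENNReal.mul_inv_cancel hN0 h2, ENNReal.mul_inv_cancel hM0 h3]; simp
      _ = _ := by ring
  rw [e, mul_comm]
  exact mul_le_mul_left key _

section csx
variable {X Y : Type*} [MeasurableSpace X] [MeasurableSpace Y]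

lemma cs_int (μ : Measure X) (f h : X → CC) (hf : AEMeasurable f μ) (hh : AEMeasurable h μ) :
    ‖∫ x, f x * h x ∂μ‖ₑ ≤ (∫⁻ x, ‖f x‖ₑ ^ 2 ∂μ) ^ (1/2:RR) * (∫⁻ x, ‖h x‖ₑ ^ 2 ∂μ) ^ (1/2:RR) := by
  refine (enorm_integral_le_lintegral_enorm _).trans ?_
  have := ENNReal.lintegral_mul_le_Lp_mul_Lq μ Real.HolderConjugate.two_two hf.enorm hh.enorm
  simpa [enorm_mul] using this

lemma trip (m : Measure X) (n : Measure Y) [SFinite m] [SFinite n] (k l : X → Y → CC) (hk : Measurable (uncurry k)) (hl : Measurable (uncurry l))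
    (A B : RR) (hA : ∀ x y, ‖k x y‖ ≤ A) (hB : ∀ x y, ‖l x y‖ ≤ B) (f h : Y → CC) (hf : Integrable f n) (hh : Integrable h n)
    (w : X → CC) (hw : Integrable w m) :
    ∫ x, (∫ y, k x y * f y ∂n) * (∫ y, l x y * h y ∂n) * w x ∂m = ∫ y, ∫ y', (∫ x, k x y * l x y' * w x ∂m) * f y * h y' ∂n ∂n := by
  have hm1 : Measurable (fun q : X × (Y × Y) => k q.1 q.2.1) := hk.comp (by fun_prop : Measurable fun q : X × (Y × Y) => (q.1, q.2.1))
  have hm2 : Measurable (fun q : X × (Y × Y) => l q.1 q.2.2) := hl.comp (by fun_prop : Measurable fun q : X × (Y × Y) => (q.1, q.2.2))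
  have hi : Integrable (uncurry fun x (p : Y × Y) => (k x p.1 * l x p.2) * (w x * (f p.1 * h p.2))) (m.prod (n.prod n)) := by
    refine Integrable.bdd_mul (c := A * B) (hw.mul_prod (hf.mul_prod hh)) (hm1.mul hm2).aestronglyMeasurable (ae_of_all _ fun p => ?_)
    rw [norm_mul]
    exact mul_le_mul (hA _ _) (hB _ _) (norm_nonneg _) ((norm_nonneg _).trans (hA p.1 p.2.1))
  have e1 : ∀ x, (∫ y, k x y * f y ∂n) * (∫ y, l x y * h y ∂n) * w x = ∫ p, (k x p.1 * l x p.2) * (w x * (f p.1 * h p.2)) ∂(n.prod n) := by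
    intro x
    rw [← integral_prod_mul, ← integral_mul_const]
    congr 1; ext p; ring
  simp_rw [e1]
  rw [integral_integral_swap hi]
  have hi2 := hi.integral_prod_right
  simp only [uncurry] at hi2
  rw [integral_prod _ hi2]
  congr 1; ext y; congr 1; ext y'
  rw [← integral_mul_const, ← integral_mul_const]
  congr 1; ext x
  ring

end csx

lemma free_L2_ext {d : ℕ} (hd : 1 ≤ d) (s : RR) (f : (Ed d) → CC) (hfm : Measurable f) (hf : Integrable f) :
    ∫⁻ x, ‖∫ y, Sfree d x y s * f y‖ₑ ^ 2 ≤ ∫⁻ y, ‖f y‖ₑ ^ 2 := by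
  rcases eq_or_ne s 0 with rfl | hs
  · simp [Sfree_zero hd]
  · exact free_L2 hd hs f hfm hf

lemma Uf_measurable {d : ℕ} (s : RR) (f : (Ed d) → CC) (hfm : Measurable f) :
    Measurable fun x => ∫ y, Sfree d x y s * f y := by
  have : Measurable (fun p : (Ed d) × (Ed d) => Sfree d p.1 p.2 s * f p.2) :=
    (Sfree_measurable d measurable_fst measurable_snd measurable_const).mul (hfm.comp measurable_snd)
  exact (this.stronglyMeasurable.integral_prod_right' (ν := volume)).measurable

lemma free_bil {d : ℕ} (hd : 1 ≤ d) {s : RR} (hs : s ≠ 0) {p : RR} (hp : 1 < p) (hp2 : p ≤ 2) (f g : (Ed d) → CC) (hf : Measurable f) (hg : Measurable g)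
    (hfi : Integrable f) (hgi : Integrable g) :
    ‖∫ x, ∫ y, Sfree d x y s * f x * g y‖ₑ ≤ eo (Cint p * |s| ^ (-((d:RR)/2*(2/p - 1)))) *
      ((∫⁻ x, ‖f x‖ₑ ^ p) ^ (1/p) * (∫⁻ x, ‖g x‖ₑ ^ p) ^ (1/p)) := by
  have hs' : 0 < |s| := abs_pos.2 hs
  have := interp volume volume (fun x y => Sfree d x y s) (Sfree_measurable d measurable_fst measurable_snd measurable_const)
    (A := |s| ^ (-(d:RR)/2)) (by positivity) (fun x y => norm_Sfree_le hd x y s) (fun f g hf hg hfi hgi => ?_) hp hp2 f g hf hg hfi hgi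
  · rw [← Real.rpow_mul hs'.le] at this
    convert this using 5
    ring
  · have e : ∀ x, ∫ y, Sfree d x y s * f x * g y = f x * ∫ y, Sfree d x y s * g y := by
      intro x; rw [← integral_const_mul]; congr 1; ext y; ring
    simp_rw [e]
    refine (cs_int volume f _ hf.aemeasurable (Uf_measurable s g hg).aemeasurable).trans ?_
    refine mul_le_mul_right (ENNReal.rpow_le_rpow ?_ (by norm_num)) _
    exact free_L2_ext hd s g hg hgi

lemma enorm_conj (z : CC) : ‖(starRingEnd CC) z‖ₑ = ‖z‖ₑ := by
  rw [← ofReal_norm, RCLike.norm_conj, ofReal_norm]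

lemma free_cross_bil {d : ℕ} (hd : 1 ≤ d) {τ σ ε : RR} (hτ : τ ≠ 0) (hσ : σ ≠ 0) (hne : τ ≠ σ) (hε : 0 < ε) {p : RR} (hp : 1 < p) (hp2 : p ≤ 2) 
    (f g : (Ed d) → CC) (hf : Measurable f) (hg : Measurable g) (hfi : Integrable f) (hgi : Integrable g) :
    ‖∫ x : Ed d, (∫ y, Sfree d x y τ * f y) * (starRingEnd CC) (∫ y, Sfree d x y σ * g y) * cexp (-(ε:CC) * ((∑ i, x i ^ 2 : RR):CC))‖ₑ ≤
     eo (Cint p * |τ - σ| ^ (-((d:RR)/2*(2/p - 1)))) *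
      ((∫⁻ x, ‖f x‖ₑ ^ p) ^ (1/p) * (∫⁻ x, ‖g x‖ₑ ^ p) ^ (1/p)) := by
  have hs' : 0 < |τ - σ| := abs_pos.2 (sub_ne_zero.2 hne)
  have hwi : Integrable (fun x : Ed d => cexp (-(ε:CC) * ((∑ i, x i ^ 2 : RR):CC))) := by
    have := (integrable_gauss_E d hε).ofReal (𝕜 := CC)
    simpa only [Complex.coe_algebraMap, RCLike.ofReal_eq_complex_ofReal, gauss_cast] using this
  set K : (Ed d) → (Ed d) → CC := fun y y' => ∫ x, Sfree d x y τ * (starRingEnd CC) (Sfree d x y' σ) * cexp (-(ε:CC) * ((∑ i, x i ^ 2 : RR):CC)) with hKd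
  have hK : Measurable (uncurry K) := by
    have : Measurable (fun q : ((Ed d) × (Ed d)) × (Ed d) => Sfree d q.2 q.1.1 τ * (starRingEnd CC) (Sfree d q.2 q.1.2 σ) * cexp (-(ε:CC) * ((∑ i, q.2 i ^ 2 : RR):CC))) := by
      refine ((Sfree_measurable d measurable_snd (measurable_fst.comp measurable_fst) measurable_const).mul (Complex.continuous_conj.measurable.comp 
        (Sfree_measurable d measurable_snd (measurable_snd.comp measurable_fst) measurable_const))).mul ?_
      fun_prop
    exact (this.stronglyMeasurable.integral_prod_right' (ν := volume)).measurable
  have hconj : ∀ (g : (Ed d) → CC) (x : Ed d), (starRingEnd CC) (∫ y, Sfree d x y σ * g y) = ∫ y, (starRingEnd CC) (Sfree d x y σ) * (starRingEnd CC) (g y) := by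
    intro g x; rw [← integral_conj]; simp
  have htrip : ∀ (f g : (Ed d) → CC) (hfi : Integrable f) (hgi : Integrable g),
      ∫ x : Ed d, (∫ y, Sfree d x y τ * f y) * (starRingEnd CC) (∫ y, Sfree d x y σ * g y) * cexp (-(ε:CC) * ((∑ i, x i ^ 2 : RR):CC)) =
      ∫ y, ∫ y', K y y' * f y * (starRingEnd CC) (g y') := by
    intro f g hfi hgi
    simp_rw [hconj]
    exact trip volume volume (fun x y => Sfree d x y τ) (fun x y => (starRingEnd CC) (Sfree d x y σ)) 
      (Sfree_measurable d measurable_fst measurable_snd measurable_const)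
      (Complex.continuous_conj.measurable.comp (Sfree_measurable d measurable_fst measurable_snd measurable_const)) _ _
      (fun x y => norm_Sfree_le hd x y τ) (fun x y => by rw [RCLike.norm_conj]; exact norm_Sfree_le hd x y σ) f (fun y => (starRingEnd CC) (g y)) hfi
      ((RCLike.conjLIE (K := CC)).integrable_comp_iff.2 hgi) _ hwi
  rw [htrip f g hfi hgi]
  have hgi' : Integrable (fun y => (starRingEnd CC) (g y)) := (RCLike.conjLIE (K := CC)).integrable_comp_iff.2 hgi
  have := interp volume volume K hK (A := |τ - σ| ^ (-(d:RR)/2)) (by positivity) (fun y y' => free_cross_bound d y y' hτ hσ hne hε) (fun f g hf hg hfi hgi => ?_) hp hp2 f 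
    (fun y => (starRingEnd CC) (g y)) hf (Complex.continuous_conj.measurable.comp hg) hfi hgi'
  · rw [← Real.rpow_mul hs'.le] at this
    simp only [enorm_conj] at this
    convert this using 5
    ring
  · have h1 := htrip f (fun y => (starRingEnd CC) (g y)) hfi ((RCLike.conjLIE (K := CC)).integrable_comp_iff.2 hgi)
    simp only [Complex.conj_conj] at h1
    rw [← h1]
    have hmc := Complex.continuous_conj.measurable.comp hg
    have h2 := cs_int (volume : Measure (Ed d)) (fun x => (∫ y, Sfree d x y τ * f y)) (fun x => (starRingEnd CC) (∫ y, Sfree d x y σ * (starRingEnd CC) (g y)) * cexp (-(ε:CC) * ((∑ i, x i ^ 2 : RR):CC)))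
      (Uf_measurable τ f hf).aemeasurable ((Complex.continuous_conj.measurable.comp (Uf_measurable σ _ hmc)).mul (by fun_prop)).aemeasurable
    simp only [← mul_assoc] at h2
    refine h2.trans ?_
    refine mul_le_mul' (ENNReal.rpow_le_rpow ?_ (by norm_num)) (ENNReal.rpow_le_rpow ?_ (by norm_num))
    · exact free_L2_ext hd τ f hf hfi
    · have h3 := free_L2_ext hd σ _ hmc ((RCLike.conjLIE (K := CC)).integrable_comp_iff.2 hgi)
      simp only [Function.comp_def, enorm_conj] at h3
      refine le_trans (lintegral_mono fun x => ?_) h3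
      simp only [enorm_mul, enorm_conj]
      gcongr
      refine mul_le_of_le_one_right' ?_
      rw [← gauss_cast, ← ofReal_norm, Complex.norm_real, Real.norm_of_nonneg (Real.exp_nonneg _)]
      refine ENNReal.ofReal_le_one.2 (Real.exp_le_one_iff.2 ?_)
      have : 0 ≤ ∑ i, x i ^ 2 := Finset.sum_nonneg fun i _ => sq_nonneg _
      nlinarith

section fatou
variable {X : Type*} [MeasurableSpace X]
lemma fatou_w (m : Measure X) (V : X → CC) (hV : Measurable V) (w : ℕ → X → RR) (hwm : ∀ j, Measurable (w j))
    (hw1 : ∀ x, Tendsto (fun j => w j x) atTop (𝓝 1)) (M : ℝ≥0∞)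
    (step : ∀ j, ∫⁻ x, ‖V x‖ₑ ^ 2 * eo (w j x) ∂m ≤ M) : ∫⁻ x, ‖V x‖ₑ ^ 2 ∂m ≤ M := by
  have hlim : ∀ x, Tendsto (fun j => ‖V x‖ₑ ^ 2 * eo (w j x)) atTop (𝓝 (‖V x‖ₑ^2)) := by
    intro x
    have h1 : Tendsto (fun j => eo (w j x)) atTop (𝓝 1) := by
      simpa using (ENNReal.tendsto_ofReal (hw1 x))
    simpa using ENNReal.Tendsto.const_mul h1 (Or.inr (by simp : ‖V x‖ₑ^2 ≠ ⊤))
  calc ∫⁻ x, ‖V x‖ₑ ^ 2 ∂m = ∫⁻ x, liminf (fun j => ‖V x‖ₑ ^ 2 * eo (w j x)) atTop ∂m :=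
        lintegral_congr fun x => (hlim x).liminf_eq.symm
    _ ≤ liminf (fun j => ∫⁻ x, ‖V x‖ₑ ^ 2 * eo (w j x) ∂m) atTop :=
        lintegral_liminf_le fun j => by have := hwm j; fun_prop
    _ ≤ _ := liminf_le_of_frequently_le' (Frequently.of_forall step)
end fatou

def lamE (d : ℕ) (a p : RR) : RR := (a+1)/2 + (d:RR)/2*(2/p-1)

def CM (d : ℕ) (a p : RR) : RR := Cint p * (cS a^2*(Real.Gamma ((a+1)/2)/2*4^((a+1)/2))) * (2 * Chls (lamE d a p))

lemma Uu_measurable {d : ℕ} (H : (Ed d) → RR → CC) (hH : Measurable (uncurry H)) :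
    Measurable fun q : (Ed d) × RR => ∫ y, Sfree d q.1 y q.2 * H y q.2 := by
  have : Measurable (fun q : ((Ed d) × RR) × (Ed d) => Sfree d q.1.1 q.2 q.1.2 * H q.2 q.1.2) :=
    (Sfree_measurable d (measurable_fst.comp measurable_fst) measurable_snd (measurable_snd.comp measurable_fst)).mul 
      (hH.comp (by fun_prop : Measurable fun q : ((Ed d) × RR) × (Ed d) => (q.2, q.1.2)))
  exact (this.stronglyMeasurable.integral_prod_right' (ν := volume)).measurable

lemma rpow_neg_le {δ τ e : RR} (hδ : 0 < δ) (h : δ ≤ |τ|) (he : 0 ≤ e) : |τ| ^ (-e) ≤ δ ^ (-e) :=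
  Real.rpow_le_rpow_of_nonpos hδ h (by linarith)

lemma Sh_cross_enorm {a : RR} (ha : 0 ≤ a) (z : RR) {τ σ ε : RR} (hτ : τ ≠ 0) (hσ : σ ≠ 0) (hne : τ ≠ σ) (hε : 0 < ε) :
    ‖∫ w, Sh a z w τ * (starRingEnd CC) (Sh a z w σ) * cexp (-(ε:CC)*(w:CC)^2) ∂ma a‖ₑ ≤ eo (cS a^2*(Real.Gamma ((a+1)/2)/2*4^((a+1)/2))*|τ-σ|^(-((a+1)/2))) := by
  rw [← ofReal_norm]
  apply ENNReal.ofReal_le_ofReal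
  simp_rw [Sh_symm a z]
  exact Sh_cross_bound ha z z hτ hσ hne hε

def UH (d : ℕ) (H : (Ed d) → RR → CC) (x : Ed d) (τ : RR) : CC := ∫ y, Sfree d x y τ * H y τ

lemma UH_zero {d : ℕ} (H : (Ed d) → RR → CC) (x : Ed d) {τ : RR} (h : ∀ y, H y τ = 0) : UH d H x τ = 0 := by
  simp [UH, h]

lemma UH_measurable {d : ℕ} (H : (Ed d) → RR → CC) (hH : Measurable (uncurry H)) {X : Type*} [MeasurableSpace X]
    {f : X → (Ed d)} {g : X → RR} (hf : Measurable f) (hg : Measurable g) : Measurable fun q => UH d H (f q) (g q) := by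
  have h : Measurable fun q : (Ed d) × RR => UH d H q.1 q.2 := by
    simp only [UH]; exact Uu_measurable H hH
  have h1 : Measurable fun x => (f x, g x) := hf.prodMk hg
  have h2 := Measurable.comp h h1
  simp only [Function.comp_def] at h2
  exact h2

def kM (d : ℕ) (a z : RR) (H : (Ed d) → RR → CC) (X : (Ed d) × RR) (τ : RR) : CC := Sh a z X.2 τ * UH d H X.1 τ

lemma kM_measurable {d : ℕ} {a : RR} (ha : 0 ≤ a) (z : RR) (H : (Ed d) → RR → CC) (hH : Measurable (uncurry H)) :
    Measurable (uncurry (kM d a z H)) := by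
  have h1 : Measurable fun q : ((Ed d) × RR) × RR => Sh a z q.1.2 q.2 :=
    Sh_measurable ha measurable_const (measurable_snd.comp measurable_fst) measurable_snd
  have h2 : Measurable fun q : ((Ed d) × RR) × RR => UH d H q.1.1 q.2 :=
    UH_measurable H hH (measurable_fst.comp measurable_fst) measurable_snd
  exact h1.mul h2

lemma kM_bound {d : ℕ} (hd : 1 ≤ d) {a : RR} (ha : 0 ≤ a) (z : RR) (H : (Ed d) → RR → CC) 
    (hs : ∀ τ, Integrable fun y => H y τ) {δ : RR} (hδ : 0 < δ) (hsup : ∀ y τ, |τ| < δ → H y τ = 0) (X : (Ed d) × RR) (τ : RR) :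
    ‖kM d a z H X τ‖ ≤ cS a * δ ^ (-((a+1)/2)) * δ ^ (-((d:RR)/2)) * ∫ y, ‖H y τ‖ := by
  have hc := cS_pos ha
  unfold kM
  rcases lt_or_ge |τ| δ with h | h
  · rw [UH_zero H X.1 fun y => hsup y τ h]
    simp [hsup _ τ h]
  · have b1 : ‖UH d H X.1 τ‖ ≤ δ ^ (-((d:RR)/2)) * ∫ y, ‖H y τ‖ := by
      refine (norm_integral_le_integral_norm _).trans ?_
      rw [← integral_const_mul]
      refine integral_mono_of_nonneg (ae_of_all _ fun y => norm_nonneg _) ((hs τ).norm.const_mul _) (ae_of_all _ fun y => ?_)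
      simp only [norm_mul]
      refine mul_le_mul_of_nonneg_right ((norm_Sfree_le hd _ _ _).trans ?_) (norm_nonneg _)
      rw [neg_div]; exact rpow_neg_le hδ h (by positivity)
    have b2 : ‖Sh a z X.2 τ‖ ≤ cS a * δ ^ (-((a+1)/2)) :=
      (norm_Sh_le ha _ _ _).trans (mul_le_mul_of_nonneg_left (rpow_neg_le hδ h (by linarith)) hc.le)
    rw [norm_mul, mul_assoc (cS a * _)]
    exact mul_le_mul b2 b1 (norm_nonneg _) (by positivity)

def nrm {d : ℕ} (p : RR) (H : (Ed d) → RR → CC) (τ : RR) : ℝ≥0∞ := (∫⁻ y, ‖H y τ‖ₑ ^ p) ^ (1/p)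

lemma nrm_measurable {d : ℕ} (p : RR) (H : (Ed d) → RR → CC) (hH : Measurable (uncurry H)) : Measurable (nrm p H) := by
  have : Measurable fun q : RR × (Ed d) => ‖H q.2 q.1‖ₑ ^ p := (hH.comp measurable_swap).enorm.pow_const p
  exact (this.lintegral_prod_right' (ν := volume)).pow_const _

lemma mixNorm_eq {d : ℕ} (q p : RR) (H : (Ed d) → RR → CC) : mixNorm d q p H = (∫⁻ t, nrm p H t ^ q) ^ (1/q) := by
  unfold mixNorm nrm
  congr 2; ext t
  rw [← ENNReal.rpow_mul]
  congr 1; ring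

lemma kM_cross {d : ℕ} (hd : 1 ≤ d) {a : RR} (ha : 0 ≤ a) {p : RR} (hp : 1 < p) (hp2 : p ≤ 2) 
    (z : RR) (H : (Ed d) → RR → CC) (hH : Measurable (uncurry H))
    (hs : ∀ τ, Integrable fun y => H y τ) {τ σ ε : RR} (hτ0 : τ ≠ 0) (hσ0 : σ ≠ 0) (hne : τ ≠ σ) (hε : 0 < ε) :
    ‖∫ X, kM d a z H X τ * (starRingEnd CC) (kM d a z H X σ) *
      ((Real.exp (-ε * ∑ i, X.1 i ^ 2) * Real.exp (-ε * X.2^2) : RR):CC) ∂(ωa d a)‖ₑ ≤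
      eo (Cint p * (cS a^2*(Real.Gamma ((a+1)/2)/2*4^((a+1)/2)))) * (eo (|τ - σ| ^ (-lamE d a p)) * (nrm p H τ * nrm p H σ)) := by
  have hslice : ∀ τ, Measurable fun y => H y τ := fun τ => hH.comp (by fun_prop : Measurable fun y : Ed d => (y, τ))
  have e : ∫ X, kM d a z H X τ * (starRingEnd CC) (kM d a z H X σ) *
      ((Real.exp (-ε * ∑ i, X.1 i ^ 2) * Real.exp (-ε * X.2^2) : RR):CC) ∂(ωa d a) = 
      (∫ x : Ed d, UH d H x τ * (starRingEnd CC) (UH d H x σ) * cexp (-(ε:CC) * ((∑ i, x i ^ 2 : RR):CC))) *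
      (∫ w, Sh a z w τ * (starRingEnd CC) (Sh a z w σ) * cexp (-(ε:CC)*(w:CC)^2) ∂ma a) := by
    rw [ωa_eq, ← integral_prod_mul]
    refine integral_congr_ae (ae_of_all _ fun X => ?_)
    simp only [kM]
    rw [Complex.ofReal_mul, gauss_cast, gauss_cast, map_mul]
    push_cast; ring
  rw [e, enorm_mul]
  refine (mul_le_mul' (free_cross_bil hd hτ0 hσ0 hne hε hp hp2 _ _ (hslice τ) (hslice σ) (hs τ) (hs σ)) (Sh_cross_enorm ha z hτ0 hσ0 hne hε)).trans (le_of_eq ?_)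
  have hpos : 0 < |τ - σ| := abs_pos.2 (sub_ne_zero.2 hne)
  have := Cint_pos hp2
  have := Real.Gamma_pos_of_pos (show 0 < (a+1)/2 by linarith)
  rw [mul_right_comm, ← ENNReal.ofReal_mul (by positivity)]
  conv_rhs => rw [← mul_assoc, ← ENNReal.ofReal_mul (by positivity)]
  unfold nrm
  congr 2
  rw [lamE, neg_add, Real.rpow_add hpos]; ring

lemma lemM {d : ℕ} (hd : 1 ≤ d) {a : RR} (ha : 0 ≤ a) {p pt : RR} (hp : 1 < p) (hp2 : p ≤ 2) (h0 : 0 < lamE d a p) (h1 : lamE d a p < 1)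
    (hpt : pt = 2/(2-lamE d a p)) (z : RR) (H : (Ed d) → RR → CC) (hH : Measurable (uncurry H))
    (hs : ∀ τ, Integrable fun y => H y τ) (hi : Integrable fun τ => ∫ y, ‖H y τ‖) {δ : RR} (hδ : 0 < δ) (hsup : ∀ y τ, |τ| < δ → H y τ = 0) :
    ∫⁻ X, ‖∫ τ, kM d a z H X τ‖ₑ ^ 2 ∂(ωa d a) ≤ eo (CM d a p) * mixNorm d pt p H ^ 2 := by
  have hkm := kM_measurable ha z H hH
  refine fatou_w (ωa d a) (fun X => ∫ τ, kM d a z H X τ) (hkm.stronglyMeasurable.integral_prod_right).measurable (fun j X => Real.exp (-ep j * ∑ i, X.1 i ^ 2) * Real.exp (-ep j * X.2^2))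
    (fun j => by fun_prop) (fun X => by simpa using (ep_tendsto (∑ i, X.1 i ^ 2)).mul (ep_tendsto (X.2^2))) _ fun j => ?_
  have hwi : Integrable (fun X : (Ed d) × RR => Real.exp (-ep j * ∑ i, X.1 i ^ 2) * Real.exp (-ep j * X.2^2)) (ωa d a) := by
    rw [ωa_eq]
    exact (integrable_gauss_E d (ep_pos j)).mul_prod (integrable_gauss_ma (by linarith) (ep_pos j))
  refine (core (ωa d a) volume (kM d a z H) hkm (fun τ => cS a * δ ^ (-((a+1)/2)) * δ ^ (-((d:RR)/2)) * ∫ y, ‖H y τ‖) (hi.const_mul _) 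
    (kM_bound hd ha z H hs hδ hsup) _ hwi (by fun_prop) (fun X => by positivity)).trans ?_
  have key : ∀ τ, ∀ᵐ σ : RR, ‖∫ X, kM d a z H X τ * (starRingEnd CC) (kM d a z H X σ) *
      ((Real.exp (-ep j * ∑ i, X.1 i ^ 2) * Real.exp (-ep j * X.2^2) : RR):CC) ∂(ωa d a)‖ₑ ≤
      eo (Cint p * (cS a^2*(Real.Gamma ((a+1)/2)/2*4^((a+1)/2)))) * (eo (|τ - σ| ^ (-lamE d a p)) * (nrm p H τ * nrm p H σ)) := by
    intro τ
    filter_upwards [compl_mem_ae_iff.2 (measure_singleton τ)] with σ hσ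
    have hne : τ ≠ σ := fun h => hσ (by simp [h])
    have hz : ∀ X, kM d a z H X 0 = 0 := fun X => by rw [kM, UH_zero H X.1 (fun y => hsup y 0 (by simpa using hδ)), mul_zero]
    rcases eq_or_ne τ 0 with rfl | hτ0
    · simp [hz]
    rcases eq_or_ne σ 0 with rfl | hσ0
    · simp [hz]
    exact kM_cross hd ha hp hp2 z H hH hs hτ0 hσ0 hne (ep_pos j)
  calc _ ≤ ∫⁻ τ, ∫⁻ σ, eo (Cint p * (cS a^2*(Real.Gamma ((a+1)/2)/2*4^((a+1)/2)))) * (eo (|τ - σ| ^ (-lamE d a p)) * (nrm p H τ * nrm p H σ)) :=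
        lintegral_mono fun τ => lintegral_mono_ae (key τ)
    _ = eo (Cint p * (cS a^2*(Real.Gamma ((a+1)/2)/2*4^((a+1)/2)))) * ∫⁻ τ, ∫⁻ σ, (eo (|τ - σ| ^ (-lamE d a p)) * (nrm p H τ * nrm p H σ)) := by
        rw [← lintegral_const_mul' _ _ (by simp)]
        refine lintegral_congr fun τ => ?_
        rw [← lintegral_const_mul' _ _ (by simp)]
    _ ≤ _ := by
        refine (mul_le_mul_right (hls h0 h1 hpt (nrm p H) (nrm p H) (nrm_measurable p H hH) (nrm_measurable p H hH)) _).trans (le_of_eq ?_)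
        rw [← mul_assoc, ← ENNReal.ofReal_mul (by
          have := Cint_pos hp2
          have := Real.Gamma_pos_of_pos (show 0 < (a+1)/2 by linarith)
          positivity), ← CM, ← sq, mixNorm_eq]

section gen
variable {X Y : Type*} [MeasurableSpace X] [MeasurableSpace Y]

lemma eL2 (m : Measure X) (f : X → CC) : eLpNorm f 2 m = (∫⁻ x, ‖f x‖ₑ ^ 2 ∂m) ^ (1/2:RR) := by
  rw [eLpNorm_eq_lintegral_rpow_enorm_toReal (by simp) (by simp)]
  simp

lemma mink2 (m : Measure X) (n : Measure Y) [SFinite m] [SFinite n] (g : X → Y → ℝ≥0∞) (hg : Measurable (uncurry g)) :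
    ∫⁻ x, (∫⁻ y, g x y ∂n) ^ 2 ∂m ≤ (∫⁻ y, (∫⁻ x, g x y ^ 2 ∂m) ^ (1/2:RR) ∂n) ^ 2 := by
  have h1 : Measurable (fun q : X × (Y × Y) => g q.1 q.2.1) := hg.comp (by fun_prop : Measurable fun q : X × (Y × Y) => (q.1, q.2.1))
  have h2 : Measurable (fun q : X × (Y × Y) => g q.1 q.2.2) := hg.comp (by fun_prop : Measurable fun q : X × (Y × Y) => (q.1, q.2.2))
  have hgx : ∀ x, Measurable (g x) := fun x => hg.of_uncurry_left
  have hgy : ∀ y, Measurable (fun x => g x y) := fun y => hg.comp (by fun_prop : Measurable fun x : X => (x, y))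
  have hN : Measurable fun y => (∫⁻ x, g x y ^ 2 ∂m) ^ (1/2:RR) := by
    have : Measurable fun q : Y × X => g q.2 q.1 ^ 2 := (hg.comp measurable_swap).pow_const 2
    exact (this.lintegral_prod_right' (ν := m)).pow_const _
  calc ∫⁻ x, (∫⁻ y, g x y ∂n) ^ 2 ∂m = ∫⁻ x, ∫⁻ s : Y × Y, g x s.1 * g x s.2 ∂(n.prod n) ∂m := by
        refine lintegral_congr fun x => ?_
        rw [lintegral_prod_mul (hgx x).aemeasurable (hgx x).aemeasurable, sq]
    _ = ∫⁻ s : Y × Y, ∫⁻ x, g x s.1 * g x s.2 ∂m ∂(n.prod n) := lintegral_lintegral_swap (h1.mul h2).aemeasurable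
    _ ≤ ∫⁻ s : Y × Y, (∫⁻ x, g x s.1 ^ 2 ∂m) ^ (1/2:RR) * (∫⁻ x, g x s.2 ^ 2 ∂m) ^ (1/2:RR) ∂(n.prod n) := by
        refine lintegral_mono fun s => ?_
        have := ENNReal.lintegral_mul_le_Lp_mul_Lq m (Real.HolderConjugate.two_two) (hgy s.1).aemeasurable (hgy s.2).aemeasurable
        simpa using this
    _ = _ := by
        rw [lintegral_prod_mul hN.aemeasurable hN.aemeasurable, sq]

lemma cut_liminf (m : Measure X) (f : X → CC) (c : ℕ → X → CC) (hcm : ∀ n, Measurable (c n)) (hc1 : ∀ n x, ‖c n x‖ ≤ 1)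
    (hc : ∀ᵐ x ∂m, Tendsto (fun n => c n x) atTop (𝓝 1)) :
    ‖∫ x, f x ∂m‖ₑ ≤ liminf (fun n => ‖∫ x, c n x * f x ∂m‖ₑ) atTop := by
  by_cases hf : Integrable f m
  · have : Tendsto (fun n => ∫ x, c n x * f x ∂m) atTop (𝓝 (∫ x, f x ∂m)) := by
      refine tendsto_integral_of_dominated_convergence (fun x => ‖f x‖) (fun n => (hcm n).aestronglyMeasurable.mul hf.1) hf.norm
        (fun n => ae_of_all _ fun x => ?_) ?_
      · rw [norm_mul]; exact mul_le_of_le_one_left (norm_nonneg _) (hc1 n x)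
      · filter_upwards [hc] with x hx
        simpa using hx.mul_const (f x)
    exact this.enorm.liminf_eq.ge
  · rw [integral_undef hf]; simp
end gen

def chi (t τ : RR) : CC := (Set.Ioc 0 t).indicator (fun _ => (1:CC)) τ - (Set.Ioc t 0).indicator (fun _ => (1:CC)) τ

lemma norm_chi_le (t τ : RR) : ‖chi t τ‖ ≤ 1 := by
  unfold chi
  by_cases h1 : τ ∈ Set.Ioc 0 t
  · have h2 : τ ∉ Set.Ioc t 0 := fun h => by have := h1.1; have := h.2; linarith
    simp [h1, h2, Set.indicator]
  · by_cases h2 : τ ∈ Set.Ioc t 0 <;> simp [h1, h2, Set.indicator]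

lemma chi_measurable : Measurable fun q : RR × RR => chi q.1 q.2 := by
  have e : (fun q : RR × RR => chi q.1 q.2) = fun q => (if 0 < q.2 ∧ q.2 ≤ q.1 then (1:CC) else 0) - (if q.1 < q.2 ∧ q.2 ≤ 0 then (1:CC) else 0) := by
    ext q; simp [chi, Set.indicator, Set.mem_Ioc]
  rw [e]
  refine Measurable.sub (Measurable.ite ?_ measurable_const measurable_const) (Measurable.ite ?_ measurable_const measurable_const)
  · exact (measurableSet_lt measurable_const measurable_snd).inter (measurableSet_le measurable_snd measurable_fst)
  · exact (measurableSet_lt measurable_fst measurable_snd).inter (measurableSet_le measurable_snd measurable_const)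

lemma ii_eq (t : RR) (f : RR → CC) : ∫ τ in (0:RR)..t, f τ = ∫ τ, chi t τ * f τ := by
  rcases le_total 0 t with h | h
  · rw [intervalIntegral.integral_of_le h, ← integral_indicator measurableSet_Ioc]
    congr 1; ext τ
    simp [chi, Set.Ioc_eq_empty (not_lt.2 h), Set.indicator]
  · rw [intervalIntegral.integral_of_ge h, ← integral_indicator measurableSet_Ioc, ← integral_neg]
    congr 1; ext τ
    simp [chi, Set.Ioc_eq_empty (not_lt.2 h), Set.indicator]

def wd (k : ℕ) {V : Type*} [NormedAddCommGroup V] (x : V) : RR := (1 + ‖x‖) ^ (-(k:RR))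

lemma wd_pos (k : ℕ) {V : Type*} [NormedAddCommGroup V] (x : V) : 0 < wd k x := by unfold wd; positivity
lemma wd_measurable (k : ℕ) {V : Type*} [NormedAddCommGroup V] [MeasurableSpace V] [OpensMeasurableSpace V] : Measurable (wd k : V → RR) := by
  unfold wd; exact (measurable_const.add measurable_norm).pow_const _

lemma wd_add (k l : ℕ) {V : Type*} [NormedAddCommGroup V] (x : V) : wd (k + l) x = wd k x * wd l x := by
  unfold wd
  rw [← Real.rpow_add (by positivity)]; push_cast; congr 1; ring

lemma wd_prod (k l : ℕ) {V W : Type*} [NormedAddCommGroup V] [NormedAddCommGroup W] (x : V × W) : wd (k + l) x ≤ wd k x.1 * wd l x.2 := by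
  rw [wd_add]
  refine mul_le_mul ?_ ?_ (wd_pos _ _).le (wd_pos _ _).le
  · exact Real.rpow_le_rpow_of_nonpos (by positivity) (by linarith [norm_fst_le x]) (by simp)
  · exact Real.rpow_le_rpow_of_nonpos (by positivity) (by linarith [norm_snd_le x]) (by simp)

lemma schwartz_wd (k : ℕ) {V : Type*} [NormedAddCommGroup V] [NormedSpace RR V] (f : SchwartzMap V CC) : ∃ C, 0 < C ∧ ∀ x, ‖f x‖ ≤ C * wd k x := by
  refine ⟨2 ^ k * ((Finset.Iic (k, 0)).sup fun m => SchwartzMap.seminorm RR m.1 m.2) f + 1, by positivity, fun x => ?_⟩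
  have := SchwartzMap.one_add_le_sup_seminorm_apply (𝕜 := RR) (m := (k, 0)) (le_refl _) (le_refl _) f x
  rw [norm_iteratedFDeriv_zero] at this
  have h0 : 0 < (1 + ‖x‖) ^ k := by positivity
  unfold wd
  rw [Real.rpow_neg (by positivity), Real.rpow_natCast, ← div_eq_mul_inv, le_div_iff₀ h0]
  linarith

lemma wd_int_E (d : ℕ) : Integrable (wd (d+1) : (Ed d) → RR) := by
  unfold wd
  exact integrable_one_add_norm (by simp)

lemma wd_int_R : Integrable (wd 2 : RR → RR) := by
  unfold wd
  exact integrable_one_add_norm (by simp)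

lemma wd_int_ma {a : RR} (ha : 0 ≤ a) (ha1 : a < 1) : Integrable (wd 3 : RR → RR) (ma a) := by
  rw [integrable_ma]
  refine (wd_int_R.integrableOn (s := Set.Ioi 0)).mono' ?_ ?_
  · have := wd_measurable 3 (V := RR)
    exact ((measurable_id.pow_const a).mul this).aestronglyMeasurable
  · refine (ae_restrict_mem measurableSet_Ioi).mono fun z hz => ?_
    have hz : 0 < z := hz
    have hw := wd_pos 3 z
    rw [smul_eq_mul, Real.norm_of_nonneg (by positivity)]
    rw [show (3:ℕ) = 1 + 2 from rfl, wd_add, ← mul_assoc]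
    refine mul_le_of_le_one_left (wd_pos _ _).le ?_
    unfold wd
    rw [Real.norm_of_nonneg hz.le, Real.rpow_neg (by positivity), ← div_eq_mul_inv, div_le_one (by positivity)]
    calc z ^ a ≤ (1+z)^a := Real.rpow_le_rpow hz.le (by linarith) ha
      _ ≤ _ := Real.rpow_le_rpow_of_exponent_le (by linarith) (by simpa using ha1.le)

lemma schw_u {d : ℕ} (f : SchwartzMap ((Ed d) × RR) CC) (k : ℕ) : ∃ C, 0 < C ∧ ∀ x z, ‖f (x, z)‖ ≤ C * (wd (d+1) x * wd k z) := by
  obtain ⟨C, hC, h⟩ := schwartz_wd (d+1+k) f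
  exact ⟨C, hC, fun x z => (h _).trans (mul_le_mul_of_nonneg_left (wd_prod _ _ _) hC.le)⟩

lemma schw_F {d : ℕ} (f : SchwartzMap (((Ed d) × RR) × RR) CC) : ∃ C, 0 < C ∧ ∀ x z t, ‖f ((x, z), t)‖ ≤ C * (wd (d+1) x * wd 3 z * wd 2 t) := by
  obtain ⟨C, hC, h⟩ := schwartz_wd (d+1+3+2) f
  exact ⟨C, hC, fun x z t => (h _).trans (mul_le_mul_of_nonneg_left ((wd_prod _ _ _).trans (mul_le_mul_of_nonneg_right (wd_prod _ _ _) (wd_pos _ _).le)) hC.le)⟩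

lemma wd_int_ωa (d : ℕ) {a : RR} (ha : 0 ≤ a) (ha1 : a < 1) : Integrable (fun X : (Ed d) × RR => wd (d+1) X.1 * wd 3 X.2) (ωa d a) := by
  rw [ωa_eq]; exact (wd_int_E d).mul_prod (wd_int_ma ha ha1)

lemma int_ωa_of_bd {d : ℕ} {a : RR} (ha : 0 ≤ a) (ha1 : a < 1) (f : (Ed d) × RR → CC) (hf : Measurable f) {C : RR}
    (h : ∀ x z, ‖f (x, z)‖ ≤ C * (wd (d+1) x * wd 3 z)) : Integrable f (ωa d a) :=
  ((wd_int_ωa d ha ha1).const_mul C).mono' hf.aestronglyMeasurable (ae_of_all _ fun X => h X.1 X.2)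

def SKh (d : ℕ) (a : RR) (X Y : (Ed d) × RR) (t : RR) : CC := Sh a X.2 Y.2 t * Sfree d X.1 Y.1 t

lemma SKh_measurable {d : ℕ} {a : RR} (ha : 0 ≤ a) {S : Type*} [MeasurableSpace S] {f g : S → (Ed d) × RR} {h : S → RR}
    (hf : Measurable f) (hg : Measurable g) (hh : Measurable h) : Measurable fun s => SKh d a (f s) (g s) (h s) := by
  have h1 : Measurable fun s => Sh a (f s).2 (g s).2 (h s) :=
    Sh_measurable ha (measurable_snd.comp hf) (measurable_snd.comp hg) hh
  have h2 : Measurable fun s => Sfree d (f s).1 (g s).1 (h s) :=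
    Sfree_measurable d (measurable_fst.comp hf) (measurable_fst.comp hg) hh
  exact h1.mul h2

lemma ae_ωa_pos (d : ℕ) (a : RR) : ∀ᵐ X ∂(ωa d a), 0 < X.2 := by
  rw [ωa_eq]
  exact Measure.quasiMeasurePreserving_snd.ae (ae_ma_pos a)

lemma SK_int_eq {d : ℕ} {a : RR} (ha : 0 ≤ a) {X : (Ed d) × RR} (hX : 0 < X.2) (t : RR) (f : (Ed d) × RR → CC) :
    ∫ Y, SK d a X Y t * f Y ∂(ωa d a) = ∫ Y, SKh d a X Y t * f Y ∂(ωa d a) := by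
  refine integral_congr_ae ((ae_ωa_pos d a).mono fun Y hY => ?_)
  simp only [SK, SKh, SaK_eq ha hX hY]

/-- time-dependent Schrodinger evolution applied to time dependent data -/
def AD (d : ℕ) (a : RR) (F : (Ed d) × RR → RR → CC) (X : (Ed d) × RR) (s τ : RR) : CC := ∫ Y, SKh d a X Y s * F Y τ ∂(ωa d a)

lemma AD_measurable {d : ℕ} {a : RR} (ha : 0 ≤ a) (F : (Ed d) × RR → RR → CC) (hF : Measurable (uncurry F)) {S : Type*} [MeasurableSpace S]
    {f : S → (Ed d) × RR} {g h : S → RR} (hf : Measurable f) (hg : Measurable g) (hh : Measurable h) : Measurable fun s => AD d a F (f s) (g s) (h s) := by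
  have h1 : Measurable fun q : S × ((Ed d) × RR) => SKh d a (f q.1) q.2 (g q.1) :=
    SKh_measurable ha (hf.comp measurable_fst) measurable_snd (hg.comp measurable_fst)
  have h0 : Measurable fun q : S × ((Ed d) × RR) => (q.2, h q.1) := measurable_snd.prodMk (hh.comp measurable_fst)
  have h2 : Measurable fun q : S × ((Ed d) × RR) => F q.2 (h q.1) := by
    have := Measurable.comp hF h0
    simpa only [Function.comp_def, uncurry] using this
  have h3 : Measurable fun q : S × ((Ed d) × RR) => SKh d a (f q.1) q.2 (g q.1) * F q.2 (h q.1) := h1.mul h2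
  exact (h3.stronglyMeasurable.integral_prod_right' (ν := ωa d a)).measurable

lemma AD_L2 {d : ℕ} (hd : 1 ≤ d) {a : RR} (ha : 0 ≤ a) (F : (Ed d) × RR → RR → CC) (τ : RR) (hF : Measurable fun Y => F Y τ)
    (hi : Integrable (fun Y => F Y τ) (ωa d a)) {s : RR} (hs : s ≠ 0) :
    (∫⁻ X, ‖AD d a F X s τ‖ₑ ^ 2 ∂(ωa d a)) ^ (1/2:RR) ≤ eo (CT a) ^ (1/2:RR) * eLpNorm (fun Y => F Y τ) 2 (ωa d a) := by
  rw [eL2, ← ENNReal.mul_rpow_of_nonneg _ _ (by norm_num)]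
  exact ENNReal.rpow_le_rpow (T_L2 hd ha hs _ hF hi) (by norm_num)

lemma Tstar_eq {d : ℕ} {a : RR} (ha : 0 ≤ a) (u : (Ed d) × RR → CC) {X : (Ed d) × RR} (hX : 0 < X.2) {t : RR} (ht : t ≠ 0) :
    Tstar d a u X t = AD d a (fun Y _ => u Y) X t 0 := by
  rw [Tstar, if_neg ht, SK_int_eq ha hX]; rfl

lemma Dop_eq {d : ℕ} {a : RR} (ha : 0 ≤ a) (F : (Ed d) × RR → RR → CC) {X : (Ed d) × RR} (hX : 0 < X.2) (t : RR) :
    Dop d a F X t = ∫ τ, chi t τ * AD d a F X (t-τ) τ := by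
  rw [Dop, ii_eq]
  simp_rw [SK_int_eq ha hX]; rfl

lemma est1_T {d : ℕ} (hd : 1 ≤ d) {a : RR} (ha : 0 ≤ a) (u : (Ed d) × RR → CC) (hu : Measurable u) (hi : Integrable u (ωa d a)) (t : RR) :
    AEStronglyMeasurable (fun X => Tstar d a u X t) (ωa d a) ∧
    eLpNorm (fun X => Tstar d a u X t) 2 (ωa d a) ≤ (1 + eo (CT a) ^ (1/2:RR)) * eLpNorm u 2 (ωa d a) := by
  rcases eq_or_ne t 0 with rfl | ht
  · have e : (fun X => Tstar d a u X 0) = u := by ext X; simp [Tstar]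
    rw [e]
    refine ⟨hu.aestronglyMeasurable, ?_⟩
    rw [add_mul, one_mul]; exact le_self_add
  · have e : (fun X => Tstar d a u X t) =ᵐ[ωa d a] fun X => AD d a (fun Y _ => u Y) X t 0 :=
      (ae_ωa_pos d a).mono fun X hX => Tstar_eq ha u hX ht
    have hm : Measurable fun X => AD d a (fun Y _ => u Y) X t 0 :=
      AD_measurable ha (fun Y _ => u Y) (hu.comp measurable_fst) measurable_id measurable_const measurable_const
    refine ⟨hm.aestronglyMeasurable.congr e.symm, ?_⟩
    rw [eLpNorm_congr_ae e, eL2]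
    refine (AD_L2 hd ha (fun Y _ => u Y) 0 hu hi ht).trans ?_
    rw [add_mul]; exact le_add_self

lemma est1_D {d : ℕ} (hd : 1 ≤ d) {a : RR} (ha : 0 ≤ a) (F : (Ed d) × RR → RR → CC) (hF : Measurable (uncurry F))
    (hi : ∀ τ, Integrable (fun Y => F Y τ) (ωa d a)) (t : RR) :
    AEStronglyMeasurable (fun X => Dop d a F X t) (ωa d a) ∧
    eLpNorm (fun X => Dop d a F X t) 2 (ωa d a) ≤ eo (CT a) ^ (1/2:RR) * ∫⁻ τ, eLpNorm (fun Y => F Y τ) 2 (ωa d a) := by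
  have e : (fun X => Dop d a F X t) =ᵐ[ωa d a] fun X => ∫ τ, chi t τ * AD d a F X (t-τ) τ :=
    (ae_ωa_pos d a).mono fun X hX => Dop_eq ha F hX t
  have hAm : Measurable fun q : ((Ed d) × RR) × RR => AD d a F q.1 (t - q.2) q.2 :=
    AD_measurable ha F hF measurable_fst (measurable_const.sub measurable_snd) measurable_snd
  have hcm : Measurable fun q : ((Ed d) × RR) × RR => chi t q.2 :=
    chi_measurable.comp (measurable_const.prodMk measurable_snd)
  have hpm : Measurable fun q : ((Ed d) × RR) × RR => chi t q.2 * AD d a F q.1 (t - q.2) q.2 := hcm.mul hAm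
  have hm : Measurable fun X => ∫ τ, chi t τ * AD d a F X (t-τ) τ :=
    (hpm.stronglyMeasurable.integral_prod_right' (ν := volume)).measurable
  refine ⟨hm.aestronglyMeasurable.congr e.symm, ?_⟩
  rw [eLpNorm_congr_ae e, eL2]
  have s1 : ∫⁻ X, ‖∫ τ, chi t τ * AD d a F X (t-τ) τ‖ₑ ^ 2 ∂(ωa d a) ≤ ∫⁻ X, (∫⁻ τ, ‖AD d a F X (t-τ) τ‖ₑ) ^ 2 ∂(ωa d a) := by
    refine lintegral_mono fun X => ?_
    refine pow_le_pow_left' ((enorm_integral_le_lintegral_enorm _).trans (lintegral_mono fun τ => ?_)) 2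
    rw [enorm_mul]
    refine mul_le_of_le_one_left' ?_
    rw [← ofReal_norm]; exact ENNReal.ofReal_le_one.2 (norm_chi_le t τ)
  have s2 := s1.trans (mink2 (ωa d a) volume (fun X τ => ‖AD d a F X (t-τ) τ‖ₑ) hAm.enorm)
  have s3 := ENNReal.rpow_le_rpow s2 (show (0:RR) ≤ 1/2 by norm_num)
  refine s3.trans ?_
  rw [← ENNReal.rpow_natCast, ← ENNReal.rpow_mul]
  norm_num
  rw [← lintegral_const_mul' _ _ (by simp)]
  refine lintegral_mono_ae ?_
  filter_upwards [compl_mem_ae_iff.2 (measure_singleton t)] with τ hτ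
  have hne : t - τ ≠ 0 := sub_ne_zero.2 fun h => hτ (by simp [h])
  have := AD_L2 hd ha F τ (hF.comp (measurable_id.prodMk measurable_const)) (hi τ) hne
  norm_num at this
  exact this

def cutn (n : ℕ) (s : RR) : CC := if 1/((n:RR)+1) ≤ |s| then 1 else 0

lemma cutn_measurable (n : ℕ) : Measurable (cutn n) := by
  unfold cutn
  exact Measurable.ite (measurableSet_le measurable_const measurable_norm) measurable_const measurable_const

lemma norm_cutn_le (n : ℕ) (s : RR) : ‖cutn n s‖ ≤ 1 := by
  unfold cutn; split_ifs <;> simp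

lemma cutn_zero {n : ℕ} {s : RR} (h : |s| < 1/((n:RR)+1)) : cutn n s = 0 := by
  unfold cutn; rw [if_neg (not_le.2 h)]

lemma cutn_tendsto {s : RR} (hs : s ≠ 0) : Tendsto (fun n => cutn n s) atTop (𝓝 1) := by
  refine tendsto_const_nhds.congr' ?_
  have h := tendsto_one_div_add_atTop_nhds_zero_nat (𝕜 := RR)
  filter_upwards [h.eventually_lt_const (abs_pos.2 hs)] with n hn
  unfold cutn; rw [if_pos hn.le]

lemma nrm_le_of {d : ℕ} {p : RR} (hp : 0 < p) (H K : (Ed d) → RR → CC) (s t : RR) (h : ∀ y, ‖H y s‖ₑ ≤ ‖K y t‖ₑ) : nrm p H s ≤ nrm p K t := by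
  unfold nrm
  exact ENNReal.rpow_le_rpow (lintegral_mono fun y => ENNReal.rpow_le_rpow (h y) hp.le) (by positivity)

def HT (d : ℕ) (Φ : (Ed d) → RR → CC) (t : RR) (y : Ed d) (s : RR) : CC := chi t (t-s) * Φ y (t-s)
def HTn (d : ℕ) (Φ : (Ed d) → RR → CC) (t : RR) (n : ℕ) (y : Ed d) (s : RR) : CC := cutn n s * HT d Φ t y s

lemma kM_cut {d : ℕ} {a z : RR} (c : RR → CC) (H : (Ed d) → RR → CC) (X : (Ed d) × RR) (s : RR) :
    kM d a z (fun y s => c s * H y s) X s = c s * kM d a z H X s := by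
  simp only [kM, UH]
  have : ∫ y, Sfree d X.1 y s * (c s * H y s) = c s * ∫ y, Sfree d X.1 y s * H y s := by
    rw [← integral_const_mul]; congr 1; ext y; ring
  rw [this]; ring

lemma Theta_eq {d : ℕ} {a : RR} (ha : 0 ≤ a) (Φ : (Ed d) → RR → CC) (X : (Ed d) × RR) (t : RR) :
    ThetaStar d a Φ X t = I * ∫ s, kM d a 0 (HT d Φ t) X s := by
  rw [ThetaStar, ii_eq, ← integral_sub_left_eq_self _ volume t]
  congr 2; ext s
  unfold HT
  rw [kM_cut (fun s => chi t (t-s)) (fun y s => Φ y (t-s))]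
  simp only [sub_sub_cancel, kM, UH, Sa0_eq ha]
  rw [Sh_symm a 0, ← integral_const_mul]
  rw [← mul_assoc, ← integral_const_mul]
  refine integral_congr_ae (ae_of_all _ fun y => ?_)
  simp only []; ring

lemma HT_measurable {d : ℕ} (Φ : (Ed d) → RR → CC) (hΦ : Measurable (uncurry Φ)) (t : RR) : Measurable (uncurry (HT d Φ t)) := by
  have h1 : Measurable fun q : (Ed d) × RR => chi t (t - q.2) :=
    chi_measurable.comp (measurable_const.prodMk (measurable_const.sub measurable_snd))
  have h2 : Measurable fun q : (Ed d) × RR => Φ q.1 (t - q.2) :=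
    hΦ.comp (measurable_fst.prodMk (measurable_const.sub measurable_snd))
  exact h1.mul h2

lemma HTn_measurable {d : ℕ} (Φ : (Ed d) → RR → CC) (hΦ : Measurable (uncurry Φ)) (t : RR) (n : ℕ) : Measurable (uncurry (HTn d Φ t n)) :=
  ((cutn_measurable n).comp measurable_snd).mul (HT_measurable Φ hΦ t)

lemma norm_HTn_le {d : ℕ} (Φ : (Ed d) → RR → CC) (t : RR) (n : ℕ) (y : Ed d) (s : RR) : ‖HTn d Φ t n y s‖ ≤ ‖Φ y (t-s)‖ := by
  unfold HTn HT
  rw [norm_mul, norm_mul]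
  calc _ ≤ 1 * (1 * ‖Φ y (t-s)‖) := mul_le_mul (norm_cutn_le _ _) (mul_le_mul_of_nonneg_right (norm_chi_le _ _) (norm_nonneg _)) (by positivity) (by norm_num)
    _ = _ := by ring

lemma mixNorm_HTn_le {d : ℕ} (Φ : (Ed d) → RR → CC) (t : RR) (n : ℕ) {p q : RR} (hp : 0 < p) (hq : 0 < q) :
    mixNorm d q p (HTn d Φ t n) ≤ mixNorm d q p Φ := by
  rw [mixNorm_eq, mixNorm_eq]
  refine ENNReal.rpow_le_rpow ?_ (by positivity)
  calc ∫⁻ s, nrm p (HTn d Φ t n) s ^ q ≤ ∫⁻ s, nrm p Φ (t - s) ^ q := by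
        refine lintegral_mono fun s => ENNReal.rpow_le_rpow (nrm_le_of hp _ _ _ _ fun y => ?_) hq.le
        rw [← ofReal_norm, ← ofReal_norm]; exact ENNReal.ofReal_le_ofReal (norm_HTn_le _ _ _ _ _)
    _ = _ := lintegral_sub_left_eq_self (μ := volume) (fun s => nrm p Φ s ^ q) t

lemma est1_Θ {d : ℕ} (hd : 1 ≤ d) {a : RR} (ha : 0 ≤ a) {p pt : RR} (hp : 1 < p) (hp2 : p ≤ 2) (h0 : 0 < lamE d a p) (h1 : lamE d a p < 1)
    (hpt : pt = 2/(2-lamE d a p)) (Φ : (Ed d) → RR → CC) (hΦ : Measurable (uncurry Φ)) {C : RR} (hb : ∀ y s, ‖Φ y s‖ ≤ C * (wd (d+1) y * wd 2 s)) (t : RR) :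
    AEStronglyMeasurable (fun X => ThetaStar d a Φ X t) (ωa d a) ∧
    eLpNorm (fun X => ThetaStar d a Φ X t) 2 (ωa d a) ≤ eo (CM d a p) ^ (1/2:RR) * mixNorm d pt p Φ := by
  have e : (fun X => ThetaStar d a Φ X t) = fun X => I * ∫ s, kM d a 0 (HT d Φ t) X s := funext fun X => Theta_eq ha Φ X t
  have hkm : Measurable fun X => ∫ s, kM d a 0 (HT d Φ t) X s :=
    ((kM_measurable ha 0 _ (HT_measurable Φ hΦ t)).stronglyMeasurable.integral_prod_right).measurable
  have hknm : ∀ n, Measurable fun X => ∫ s, kM d a 0 (HTn d Φ t n) X s := fun n =>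
    ((kM_measurable ha 0 _ (HTn_measurable Φ hΦ t n)).stronglyMeasurable.integral_prod_right).measurable
  rw [e]
  refine ⟨(hkm.const_mul I).aestronglyMeasurable, ?_⟩
  have hpt0 : 0 < pt := by rw [hpt]; exact div_pos two_pos (by linarith)
  have step : ∀ n, ∫⁻ X, ‖∫ s, kM d a 0 (HTn d Φ t n) X s‖ₑ ^ 2 ∂(ωa d a) ≤ eo (CM d a p) * mixNorm d pt p Φ ^ 2 := by
    intro n
    have hsl : ∀ s, Integrable fun y => HTn d Φ t n y s := fun s => by
      refine ((wd_int_E d).const_mul (C * wd 2 (t-s))).mono' ((HTn_measurable Φ hΦ t n).comp (measurable_id.prodMk measurable_const : Measurable fun y : Ed d => (y, s))).aestronglyMeasurable (ae_of_all _ fun y => ?_)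
      refine ((norm_HTn_le Φ t n y s).trans (hb _ _)).trans (le_of_eq (by ring))
    refine (lemM hd ha hp hp2 h0 h1 hpt 0 (HTn d Φ t n) (HTn_measurable Φ hΦ t n) hsl ?_ (δ := 1/((n:RR)+1)) (by positivity) ?_).trans
      (mul_le_mul_right (pow_le_pow_left' (mixNorm_HTn_le Φ t n (by linarith) hpt0) 2) _)
    · have hw : Integrable fun s : RR => C * (∫ y : Ed d, wd (d+1) y) * wd 2 (t-s) := (wd_int_R.comp_sub_left t).const_mul _
      have hm : Measurable fun q : RR × (Ed d) => ‖HTn d Φ t n q.2 q.1‖ := ((HTn_measurable Φ hΦ t n).comp measurable_swap).norm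
      refine hw.mono' (hm.stronglyMeasurable.integral_prod_right' (ν := volume)).aestronglyMeasurable (ae_of_all _ fun s => ?_)
      rw [Real.norm_of_nonneg (integral_nonneg fun y => norm_nonneg _), mul_right_comm, ← integral_const_mul]
      refine integral_mono (hsl s).norm ((wd_int_E d).const_mul _) fun y => ?_
      refine ((norm_HTn_le Φ t n y s).trans (hb _ _)).trans (le_of_eq (by ring))
    · intro y s hs
      rw [HTn, cutn_zero hs, zero_mul]
  have lim : ∫⁻ X, ‖∫ s, kM d a 0 (HT d Φ t) X s‖ₑ ^ 2 ∂(ωa d a) ≤ eo (CM d a p) * mixNorm d pt p Φ ^ 2 := by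
    calc _ ≤ ∫⁻ X, liminf (fun n => ‖∫ s, kM d a 0 (HTn d Φ t n) X s‖ₑ ^ 2) atTop ∂(ωa d a) := by
          refine lintegral_mono fun X => ?_
          have hl := cut_liminf volume (fun s => kM d a 0 (HT d Φ t) X s) cutn cutn_measurable norm_cutn_le
            (by filter_upwards [compl_mem_ae_iff.2 (measure_singleton (0:RR))] with s hs using cutn_tendsto (by simpa using hs))
          have e2 : ∀ n, ∫ s, cutn n s * kM d a 0 (HT d Φ t) X s = ∫ s, kM d a 0 (HTn d Φ t n) X s := fun n => by
            congr 1; ext s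
            exact (kM_cut (cutn n) (HT d Φ t) X s).symm
          simp only [e2] at hl
          have := (ENNReal.orderIsoRpow 2 two_pos).liminf_apply (f := atTop) (u := fun n => ‖∫ s, kM d a 0 (HTn d Φ t n) X s‖ₑ)
          simp only [ENNReal.orderIsoRpow_apply, ENNReal.rpow_two] at this
          rw [← this]
          exact pow_le_pow_left' hl 2
      _ ≤ liminf (fun n => ∫⁻ X, ‖∫ s, kM d a 0 (HTn d Φ t n) X s‖ₑ ^ 2 ∂(ωa d a)) atTop := lintegral_liminf_le fun n => (hknm n).enorm.pow_const 2
      _ ≤ _ := liminf_le_of_frequently_le' (Frequently.of_forall step)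
  rw [eL2]
  have e3 : ∀ X, ‖I * ∫ s, kM d a 0 (HT d Φ t) X s‖ₑ = ‖∫ s, kM d a 0 (HT d Φ t) X s‖ₑ := fun X => by
    rw [enorm_mul, ← ofReal_norm I, Complex.norm_I]; simp
  simp only [e3]
  refine (ENNReal.rpow_le_rpow lim (show (0:RR) ≤ 1/2 by norm_num)).trans (le_of_eq ?_)
  rw [ENNReal.mul_rpow_of_nonneg _ _ (by norm_num), ← ENNReal.rpow_natCast, ← ENNReal.rpow_mul]
  norm_num

lemma liminf_rpow (u : ℕ → ℝ≥0∞) {p : RR} (hp : 0 < p) : (liminf u atTop) ^ p = liminf (fun n => u n ^ p) atTop := by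
  have := (ENNReal.orderIsoRpow p hp).liminf_apply (f := atTop) (u := u)
  simpa only [ENNReal.orderIsoRpow_apply] using this

lemma mix_fatou {d : ℕ} {q r : RR} (hq : 0 < q) (hr : 0 < r) (W : (Ed d) → RR → CC) (Wn : ℕ → (Ed d) → RR → CC)
    (hm : ∀ n, Measurable (uncurry (Wn n))) (hl : ∀ x t, ‖W x t‖ₑ ≤ liminf (fun n => ‖Wn n x t‖ₑ) atTop) (M : ℝ≥0∞)
    (hM : ∀ n, mixNorm d q r (Wn n) ≤ M) : mixNorm d q r W ≤ M := by
  have hsl : ∀ n t, Measurable fun x => Wn n x t := fun n t => (hm n).comp (measurable_id.prodMk measurable_const : Measurable fun y : Ed d => (y, t))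
  have h1 : ∀ t, nrm r W t ≤ liminf (fun n => nrm r (Wn n) t) atTop := by
    intro t
    unfold nrm
    rw [← liminf_rpow _ (by positivity)]
    refine ENNReal.rpow_le_rpow ?_ (by positivity)
    calc ∫⁻ x, ‖W x t‖ₑ ^ r ≤ ∫⁻ x, liminf (fun n => ‖Wn n x t‖ₑ ^ r) atTop := by
          refine lintegral_mono fun x => ?_
          rw [← liminf_rpow _ hr]
          exact ENNReal.rpow_le_rpow (hl x t) hr.le
      _ ≤ _ := lintegral_liminf_le fun n => (hsl n t).enorm.pow_const r
  rw [mixNorm_eq]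
  calc (∫⁻ t, nrm r W t ^ q) ^ (1/q) ≤ (liminf (fun n => ∫⁻ t, nrm r (Wn n) t ^ q) atTop) ^ (1/q) := by
        refine ENNReal.rpow_le_rpow ?_ (by positivity)
        calc ∫⁻ t, nrm r W t ^ q ≤ ∫⁻ t, liminf (fun n => nrm r (Wn n) t ^ q) atTop := by
              refine lintegral_mono fun t => ?_
              rw [← liminf_rpow _ hq]
              exact ENNReal.rpow_le_rpow (h1 t) hq.le
          _ ≤ _ := lintegral_liminf_le fun n => (nrm_measurable r _ (hm n)).pow_const q
    _ = liminf (fun n => mixNorm d q r (Wn n)) atTop := by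
        rw [liminf_rpow _ (by positivity)]
        simp only [mixNorm_eq]
    _ ≤ M := liminf_le_of_frequently_le' (Frequently.of_forall hM)

lemma mix_congr {d : ℕ} {q r : RR} (A B : (Ed d) → RR → CC) (h : ∀ᵐ t : RR, ∀ x, A x t = B x t) : mixNorm d q r A = mixNorm d q r B := by
  unfold mixNorm
  congr 1
  refine lintegral_congr_ae (h.mono fun t ht => ?_)
  simp only [ht]

lemma mix_add {d : ℕ} {q r : RR} (hq : 1 ≤ q) (hr : 1 ≤ r) (A B : (Ed d) → RR → CC) (hA : Measurable (uncurry A)) (hB : Measurable (uncurry B)) :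
    mixNorm d q r (fun x t => A x t + B x t) ≤ mixNorm d q r A + mixNorm d q r B := by
  have hsl : ∀ C : (Ed d) → RR → CC, Measurable (uncurry C) → ∀ t, Measurable fun x => ‖C x t‖ₑ := fun C hC t => 
    (hC.comp (measurable_id.prodMk measurable_const : Measurable fun y : Ed d => (y, t))).enorm
  have h1 : ∀ t, nrm r (fun x t => A x t + B x t) t ≤ nrm r A t + nrm r B t := by
    intro t
    refine le_trans ?_ (ENNReal.lintegral_Lp_add_le (hsl A hA t).aemeasurable (hsl B hB t).aemeasurable hr)
    exact ENNReal.rpow_le_rpow (lintegral_mono fun x => ENNReal.rpow_le_rpow (enorm_add_le _ _) (by linarith)) (by positivity)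
  simp only [mixNorm_eq]
  refine le_trans ?_ (ENNReal.lintegral_Lp_add_le (nrm_measurable r A hA).aemeasurable (nrm_measurable r B hB).aemeasurable hq)
  exact ENNReal.rpow_le_rpow (lintegral_mono fun t => ENNReal.rpow_le_rpow (h1 t) (by linarith)) (by positivity)

lemma rpow_bd {x l K e : RR} (hl : 0 < l) (h1 : l ≤ x) (h2 : x ≤ K) : x ^ e ≤ l ^ e + K ^ e := by
  have hx := hl.trans_le h1
  have hK := hx.trans_le h2
  rcases le_total 0 e with h | h
  · exact (Real.rpow_le_rpow hx.le h2 h).trans (le_add_of_nonneg_left (by positivity))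
  · exact (Real.rpow_le_rpow_of_nonpos hl h1 h).trans (le_add_of_nonneg_right (by positivity))

lemma J_cancel {J M : ℝ≥0∞} {q pt : RR} (hq : 0 < q) (h : 1/q + 1/pt = 1) (hJ : J ≠ ⊤) (hb : J ≤ M * J ^ (1/pt)) : J ≤ M ^ q := by
  rcases eq_or_ne J 0 with h0 | h0
  · simp [h0]
  have e : J = J ^ (1/q) * J ^ (1/pt) := by
    rw [← ENNReal.rpow_add _ _ h0 hJ, h, ENNReal.rpow_one]
  have h2 : J ^ (1/q) * J ^ (1/pt) ≤ M * J ^ (1/pt) := e ▸ hb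
  have h3 : J ^ (1/q) ≤ M := by
    refine (ENNReal.mul_le_mul_iff_left ?_ ?_).1 h2
    · simp [ENNReal.rpow_eq_zero_iff, h0, hJ]
    · exact ENNReal.rpow_ne_top_of_ne_zero h0 hJ
  calc J = (J ^ (1/q)) ^ q := by rw [← ENNReal.rpow_mul, one_div_mul_cancel hq.ne', ENNReal.rpow_one]
    _ ≤ M ^ q := ENNReal.rpow_le_rpow h3 hq.le

lemma dual_step {d : ℕ} {q r p pt : RR} (hq : 1 < q) (hr : 2 ≤ r) (hp : p = r/(r-1)) (hpt : pt = q/(q-1)) {N ε : RR} (hN : 0 ≤ N) (hε : 0 < ε)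
    (G : (Ed d) → RR → CC) (hG : Measurable (uncurry G)) (hb : ∀ x t, ‖G x t‖ ≤ N) (hx : ∀ x t, N < ‖x‖ → G x t = 0) (ht : ∀ x t, N < |t| → G x t = 0)
    (M : ℝ≥0∞) (hM : ∀ H : (Ed d) → RR → CC, Measurable (uncurry H) → (∃ B, ∀ x t, ‖H x t‖ ≤ B) → (∀ x t, G x t = 0 → H x t = 0) →
      ‖∫ t, ∫ x, G x t * H x t‖ₑ ≤ M * mixNorm d pt p H) :
    ∫⁻ t, (if eo ε < ∫⁻ x, ‖G x t‖ₑ ^ r then (∫⁻ x, ‖G x t‖ₑ ^ r) ^ (q/r) else 0) ≤ M ^ q := by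
  have hr0 : 0 < r := by linarith
  have hr1 : 0 < r - 1 := by linarith
  have hq1 : 0 < q - 1 := by linarith
  set g : RR → ℝ≥0∞ := fun t => ∫⁻ x, ‖G x t‖ₑ ^ r with hg
  set V : ℝ≥0∞ := volume (Metric.closedBall (0 : Ed d) N) with hV
  have hVt : V ≠ ⊤ := (measure_closedBall_lt_top).ne
  have hgm : Measurable g := by
    have : Measurable fun q : RR × (Ed d) => ‖G q.2 q.1‖ₑ ^ r := (hG.comp measurable_swap).enorm.pow_const r
    exact this.lintegral_prod_right' (ν := volume)
  set K : ℝ≥0∞ := eo (N ^ r) * V with hK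
  have hKt : K ≠ ⊤ := ENNReal.mul_ne_top (by simp) hVt
  have hpow : ∀ x t, ‖G x t‖ₑ ^ r = eo (‖G x t‖ ^ r) := fun x t => by
    rw [← ofReal_norm, ENNReal.ofReal_rpow_of_nonneg (norm_nonneg _) hr0.le]
  have hgK : ∀ t, g t ≤ K := by
    intro t
    calc g t ≤ ∫⁻ x, (Metric.closedBall (0 : Ed d) N).indicator (fun _ => eo (N ^ r)) x := by
          refine lintegral_mono fun x => ?_
          by_cases h : x ∈ Metric.closedBall (0 : Ed d) N
          · rw [Set.indicator_of_mem h, hpow]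
            exact ENNReal.ofReal_le_ofReal (Real.rpow_le_rpow (norm_nonneg _) (hb _ _) hr0.le)
          · rw [hx x t (by simpa using h)]; simp [hr0]
      _ = K := by rw [lintegral_indicator_const Metric.isClosed_closedBall.measurableSet]
  set gr : RR → RR := fun t => (g t).toReal with hgr
  have hgrm : Measurable gr := hgm.ennreal_toReal
  have hgt : ∀ t, g t ≠ ⊤ := fun t => ((hgK t).trans_lt hKt.lt_top).ne
  have hgg : ∀ t, eo (gr t) = g t := fun t => ENNReal.ofReal_toReal (hgt t)
  have hgr0 : ∀ t, 0 ≤ gr t := fun t => ENNReal.toReal_nonneg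
  have hgrK : ∀ t, gr t ≤ K.toReal := fun t => ENNReal.toReal_mono hKt (hgK t)
  have hgi : ∀ t, ∫ x, ‖G x t‖ ^ r = gr t := by
    intro t
    rw [integral_eq_lintegral_of_nonneg_ae (ae_of_all _ fun x => by positivity)]
    · simp only [hgr, hg, hpow]
    · exact ((hG.comp (measurable_id.prodMk measurable_const : Measurable fun y : Ed d => (y, t))).norm.pow_const r).aestronglyMeasurable
  set h : RR → RR := fun t => if ε < gr t then gr t ^ ((q-r)/r) else 0 with hh
  have hset : MeasurableSet {t | ε < gr t} := measurableSet_lt measurable_const hgrm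
  have hhm : Measurable h := Measurable.ite hset (hgrm.pow_const _) measurable_const
  have hh0 : ∀ t, 0 ≤ h t := fun t => by
    simp only [hh]; split_ifs
    · exact Real.rpow_nonneg (hgr0 t) _
    · exact le_rfl
  have hhB : ∀ t, h t ≤ ε ^ ((q-r)/r) + K.toReal ^ ((q-r)/r) := fun t => by
    simp only [hh]; split_ifs with h1
    · exact rpow_bd hε h1.le (hgrK t)
    · positivity
  set j : RR → RR := fun t => if ε < gr t then gr t ^ (q/r) else 0 with hj
  have hjm : Measurable j := Measurable.ite hset (hgrm.pow_const _) measurable_const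
  have hj0 : ∀ t, 0 ≤ j t := fun t => by
    simp only [hj]; split_ifs
    · exact Real.rpow_nonneg (hgr0 t) _
    · exact le_rfl
  have hgh : ∀ t, gr t * h t = j t := fun t => by
    simp only [hh, hj]; split_ifs with h1
    · have : 0 < gr t := hε.trans h1
      nth_rw 1 [← Real.rpow_one (gr t)]
      rw [← Real.rpow_add this]; congr 1; field_simp; ring
    · simp
  have hji : Integrable j := by
    have hi : Integrable (fun t : RR => (Metric.closedBall (0:RR) N).indicator (fun _ => K.toReal ^ (q/r)) t) :=
      (integrable_indicator_iff Metric.isClosed_closedBall.measurableSet).2 (integrableOn_const (measure_closedBall_lt_top).ne)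
    refine hi.mono' hjm.aestronglyMeasurable (ae_of_all _ fun t => ?_)
    rw [Real.norm_of_nonneg (hj0 t)]
    by_cases h1 : t ∈ Metric.closedBall (0:RR) N
    · rw [Set.indicator_of_mem h1]
      simp only [hj]; split_ifs with h2
      · exact Real.rpow_le_rpow (hgr0 t) (hgrK t) (by positivity)
      · positivity
    · rw [Set.indicator_of_notMem h1]
      have : gr t = 0 := by
        simp only [hgr, hg]
        simp [ht _ t (by simpa using h1), hr0]
      simp [hj, this, not_lt.2 hε.le]
  set H : (Ed d) → RR → CC := fun x t => (starRingEnd CC) (G x t) * ((‖G x t‖ ^ (r-2) * h t : RR):CC) with hH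
  have hHm : Measurable (uncurry H) := by
    have a1 : Measurable fun s : (Ed d) × RR => (starRingEnd CC) (G s.1 s.2) := Complex.continuous_conj.measurable.comp hG
    have a2 : Measurable fun s : (Ed d) × RR => ‖G s.1 s.2‖ ^ (r-2) * h s.2 := (hG.norm.pow_const _).mul (hhm.comp measurable_snd)
    exact a1.mul (Complex.measurable_ofReal.comp a2)
  have hHn : ∀ x t, ‖H x t‖ = ‖G x t‖ ^ (r-1) * h t := fun x t => by
    simp only [hH, norm_mul, RCLike.norm_conj, Complex.norm_real]
    rw [Real.norm_of_nonneg (by positivity), Real.norm_of_nonneg (hh0 t), ← mul_assoc]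
    congr 1
    nth_rw 1 [← Real.rpow_one ‖G x t‖]
    rw [← Real.rpow_add' (norm_nonneg _) (by linarith)]; congr 1; ring
  have hGH : ∀ x t, G x t * H x t = ((‖G x t‖ ^ r * h t : RR):CC) := fun x t => by
    simp only [hH]
    rw [← mul_assoc, Complex.mul_conj, Complex.normSq_eq_norm_sq, ← Complex.ofReal_mul, ← mul_assoc]
    congr 2
    rw [← Real.rpow_two, ← Real.rpow_add' (norm_nonneg _) (by linarith)]; congr 1; ring
  have main := hM H hHm ⟨N ^ (r-1) * (ε ^ ((q-r)/r) + K.toReal ^ ((q-r)/r)), fun x t => by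
    rw [hHn]
    exact mul_le_mul (Real.rpow_le_rpow (norm_nonneg _) (hb _ _) hr1.le) (hhB t) (hh0 t) (by positivity)⟩ (fun x t h => by simp [hH, h])
  have e1 : ‖∫ t, ∫ x, G x t * H x t‖ₑ = ∫⁻ t, eo (j t) := by
    simp only [hGH]
    have : ∀ t, ∫ x, ((‖G x t‖ ^ r * h t : RR):CC) = ((j t : RR):CC) := fun t => by
      rw [integral_complex_ofReal, integral_mul_const, hgi, hgh]
    simp only [this]
    rw [integral_complex_ofReal, ← ofReal_integral_eq_lintegral_ofReal hji (ae_of_all _ hj0), ← ofReal_norm, Complex.norm_real, Real.norm_of_nonneg (integral_nonneg hj0)]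
  have hp0 : 0 < p := by rw [hp]; positivity
  have hpt0 : 0 < pt := by rw [hpt]; positivity
  have e2 : mixNorm d pt p H = (∫⁻ t, eo (j t)) ^ (1/pt) := by
    rw [mixNorm_eq]
    congr 1
    refine lintegral_congr fun t => ?_
    have : ∫⁻ x, ‖H x t‖ₑ ^ p = eo (gr t * h t ^ p) := by
      rw [ENNReal.ofReal_mul (hgr0 t), hgg]
      simp only [hg]
      rw [← lintegral_mul_const' _ _ (by simp)]
      refine lintegral_congr fun x => ?_
      rw [hpow, ← ofReal_norm, hHn, ENNReal.ofReal_rpow_of_nonneg (by have := hh0 t; positivity) hp0.le, ← ENNReal.ofReal_mul (by positivity),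
        Real.mul_rpow (by positivity) (hh0 t), ← Real.rpow_mul (norm_nonneg _)]
      congr 4
      rw [hp]; field_simp
    have hnn : 0 ≤ gr t * h t ^ p := mul_nonneg (hgr0 t) (Real.rpow_nonneg (hh0 t) _)
    rw [nrm, this, ← ENNReal.rpow_mul, ENNReal.ofReal_rpow_of_nonneg hnn (by positivity)]
    congr 1
    simp only [hh, hj]
    split_ifs with h1
    · have h3 : 0 < gr t := hε.trans h1
      rw [← Real.rpow_mul h3.le]
      nth_rw 1 [← Real.rpow_one (gr t)]
      rw [← Real.rpow_add h3, ← Real.rpow_mul h3.le]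
      congr 1
      rw [hp, hpt]; field_simp; ring
    · rw [Real.zero_rpow hp0.ne', mul_zero, Real.zero_rpow (by positivity)]
  rw [e1, e2] at main
  have hJt : ∫⁻ t, eo (j t) ≠ ⊤ := by
    rw [← ofReal_integral_eq_lintegral_ofReal hji (ae_of_all _ hj0)]; simp
  have := J_cancel (q := q) (by linarith) (by rw [hpt]; field_simp; ring) hJt main
  refine le_trans (le_of_eq (lintegral_congr fun t => ?_)) this
  have hiff : eo ε < g t ↔ ε < gr t := by
    rw [← hgg t]; exact ENNReal.ofReal_lt_ofReal_iff_of_nonneg hε.le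
  simp only [hj]
  by_cases h1 : ε < gr t
  · rw [if_pos h1, if_pos (hiff.2 h1), ← ENNReal.ofReal_rpow_of_nonneg (hgr0 t) (by positivity), hgg]
  · rw [if_neg h1, if_neg (fun h => h1 (hiff.1 h))]; simp

def inS {d : ℕ} (N : RR) (x : Ed d) (t : RR) : Prop := ‖x‖ ≤ N ∧ 1/N ≤ |t| ∧ |t| ≤ N

open Classical in
def trunc {d : ℕ} (G : (Ed d) → RR → CC) (n : ℕ) (x : Ed d) (t : RR) : CC := if inS ((n:RR)+1) x t ∧ ‖G x t‖ ≤ (n:RR)+1 then G x t else 0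

lemma trunc_measurable {d : ℕ} (G : (Ed d) → RR → CC) (hG : Measurable (uncurry G)) (n : ℕ) : Measurable (uncurry (trunc G n)) := by
  have h1 : Measurable fun s : (Ed d) × RR => ‖s.1‖ := measurable_norm.comp measurable_fst
  have h2 : Measurable fun s : (Ed d) × RR => |s.2| := measurable_norm.comp measurable_snd
  have hS : MeasurableSet {s : (Ed d) × RR | inS ((n:RR)+1) s.1 s.2 ∧ ‖G s.1 s.2‖ ≤ (n:RR)+1} :=
    ((measurableSet_le h1 measurable_const).inter ((measurableSet_le measurable_const h2).inter (measurableSet_le h2 measurable_const))).inter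
      (measurableSet_le hG.norm measurable_const)
  exact Measurable.ite hS hG measurable_const

lemma mix_dual {d : ℕ} {q r p pt : RR} (hq : 1 < q) (hr : 2 ≤ r) (hp : p = r/(r-1)) (hpt : pt = q/(q-1)) 
    (G : (Ed d) → RR → CC) (hG : Measurable (uncurry G)) 
    (M : ℝ≥0∞) (hM : ∀ H : (Ed d) → RR → CC, Measurable (uncurry H) → ∀ B N : RR, 0 < N → (∀ x t, ‖H x t‖ ≤ B) → (∀ x t, ¬ inS N x t → H x t = 0) →
      ‖∫ t, ∫ x, G x t * H x t‖ₑ ≤ M * mixNorm d pt p H) : mixNorm d q r G ≤ M := by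
  have hr0 : 0 < r := by linarith
  have hq0 : 0 < q := by linarith
  set g : ℕ → RR → ℝ≥0∞ := fun n t => ∫⁻ x, ‖trunc G n x t‖ₑ ^ r with hg
  have htm := trunc_measurable G hG
  have hgm : ∀ n, Measurable (g n) := fun n => by
    have : Measurable fun q : RR × (Ed d) => ‖trunc G n q.2 q.1‖ₑ ^ r := ((htm n).comp measurable_swap).enorm.pow_const r
    exact this.lintegral_prod_right' (ν := volume)
  have step : ∀ n : ℕ, ∫⁻ t, (if eo (1/((n:RR)+1)) < g n t then (g n t) ^ (q/r) else 0) ≤ M ^ q := by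
    intro n
    have hn : (0:RR) < (n:RR)+1 := by positivity
    refine dual_step hq hr hp hpt hn.le (by positivity) (trunc G n) (htm n) ?_ ?_ ?_ M ?_
    · intro x t; unfold trunc; split_ifs with h
      · exact h.2
      · simpa using hn.le
    · intro x t h; unfold trunc; rw [if_neg]; rintro ⟨h1, -⟩; exact absurd h1.1 (not_le.2 h)
    · intro x t h; unfold trunc; rw [if_neg]; rintro ⟨h1, -⟩; exact absurd h1.2.2 (not_le.2 h)
    · rintro H hH ⟨B, hB⟩ hz
      have e : ∀ x t, trunc G n x t * H x t = G x t * H x t := fun x t => by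
        by_cases h : inS ((n:RR)+1) x t ∧ ‖G x t‖ ≤ (n:RR)+1
        · unfold trunc; rw [if_pos h]
        · rw [hz x t (by unfold trunc; rw [if_neg h])]; simp
      simp only [e]
      refine hM H hH B _ hn hB fun x t h => hz x t ?_
      unfold trunc; rw [if_neg fun h' => h h'.1]
  have hlim : ∀ t : RR, t ≠ 0 → nrm r G t ^ q ≤ liminf (fun n : ℕ => if eo (1/((n:RR)+1)) < g n t then (g n t) ^ (q/r) else 0) atTop := by
    intro t ht
    set gi := ∫⁻ x, ‖G x t‖ₑ ^ r with hgi
    have e : nrm r G t ^ q = gi ^ (q/r) := by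
      rw [nrm, ← ENNReal.rpow_mul]; congr 1; ring
    have hmono : ∀ x, Monotone fun n => ‖trunc G n x t‖ₑ ^ r := by
      intro x n m hnm
      refine ENNReal.rpow_le_rpow ?_ hr0.le
      have hc : (n:RR)+1 ≤ (m:RR)+1 := by have : (n:RR) ≤ m := Nat.cast_le.2 hnm; linarith
      by_cases h : inS ((n:RR)+1) x t ∧ ‖G x t‖ ≤ (n:RR)+1
      · have h' : inS ((m:RR)+1) x t ∧ ‖G x t‖ ≤ (m:RR)+1 :=
          ⟨⟨h.1.1.trans hc, (one_div_le_one_div_of_le (by positivity) hc).trans h.1.2.1, h.1.2.2.trans hc⟩, h.2.trans hc⟩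
        unfold trunc; rw [if_pos h, if_pos h']
      · unfold trunc; rw [if_neg h]; simp
    have hpt1 : ∀ x, Tendsto (fun n => ‖trunc G n x t‖ₑ ^ r) atTop (𝓝 (‖G x t‖ₑ ^ r)) := by
      intro x
      refine tendsto_const_nhds.congr' ?_
      have hz := (tendsto_one_div_add_atTop_nhds_zero_nat (𝕜 := RR)).eventually_lt_const (abs_pos.2 ht)
      have ha := (tendsto_natCast_atTop_atTop (R := RR)).eventually_ge_atTop (max ‖x‖ (max |t| ‖G x t‖))
      filter_upwards [hz, ha] with n h1 h2
      have h3 := (le_max_left _ _).trans h2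
      have h4 := ((le_max_left _ _).trans (le_max_right _ _)).trans h2
      have h5 := ((le_max_right _ _).trans (le_max_right _ _)).trans h2
      unfold trunc; rw [if_pos ⟨⟨by linarith, h1.le, by linarith⟩, by linarith⟩]
    have hgt : Tendsto (fun n => g n t) atTop (𝓝 gi) := by
      refine lintegral_tendsto_of_tendsto_of_monotone (fun n => ?_) (ae_of_all _ hmono) (ae_of_all _ hpt1)
      exact (((htm n).comp (measurable_id.prodMk measurable_const : Measurable fun y : Ed d => (y, t))).enorm.pow_const r).aemeasurable
    rw [e]
    rcases eq_or_ne gi 0 with h0 | h0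
    · rw [h0, ENNReal.zero_rpow_of_pos (by positivity)]; simp
    · have hz : Tendsto (fun n : ℕ => eo (1/((n:RR)+1))) atTop (𝓝 0) := by
        simpa using ENNReal.tendsto_ofReal (tendsto_one_div_add_atTop_nhds_zero_nat (𝕜 := RR))
      obtain ⟨c, hc0, hc⟩ := exists_between (pos_iff_ne_zero.2 h0)
      have : Tendsto (fun n : ℕ => if eo (1/((n:RR)+1)) < g n t then (g n t) ^ (q/r) else 0) atTop (𝓝 (gi ^ (q/r))) := by
        refine ((ENNReal.continuous_rpow_const.tendsto gi).comp hgt).congr' ?_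
        filter_upwards [hz.eventually_lt_const hc0, hgt.eventually_const_lt hc] with n h1 h2
        rw [if_pos (h1.trans h2)]; rfl
      exact this.liminf_eq.ge
  have hfin : ∫⁻ t, nrm r G t ^ q ≤ M ^ q := by
    calc ∫⁻ t, nrm r G t ^ q ≤ ∫⁻ t, liminf (fun n : ℕ => if eo (1/((n:RR)+1)) < g n t then (g n t) ^ (q/r) else 0) atTop := by
          refine lintegral_mono_ae ?_
          filter_upwards [compl_mem_ae_iff.2 (measure_singleton (0:RR))] with t ht using hlim t (by simpa using ht)
      _ ≤ _ := lintegral_liminf_le fun n => Measurable.ite (measurableSet_lt measurable_const (hgm n)) ((hgm n).pow_const _) measurable_const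
      _ ≤ _ := liminf_le_of_frequently_le' (Frequently.of_forall step)
  rw [mixNorm_eq]
  refine (ENNReal.rpow_le_rpow hfin (by positivity)).trans (le_of_eq ?_)
  rw [← ENNReal.rpow_mul, mul_one_div_cancel hq0.ne', ENNReal.rpow_one]

section sw
variable {X Y : Type*} [MeasurableSpace X] [MeasurableSpace Y]
lemma dom_int (m : Measure X) (n : Measure Y) [SFinite m] [SFinite n] (f : X → Y → CC) (hf : Measurable (uncurry f)) (g : X → RR) (h : Y → RR)
    (hg : Integrable g m) (hh : Integrable h n) (hb : ∀ x y, ‖f x y‖ ≤ g x * h y) : Integrable (uncurry f) (m.prod n) :=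
  (hg.mul_prod hh).mono' hf.aestronglyMeasurable (ae_of_all _ fun s => hb s.1 s.2)

lemma swap_dom (m : Measure X) (n : Measure Y) [SFinite m] [SFinite n] (f : X → Y → CC) (hf : Measurable (uncurry f)) (g : X → RR) (h : Y → RR)
    (hg : Integrable g m) (hh : Integrable h n) (hb : ∀ x y, ‖f x y‖ ≤ g x * h y) : ∫ x, ∫ y, f x y ∂n ∂m = ∫ y, ∫ x, f x y ∂m ∂n :=
  integral_integral_swap (dom_int m n f hf g h hg hh hb)
end sw

def bx {d : ℕ} (N : RR) (x : Ed d) : RR := (Metric.closedBall (0 : Ed d) N).indicator (fun _ => (1:RR)) x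
def bt (N : RR) (t : RR) : RR := (Metric.closedBall (0 : RR) N).indicator (fun _ => (1:RR)) t

lemma bx_int {d : ℕ} (N : RR) : Integrable (bx N : (Ed d) → RR) :=
  (integrable_indicator_iff Metric.isClosed_closedBall.measurableSet).2 (integrableOn_const (measure_closedBall_lt_top).ne)
lemma bt_int (N : RR) : Integrable (bt N) :=
  (integrable_indicator_iff Metric.isClosed_closedBall.measurableSet).2 (integrableOn_const (measure_closedBall_lt_top).ne)
lemma bx_nonneg {d : ℕ} (N : RR) (x : Ed d) : 0 ≤ bx N x := Set.indicator_nonneg (fun _ _ => zero_le_one) _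
lemma bt_nonneg (N : RR) (x : RR) : 0 ≤ bt N x := Set.indicator_nonneg (fun _ _ => zero_le_one) _

lemma test_bd {d : ℕ} {B N : RR} (H : (Ed d) → RR → CC) (hB : ∀ x t, ‖H x t‖ ≤ B) (hz : ∀ x t, ¬ inS N x t → H x t = 0) (x : Ed d) (t : RR) :
    ‖H x t‖ ≤ B * (bx N x * bt N t) := by
  by_cases h : inS N x t
  · have h1 : x ∈ Metric.closedBall (0 : Ed d) N := by simpa using h.1
    have h2 : t ∈ Metric.closedBall (0 : RR) N := by simpa using h.2.2
    rw [bx, bt, Set.indicator_of_mem h1, Set.indicator_of_mem h2]; simpa using hB x t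
  · rw [hz x t h, norm_zero]
    have : 0 ≤ B := (norm_nonneg _).trans (hB x t)
    exact mul_nonneg this (mul_nonneg (bx_nonneg _ _) (bt_nonneg _ _))

lemma slice_meas {d : ℕ} (H : (Ed d) → RR → CC) (hH : Measurable (uncurry H)) (t : RR) : Measurable fun x => H x t :=
  hH.comp (measurable_id.prodMk measurable_const : Measurable fun y : Ed d => (y, t))

lemma test_sl {d : ℕ} {B N : RR} (H : (Ed d) → RR → CC) (hH : Measurable (uncurry H)) (hB : ∀ x t, ‖H x t‖ ≤ B) (hz : ∀ x t, ¬ inS N x t → H x t = 0) (t : RR) :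
    Integrable fun x => H x t := by
  refine ((bx_int N).const_mul (B * bt N t)).mono' (slice_meas H hH t).aestronglyMeasurable (ae_of_all _ fun x => ?_)
  exact (test_bd H hB hz x t).trans (le_of_eq (by ring))

lemma test_i {d : ℕ} {B N : RR} (H : (Ed d) → RR → CC) (hH : Measurable (uncurry H)) (hB : ∀ x t, ‖H x t‖ ≤ B) (hz : ∀ x t, ¬ inS N x t → H x t = 0) :
    Integrable fun t => ∫ x, ‖H x t‖ := by
  have hm : Measurable fun q : RR × (Ed d) => ‖H q.2 q.1‖ := (hH.comp measurable_swap).norm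
  refine ((bt_int N).const_mul (B * ∫ x : Ed d, bx N x)).mono' (hm.stronglyMeasurable.integral_prod_right' (ν := volume)).aestronglyMeasurable (ae_of_all _ fun t => ?_)
  rw [Real.norm_of_nonneg (integral_nonneg fun y => norm_nonneg _), mul_right_comm, ← integral_const_mul]
  refine integral_mono (test_sl H hH hB hz t).norm ((bx_int N).const_mul _) fun x => ?_
  exact (test_bd H hB hz x t).trans (le_of_eq (by ring))

lemma norm_SKh_le {d : ℕ} (hd : 1 ≤ d) {a : RR} (ha : 0 ≤ a) (X Y : (Ed d) × RR) (t : RR) :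
    ‖SKh d a X Y t‖ ≤ cS a * |t| ^ (-((a+1)/2)) * |t| ^ (-(d:RR)/2) := by
  unfold SKh
  rw [norm_mul]
  have := cS_pos ha
  exact mul_le_mul (norm_Sh_le ha _ _ _) (norm_Sfree_le hd _ _ _) (norm_nonneg _) (by positivity)

lemma T_pair {d : ℕ} (hd : 1 ≤ d) {a : RR} (ha : 0 ≤ a) (z : RR) (u : (Ed d) × RR → CC) (hu : Measurable u) (hui : Integrable u (ωa d a)) {B N : RR} (hN : 0 < N)
    (H : (Ed d) → RR → CC) (hH : Measurable (uncurry H)) (hB : ∀ x t, ‖H x t‖ ≤ B) (hz : ∀ x t, ¬ inS N x t → H x t = 0) :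
    ∫ t, ∫ x, AD d a (fun Y _ => u Y) (x, z) t 0 * H x t = ∫ Y, u Y * (∫ t, kM d a z H Y t) ∂(ωa d a) := by
  have s1 : ∀ t, ∫ x, AD d a (fun Y _ => u Y) (x, z) t 0 * H x t = ∫ Y, u Y * kM d a z H Y t ∂(ωa d a) := by
    intro t
    have hm : Measurable (uncurry fun (x : Ed d) (Y : (Ed d) × RR) => SKh d a (x, z) Y t * u Y * H x t) := by
      have h1 : Measurable fun s : (Ed d) × ((Ed d) × RR) => SKh d a (s.1, z) s.2 t :=
        SKh_measurable ha (measurable_fst.prodMk measurable_const) measurable_snd measurable_const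
      have h2 : Measurable fun s : (Ed d) × ((Ed d) × RR) => H s.1 t := (slice_meas H hH t).comp measurable_fst
      exact (h1.mul (hu.comp measurable_snd)).mul h2
    have := swap_dom volume (ωa d a) _ hm (fun x => ‖H x t‖) (fun Y => cS a * |t| ^ (-((a+1)/2)) * |t| ^ (-(d:RR)/2) * ‖u Y‖)
      (test_sl H hH hB hz t).norm (hui.norm.const_mul _) (fun x Y => by
        rw [norm_mul, norm_mul, mul_comm ‖H x t‖]
        exact mul_le_mul_of_nonneg_right (mul_le_mul_of_nonneg_right (norm_SKh_le hd ha _ _ _) (norm_nonneg _)) (norm_nonneg _))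
    calc _ = ∫ x, ∫ Y, SKh d a (x, z) Y t * u Y * H x t ∂(ωa d a) := by
          refine integral_congr_ae (ae_of_all _ fun x => ?_)
          simp only [AD]; rw [integral_mul_const]
      _ = _ := this
      _ = _ := by
          refine integral_congr_ae (ae_of_all _ fun Y => ?_)
          simp only [kM, UH, SKh]
          rw [← mul_assoc, ← integral_const_mul]
          refine integral_congr_ae (ae_of_all _ fun x => ?_)
          simp only []
          rw [Sfree_symm d x Y.1]; ring
  simp only [s1]
  have hm : Measurable (uncurry fun (t : RR) (Y : (Ed d) × RR) => u Y * kM d a z H Y t) := by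
    have e1 : Measurable fun s : RR × ((Ed d) × RR) => u s.2 := hu.comp measurable_snd
    have e2 : Measurable fun s : RR × ((Ed d) × RR) => (s.2, s.1) := measurable_snd.prodMk measurable_fst
    have e3 := Measurable.comp (kM_measurable ha z H hH) e2
    simp only [Function.comp_def] at e3
    exact e1.mul e3
  have := swap_dom volume (ωa d a) _ hm (fun t => cS a * (1/N) ^ (-((a+1)/2)) * (1/N) ^ (-((d:RR)/2)) * ∫ y, ‖H y t‖) (fun Y => ‖u Y‖) 
    ((test_i H hH hB hz).const_mul _) hui.norm (fun t Y => by
      rw [norm_mul, mul_comm]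
      refine mul_le_mul_of_nonneg_right (kM_bound hd ha z H (test_sl H hH hB hz) (by positivity) (fun y τ hτ => hz _ _ fun h => ?_) Y t) (norm_nonneg _)
      exact absurd h.2.1 (not_le.2 hτ))
  rw [this]
  refine integral_congr_ae (ae_of_all _ fun Y => ?_)
  simp only []
  rw [integral_const_mul]

lemma est2_T {d : ℕ} (hd : 1 ≤ d) {a : RR} (ha : 0 ≤ a) {p pt q r : RR} (hq : 1 < q) (hr : 2 ≤ r) (hpr : p = r/(r-1)) (hqpt : pt = q/(q-1)) (hp : 1 < p) (hp2 : p ≤ 2) (h0 : 0 < lamE d a p) (h1 : lamE d a p < 1)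
    (hpt : pt = 2/(2-lamE d a p)) (z : RR) (u : (Ed d) × RR → CC) (hu : Measurable u) (hui : Integrable u (ωa d a)) :
    mixNorm d q r (fun x t => AD d a (fun Y _ => u Y) (x, z) t 0) ≤ eo (CM d a p) ^ (1/2:RR) * eLpNorm u 2 (ωa d a) := by
  have hm : Measurable fun s : (Ed d) × RR => AD d a (fun Y _ => u Y) (s.1, z) s.2 0 :=
    AD_measurable ha (fun Y _ => u Y) (hu.comp measurable_fst) (measurable_fst.prodMk measurable_const) measurable_snd measurable_const
  refine mix_dual hq hr hpr hqpt _ hm _ fun H hH B N hN hB hz => ?_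
  rw [T_pair hd ha z u hu hui hN H hH hB hz]
  have hkm : Measurable fun X => ∫ t, kM d a z H X t := ((kM_measurable ha z H hH).stronglyMeasurable.integral_prod_right).measurable
  refine (cs_int (ωa d a) u _ hu.aemeasurable hkm.aemeasurable).trans ?_
  have hL := lemM hd ha hp hp2 h0 h1 hpt z H hH (test_sl H hH hB hz) (test_i H hH hB hz) (δ := 1/N) (by positivity) (fun y τ hτ => hz _ _ fun h => absurd h.2.1 (not_le.2 hτ))
  rw [eL2, mul_right_comm, mul_comm]
  refine mul_le_mul_left ?_ _
  refine (ENNReal.rpow_le_rpow hL (show (0:RR) ≤ 1/2 by norm_num)).trans (le_of_eq ?_)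
  rw [ENNReal.mul_rpow_of_nonneg _ _ (by norm_num), ← ENNReal.rpow_natCast, ← ENNReal.rpow_mul]
  norm_num

def VF (d : ℕ) (F : (Ed d) × RR → RR → CC) (x : Ed d) (s ζ τ : RR) : CC := ∫ y, Sfree d x y s * F (y, ζ) τ

def BD (d : ℕ) (a : RR) (ρ : Measure RR) (F : (Ed d) × RR → RR → CC) (z : RR) (x : Ed d) (s τ : RR) : CC := ∫ ζ, Sh a z ζ s * VF d F x s ζ τ ∂ρ

lemma VF_measurable {d : ℕ} (F : (Ed d) × RR → RR → CC) (hF : Measurable (uncurry F)) {S : Type*} [MeasurableSpace S]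
    {f : S → (Ed d)} {g h k : S → RR} (hf : Measurable f) (hg : Measurable g) (hh : Measurable h) (hk : Measurable k) :
    Measurable fun s => VF d F (f s) (g s) (h s) (k s) := by
  have h1 : Measurable fun q : S × (Ed d) => Sfree d (f q.1) q.2 (g q.1) :=
    Sfree_measurable d (hf.comp measurable_fst) measurable_snd (hg.comp measurable_fst)
  have h0 : Measurable fun q : S × (Ed d) => ((q.2, h q.1), k q.1) := (measurable_snd.prodMk (hh.comp measurable_fst)).prodMk (hk.comp measurable_fst)
  have h2 : Measurable fun q : S × (Ed d) => F (q.2, h q.1) (k q.1) := by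
    have := Measurable.comp hF h0
    simp only [Function.comp_def] at this
    exact this
  have h3 : Measurable fun q : S × (Ed d) => Sfree d (f q.1) q.2 (g q.1) * F (q.2, h q.1) (k q.1) := h1.mul h2
  exact (h3.stronglyMeasurable.integral_prod_right' (ν := volume)).measurable

lemma BD_measurable {d : ℕ} {a : RR} (ha : 0 ≤ a) (ρ : Measure RR) [SFinite ρ] (F : (Ed d) × RR → RR → CC) (hF : Measurable (uncurry F)) (z : RR) {S : Type*} [MeasurableSpace S]
    {f : S → (Ed d)} {g k : S → RR} (hf : Measurable f) (hg : Measurable g) (hk : Measurable k) :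
    Measurable fun s => BD d a ρ F z (f s) (g s) (k s) := by
  have h1 : Measurable fun q : S × RR => Sh a z q.2 (g q.1) := Sh_measurable ha measurable_const measurable_snd (hg.comp measurable_fst)
  have h2 : Measurable fun q : S × RR => VF d F (f q.1) (g q.1) q.2 (k q.1) :=
    VF_measurable F hF (hf.comp measurable_fst) (hg.comp measurable_fst) measurable_snd (hk.comp measurable_fst)
  have h3 : Measurable fun q : S × RR => Sh a z q.2 (g q.1) * VF d F (f q.1) (g q.1) q.2 (k q.1) := h1.mul h2
  exact (h3.stronglyMeasurable.integral_prod_right' (ν := ρ)).measurable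

def Wn (d : ℕ) (a : RR) (ρ : Measure RR) (F : (Ed d) × RR → RR → CC) (z : RR) (n : ℕ) (x : Ed d) (t : RR) : CC :=
  ∫ τ, cutn n (t-τ) * (chi t τ * BD d a ρ F z x (t-τ) τ)
def WD (d : ℕ) (a : RR) (ρ : Measure RR) (F : (Ed d) × RR → RR → CC) (z : RR) (x : Ed d) (t : RR) : CC :=
  ∫ τ, chi t τ * BD d a ρ F z x (t-τ) τ

def Kn (a z : RR) (n : ℕ) (t : RR) (s : RR × RR) : CC := cutn n (t-s.1) * (chi t s.1 * Sh a z s.2 (t-s.1))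

lemma WD_measurable {d : ℕ} {a : RR} (ha : 0 ≤ a) (ρ : Measure RR) [SFinite ρ] (F : (Ed d) × RR → RR → CC) (hF : Measurable (uncurry F)) (z : RR) :
    Measurable (uncurry (WD d a ρ F z)) := by
  have h1 : Measurable fun q : ((Ed d) × RR) × RR => chi q.1.2 q.2 :=
    chi_measurable.comp ((measurable_snd.comp measurable_fst).prodMk measurable_snd)
  have h2 : Measurable fun q : ((Ed d) × RR) × RR => BD d a ρ F z q.1.1 (q.1.2 - q.2) q.2 :=
    BD_measurable ha ρ F hF z (measurable_fst.comp measurable_fst) ((measurable_snd.comp measurable_fst).sub measurable_snd) measurable_snd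
  have h3 : Measurable fun q : ((Ed d) × RR) × RR => chi q.1.2 q.2 * BD d a ρ F z q.1.1 (q.1.2 - q.2) q.2 := h1.mul h2
  exact (h3.stronglyMeasurable.integral_prod_right' (ν := volume)).measurable

lemma Wn_measurable {d : ℕ} {a : RR} (ha : 0 ≤ a) (ρ : Measure RR) [SFinite ρ] (F : (Ed d) × RR → RR → CC) (hF : Measurable (uncurry F)) (z : RR) (n : ℕ) :
    Measurable (uncurry (Wn d a ρ F z n)) := by
  have h0 : Measurable fun q : ((Ed d) × RR) × RR => cutn n (q.1.2 - q.2) :=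
    (cutn_measurable n).comp ((measurable_snd.comp measurable_fst).sub measurable_snd)
  have h1 : Measurable fun q : ((Ed d) × RR) × RR => chi q.1.2 q.2 :=
    chi_measurable.comp ((measurable_snd.comp measurable_fst).prodMk measurable_snd)
  have h2 : Measurable fun q : ((Ed d) × RR) × RR => BD d a ρ F z q.1.1 (q.1.2 - q.2) q.2 :=
    BD_measurable ha ρ F hF z (measurable_fst.comp measurable_fst) ((measurable_snd.comp measurable_fst).sub measurable_snd) measurable_snd
  have h3 : Measurable fun q : ((Ed d) × RR) × RR => cutn n (q.1.2 - q.2) * (chi q.1.2 q.2 * BD d a ρ F z q.1.1 (q.1.2 - q.2) q.2) := h0.mul (h1.mul h2)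
  exact (h3.stronglyMeasurable.integral_prod_right' (ν := volume)).measurable

lemma Kn_measurable {a : RR} (ha : 0 ≤ a) (z : RR) (n : ℕ) (t : RR) : Measurable (Kn a z n t) := by
  have h0 : Measurable fun s : RR × RR => cutn n (t-s.1) := (cutn_measurable n).comp (measurable_const.sub measurable_fst)
  have h1 : Measurable fun s : RR × RR => chi t s.1 := chi_measurable.comp (measurable_const.prodMk measurable_fst)
  have h2 : Measurable fun s : RR × RR => Sh a z s.2 (t-s.1) := Sh_measurable ha measurable_const measurable_snd (measurable_const.sub measurable_fst)
  exact h0.mul (h1.mul h2)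

lemma norm_Kn_le {a : RR} (ha : 0 ≤ a) (z : RR) (n : ℕ) (t : RR) (s : RR × RR) : ‖Kn a z n t s‖ ≤ cS a * |t-s.1| ^ (-((a+1)/2)) := by
  unfold Kn
  rw [norm_mul, norm_mul]
  calc _ ≤ 1 * (1 * (cS a * |t-s.1| ^ (-((a+1)/2)))) :=
        mul_le_mul (norm_cutn_le _ _) (mul_le_mul (norm_chi_le _ _) (norm_Sh_le ha _ _ _) (norm_nonneg _) (by norm_num)) (by positivity) (by norm_num)
    _ = _ := by ring

lemma norm_VF_le {d : ℕ} (hd : 1 ≤ d) (F : (Ed d) × RR → RR → CC) {g : RR → RR} 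
    (hb : ∀ y ζ τ, ‖F (y, ζ) τ‖ ≤ wd (d+1) y * (g ζ * wd 2 τ)) (x : Ed d) (s ζ τ : RR) :
    ‖VF d F x s ζ τ‖ ≤ |s| ^ (-(d:RR)/2) * (∫ y : Ed d, wd (d+1) y) * (g ζ * wd 2 τ) := by
  unfold VF
  have : ∀ y, ‖Sfree d x y s * F (y, ζ) τ‖ ≤ |s| ^ (-(d:RR)/2) * (g ζ * wd 2 τ) * wd (d+1) y := fun y => by
    rw [norm_mul]
    calc _ ≤ |s| ^ (-(d:RR)/2) * (wd (d+1) y * (g ζ * wd 2 τ)) := mul_le_mul (norm_Sfree_le hd _ _ _) (hb _ _ _) (norm_nonneg _) (by positivity)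
      _ = _ := by ring
  refine (norm_integral_le_of_norm_le ((wd_int_E d).const_mul _) (ae_of_all _ this)).trans (le_of_eq ?_)
  rw [integral_const_mul]; ring

lemma Kn_VF_le {d : ℕ} (hd : 1 ≤ d) {a : RR} (ha : 0 ≤ a) (F : (Ed d) × RR → RR → CC) {g : RR → RR} (hg0 : ∀ ζ, 0 ≤ g ζ)
    (hb : ∀ y ζ τ, ‖F (y, ζ) τ‖ ≤ wd (d+1) y * (g ζ * wd 2 τ)) (z : RR) (n : ℕ) (t : RR) (s : RR × RR) (x : Ed d) :
    ‖Kn a z n t s * VF d F x (t-s.1) s.2 s.1‖ ≤ 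
      cS a * (1/((n:RR)+1)) ^ (-((a+1)/2)) * (1/((n:RR)+1)) ^ (-((d:RR)/2)) * (∫ y : Ed d, wd (d+1) y) * (wd 2 s.1 * g s.2) := by
  have hI : 0 ≤ ∫ y : Ed d, wd (d+1) y := integral_nonneg fun y => (wd_pos _ _).le
  have hc := cS_pos ha
  have hw : 0 < wd 2 s.1 := wd_pos _ _
  have hg := hg0 s.2
  rcases lt_or_ge |t-s.1| (1/((n:RR)+1)) with h | h
  · rw [Kn, cutn_zero h]; simp only [zero_mul, norm_zero]
    positivity
  · rw [norm_mul]
    have hn : 0 < 1/((n:RR)+1) := by positivity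
    have r1 : |t-s.1| ^ (-((a+1)/2)) ≤ (1/((n:RR)+1)) ^ (-((a+1)/2)) := Real.rpow_le_rpow_of_nonpos hn h (by linarith)
    have r2 : |t-s.1| ^ (-(d:RR)/2) ≤ (1/((n:RR)+1)) ^ (-((d:RR)/2)) := by
      rw [neg_div]; exact Real.rpow_le_rpow_of_nonpos hn h (by have : (0:RR) ≤ d := Nat.cast_nonneg d; linarith)
    calc _ ≤ (cS a * |t-s.1| ^ (-((a+1)/2))) * (|t-s.1| ^ (-(d:RR)/2) * (∫ y : Ed d, wd (d+1) y) * (g s.2 * wd 2 s.1)) :=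
          mul_le_mul (norm_Kn_le ha z n t s) (norm_VF_le hd F hb x _ _ _) (norm_nonneg _) (by positivity)
      _ ≤ (cS a * (1/((n:RR)+1)) ^ (-((a+1)/2))) * ((1/((n:RR)+1)) ^ (-((d:RR)/2)) * (∫ y : Ed d, wd (d+1) y) * (g s.2 * wd 2 s.1)) := by gcongr
      _ = _ := by ring

lemma W_pair {d : ℕ} (hd : 1 ≤ d) {a : RR} (ha : 0 ≤ a) (ρ : Measure RR) [SFinite ρ] (F : (Ed d) × RR → RR → CC) (hF : Measurable (uncurry F)) 
    {g : RR → RR} (hg0 : ∀ ζ, 0 ≤ g ζ) (hgi : Integrable g ρ)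
    (hb : ∀ y ζ τ, ‖F (y, ζ) τ‖ ≤ wd (d+1) y * (g ζ * wd 2 τ)) (z : RR) (n : ℕ) (t : RR) (h : (Ed d) → CC) (hm : Measurable h) (hi : Integrable h) :
    ∫ x, Wn d a ρ F z n x t * h x = ∫ s, Kn a z n t s * (∫ x, VF d F x (t-s.1) s.2 s.1 * h x) ∂(volume.prod ρ) := by
  have hKm := Kn_measurable ha z n t
  have hwi : Integrable (fun s : RR × RR => wd 2 s.1 * g s.2) (volume.prod ρ) := wd_int_R.mul_prod hgi
  have hVm : ∀ x, Measurable fun s : RR × RR => VF d F x (t-s.1) s.2 s.1 := fun x =>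
    VF_measurable F hF measurable_const (measurable_const.sub measurable_fst) measurable_snd measurable_fst
  have e : ∀ x, Wn d a ρ F z n x t = ∫ s, Kn a z n t s * VF d F x (t-s.1) s.2 s.1 ∂(volume.prod ρ) := by
    intro x
    have hint : Integrable (fun s : RR × RR => Kn a z n t s * VF d F x (t-s.1) s.2 s.1) (volume.prod ρ) :=
      (hwi.const_mul _).mono' (hKm.mul (hVm x)).aestronglyMeasurable (ae_of_all _ fun s => Kn_VF_le hd ha F hg0 hb z n t s x)
    rw [integral_prod _ hint, Wn]
    refine integral_congr_ae (ae_of_all _ fun τ => ?_)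
    simp only [BD, Kn]
    rw [← mul_assoc, ← integral_const_mul]
    refine integral_congr_ae (ae_of_all _ fun ζ => ?_)
    simp only []; ring
  simp only [e]
  have hm2 : Measurable (uncurry fun (x : Ed d) (s : RR × RR) => Kn a z n t s * VF d F x (t-s.1) s.2 s.1 * h x) := by
    have h1 : Measurable fun q : (Ed d) × (RR × RR) => Kn a z n t q.2 := hKm.comp measurable_snd
    have h2 : Measurable fun q : (Ed d) × (RR × RR) => VF d F q.1 (t-q.2.1) q.2.2 q.2.1 :=
      VF_measurable F hF measurable_fst (measurable_const.sub (measurable_fst.comp measurable_snd)) (measurable_snd.comp measurable_snd) (measurable_fst.comp measurable_snd)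
    have h3 : Measurable fun q : (Ed d) × (RR × RR) => h q.1 := hm.comp measurable_fst
    exact (h1.mul h2).mul h3
  have sw := swap_dom volume (volume.prod ρ) _ hm2 (fun x => ‖h x‖) _ hi.norm (hwi.const_mul _) (fun x s => by
    rw [norm_mul, mul_comm]
    exact mul_le_mul_of_nonneg_left (Kn_VF_le hd ha F hg0 hb z n t s x) (norm_nonneg _))
  calc _ = ∫ x, ∫ s, Kn a z n t s * VF d F x (t-s.1) s.2 s.1 * h x ∂(volume.prod ρ) := by
        refine integral_congr_ae (ae_of_all _ fun x => ?_)
        simp only []; rw [integral_mul_const]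
    _ = _ := sw
    _ = _ := by
        refine integral_congr_ae (ae_of_all _ fun s => ?_)
        simp only []; rw [← integral_const_mul]; simp only [mul_assoc]

lemma pt_bd {d : ℕ} (hd : 1 ≤ d) {a : RR} (ha : 0 ≤ a) {p : RR} (hp : 1 < p) (hp2 : p ≤ 2) (F : (Ed d) × RR → RR → CC) (hF : Measurable (uncurry F)) 
    {g : RR → RR} (hb : ∀ y ζ τ, ‖F (y, ζ) τ‖ ≤ wd (d+1) y * (g ζ * wd 2 τ)) (z : RR) (n : ℕ) (t : RR)
    (H : (Ed d) → RR → CC) (hH : Measurable (uncurry H)) (hi : ∀ t, Integrable fun x => H x t) (s : RR × RR) :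
    ‖Kn a z n t s * (∫ x, VF d F x (t-s.1) s.2 s.1 * H x t)‖ₑ ≤ 
      eo (Cint p * cS a) * (eo (|t-s.1| ^ (-lamE d a p)) * (nrm p H t * nrm p (fun y τ => F (y, s.2) τ) s.1)) := by
  have hc := cS_pos ha
  have hC := Cint_pos hp2
  rcases eq_or_ne (t-s.1) 0 with h0 | h0
  · rw [Kn, h0, cutn_zero (by rw [abs_zero]; positivity)]; simp
  have hFm : Measurable fun y : Ed d => F (y, s.2) s.1 := by
    have h0 : Measurable fun y : Ed d => ((y, s.2), s.1) := (measurable_id.prodMk measurable_const).prodMk measurable_const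
    have := Measurable.comp hF h0
    simp only [Function.comp_def] at this
    exact this
  have hFi : Integrable fun y : Ed d => F (y, s.2) s.1 :=
    ((wd_int_E d).mul_const _).mono' hFm.aestronglyMeasurable (ae_of_all _ fun y => hb y s.2 s.1)
  have fb := free_bil hd h0 hp hp2 (fun x => H x t) (fun y => F (y, s.2) s.1) (slice_meas H hH t) hFm (hi t) hFi
  have e : ∫ x, VF d F x (t-s.1) s.2 s.1 * H x t = ∫ x, ∫ y, Sfree d x y (t-s.1) * H x t * F (y, s.2) s.1 := by
    refine integral_congr_ae (ae_of_all _ fun x => ?_)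
    simp only [VF]
    rw [← integral_mul_const]
    refine integral_congr_ae (ae_of_all _ fun y => ?_)
    simp only []; ring
  rw [enorm_mul, e]
  have k1 : ‖Kn a z n t s‖ₑ ≤ eo (cS a * |t-s.1| ^ (-((a+1)/2))) := by
    rw [← ofReal_norm]; exact ENNReal.ofReal_le_ofReal (norm_Kn_le ha z n t s)
  refine (mul_le_mul' k1 fb).trans (le_of_eq ?_)
  have hpos : 0 < |t-s.1| := abs_pos.2 h0
  rw [← mul_assoc (eo _) (eo _), ← mul_assoc (eo _) (eo _), ← ENNReal.ofReal_mul (by positivity), ← ENNReal.ofReal_mul (by positivity)]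
  congr 2
  rw [lamE, neg_add, Real.rpow_add hpos]; ring

def CW (d : ℕ) (a p : RR) : ℝ≥0∞ := eo (Cint p * cS a) * eo (2 * Chls (lamE d a p))

lemma est2_Wn {d : ℕ} (hd : 1 ≤ d) {a : RR} (ha : 0 ≤ a) {p pt q r : RR} (hq : 1 < q) (hr : 2 ≤ r) (hpr : p = r/(r-1)) (hqpt : pt = q/(q-1)) (hp : 1 < p) (hp2 : p ≤ 2) (h0 : 0 < lamE d a p) (h1 : lamE d a p < 1)
    (hpt : pt = 2/(2-lamE d a p)) (ρ : Measure RR) [SFinite ρ] (F : (Ed d) × RR → RR → CC) (hF : Measurable (uncurry F)) 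
    {g : RR → RR} (hg0 : ∀ ζ, 0 ≤ g ζ) (hgi : Integrable g ρ)
    (hb : ∀ y ζ τ, ‖F (y, ζ) τ‖ ≤ wd (d+1) y * (g ζ * wd 2 τ)) (z : RR) (n : ℕ) :
    mixNorm d q r (Wn d a ρ F z n) ≤ CW d a p * ∫⁻ ζ, mixNorm d pt p (fun y τ => F (y, ζ) τ) ∂ρ := by
  refine mix_dual hq hr hpr hqpt _ (Wn_measurable ha ρ F hF z n) _ fun H hH B N hN hB hz => ?_
  have hi := test_sl H hH hB hz
  have hnH := nrm_measurable p H hH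
  have hnF : Measurable fun s : RR × RR => nrm p (fun y τ => F (y, s.2) τ) s.1 := by
    have h0 : Measurable fun q : (RR × RR) × (Ed d) => ((q.2, q.1.2), q.1.1) :=
      (measurable_snd.prodMk (measurable_snd.comp measurable_fst)).prodMk (measurable_fst.comp measurable_fst)
    have h2 := Measurable.comp hF h0
    simp only [Function.comp_def] at h2
    have h3 : Measurable fun q : (RR × RR) × (Ed d) => ‖F (q.2, q.1.2) q.1.1‖ₑ ^ p := h2.enorm.pow_const p
    exact (h3.lintegral_prod_right' (ν := volume)).pow_const _
  have hnF1 : ∀ ζ, Measurable (nrm p (fun y τ => F (y, ζ) τ)) := fun ζ => by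
    have e2 : Measurable fun τ : RR => (τ, ζ) := measurable_id.prodMk measurable_const
    exact hnF.comp e2
  have hker : Measurable fun w : RR × (RR × RR) => eo (|w.1-w.2.1| ^ (-lamE d a p)) * (nrm p H w.1 * nrm p (fun y τ => F (y, w.2.2) τ) w.2.1) := by
    have e1 : Measurable fun w : RR × (RR × RR) => eo (|w.1-w.2.1| ^ (-lamE d a p)) := by fun_prop
    have e2 : Measurable fun w : RR × (RR × RR) => nrm p H w.1 := hnH.comp measurable_fst
    have e3 : Measurable fun w : RR × (RR × RR) => nrm p (fun y τ => F (y, w.2.2) τ) w.2.1 := hnF.comp measurable_snd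
    exact e1.mul (e2.mul e3)
  calc ‖∫ t, ∫ x, Wn d a ρ F z n x t * H x t‖ₑ
      ≤ ∫⁻ t, ‖∫ x, Wn d a ρ F z n x t * H x t‖ₑ := enorm_integral_le_lintegral_enorm _
    _ ≤ ∫⁻ t, ∫⁻ s, eo (Cint p * cS a) * (eo (|t-s.1| ^ (-lamE d a p)) * (nrm p H t * nrm p (fun y τ => F (y, s.2) τ) s.1)) ∂(volume.prod ρ) := by
        refine lintegral_mono fun t => ?_
        rw [W_pair hd ha ρ F hF hg0 hgi hb z n t (fun x => H x t) (slice_meas H hH t) (hi t)]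
        exact (enorm_integral_le_lintegral_enorm _).trans (lintegral_mono fun s => pt_bd hd ha hp hp2 F hF hb z n t H hH hi s)
    _ = eo (Cint p * cS a) * ∫⁻ t, ∫⁻ s, (eo (|t-s.1| ^ (-lamE d a p)) * (nrm p H t * nrm p (fun y τ => F (y, s.2) τ) s.1)) ∂(volume.prod ρ) := by
        simp_rw [lintegral_const_mul' _ _ ENNReal.ofReal_ne_top]
    _ = eo (Cint p * cS a) * ∫⁻ t, ∫⁻ ζ, ∫⁻ τ, (eo (|t-τ| ^ (-lamE d a p)) * (nrm p H t * nrm p (fun y τ => F (y, ζ) τ) τ)) ∂volume ∂ρ := by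
        congr 1
        refine lintegral_congr fun t => ?_
        have e2 : Measurable fun s : RR × RR => (t, s) := measurable_const.prodMk measurable_id
        have h3 := Measurable.comp hker e2
        simp only [Function.comp_def] at h3
        exact lintegral_prod_symm' _ h3
    _ = eo (Cint p * cS a) * ∫⁻ ζ, ∫⁻ t, ∫⁻ τ, (eo (|t-τ| ^ (-lamE d a p)) * (nrm p H t * nrm p (fun y τ => F (y, ζ) τ) τ)) ∂volume ∂volume ∂ρ := by
        congr 1
        refine lintegral_lintegral_swap ?_
        have e2 : Measurable fun w : (RR × RR) × RR => (w.1.1, (w.2, w.1.2)) :=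
          (measurable_fst.comp measurable_fst).prodMk (measurable_snd.prodMk (measurable_snd.comp measurable_fst))
        have h3 := Measurable.comp hker e2
        simp only [Function.comp_def] at h3
        exact (h3.lintegral_prod_right' (ν := volume)).aemeasurable
    _ ≤ eo (Cint p * cS a) * ∫⁻ ζ, eo (2 * Chls (lamE d a p)) * (mixNorm d pt p H * mixNorm d pt p (fun y τ => F (y, ζ) τ)) ∂ρ := by
        refine mul_le_mul_right (lintegral_mono fun ζ => ?_) _
        rw [mixNorm_eq, mixNorm_eq]
        exact hls h0 h1 hpt (nrm p H) (nrm p (fun y τ => F (y, ζ) τ)) hnH (hnF1 ζ)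
    _ = _ := by
        have hmz : Measurable fun ζ => mixNorm d pt p (fun y τ => F (y, ζ) τ) := by
          simp only [mixNorm_eq]
          have h2 : Measurable fun s : RR × RR => nrm p (fun y τ => F (y, s.1) τ) s.2 := hnF.comp measurable_swap
          exact ((h2.pow_const pt).lintegral_prod_right' (ν := volume)).pow_const _
        rw [lintegral_const_mul' _ _ ENNReal.ofReal_ne_top, lintegral_const_mul _ hmz, CW]
        ring

lemma est2_W {d : ℕ} (hd : 1 ≤ d) {a : RR} (ha : 0 ≤ a) {p pt q r : RR} (hq : 1 < q) (hr : 2 ≤ r) (hpr : p = r/(r-1)) (hqpt : pt = q/(q-1)) (hp : 1 < p) (hp2 : p ≤ 2) (h0 : 0 < lamE d a p) (h1 : lamE d a p < 1)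
    (hpt : pt = 2/(2-lamE d a p)) (ρ : Measure RR) [SFinite ρ] (F : (Ed d) × RR → RR → CC) (hF : Measurable (uncurry F)) 
    {g : RR → RR} (hg0 : ∀ ζ, 0 ≤ g ζ) (hgi : Integrable g ρ)
    (hb : ∀ y ζ τ, ‖F (y, ζ) τ‖ ≤ wd (d+1) y * (g ζ * wd 2 τ)) (z : RR) :
    mixNorm d q r (WD d a ρ F z) ≤ CW d a p * ∫⁻ ζ, mixNorm d pt p (fun y τ => F (y, ζ) τ) ∂ρ := by
  refine mix_fatou (by linarith) (by linarith) _ (Wn d a ρ F z) (Wn_measurable ha ρ F hF z) (fun x t => ?_) _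
    (fun n => est2_Wn hd ha hq hr hpr hqpt hp hp2 h0 h1 hpt ρ F hF hg0 hgi hb z n)
  unfold WD Wn
  refine cut_liminf volume _ (fun n τ => cutn n (t-τ)) (fun n => (cutn_measurable n).comp (measurable_const.sub measurable_id)) (fun n τ => norm_cutn_le _ _) ?_
  filter_upwards [compl_mem_ae_iff.2 (measure_singleton t)] with τ hτ
  exact cutn_tendsto (sub_ne_zero.2 (fun h => hτ (by simp [h])))

lemma Dop_WD {d : ℕ} (hd : 1 ≤ d) {a : RR} (ha : 0 ≤ a) (F : (Ed d) × RR → RR → CC) (hF : Measurable (uncurry F)) (hi : ∀ τ, Integrable (fun Y => F Y τ) (ωa d a))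
    {z : RR} (hz : 0 < z) (x : Ed d) (t : RR) : Dop d a F (x, z) t = WD d a (ma a) F z x t := by
  rw [Dop_eq ha F hz t, WD]
  refine integral_congr_ae (ae_of_all _ fun τ => ?_)
  simp only []
  congr 1
  unfold AD BD VF
  have hFm : Measurable fun Y : (Ed d) × RR => F Y τ := by
    have h0 : Measurable fun Y : (Ed d) × RR => (Y, τ) := measurable_id.prodMk measurable_const
    have := Measurable.comp hF h0
    simp only [Function.comp_def] at this
    exact this
  have hS : Measurable fun Y : (Ed d) × RR => SKh d a (x, z) Y (t-τ) := SKh_measurable ha measurable_const measurable_id measurable_const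
  have hint : Integrable (fun Y : (Ed d) × RR => SKh d a (x, z) Y (t-τ) * F Y τ) (ωa d a) := by
    refine ((hi τ).norm.const_mul (cS a * |t-τ| ^ (-((a+1)/2)) * |t-τ| ^ (-(d:RR)/2))).mono' (hS.mul hFm).aestronglyMeasurable (ae_of_all _ fun Y => ?_)
    rw [norm_mul]
    exact mul_le_mul_of_nonneg_right (norm_SKh_le hd ha _ _ _) (norm_nonneg _)
  rw [ωa_eq] at hint ⊢
  rw [integral_prod_symm _ hint]
  refine integral_congr_ae (ae_of_all _ fun ζ => ?_)
  simp only [SKh]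
  rw [← integral_const_mul]
  simp only [mul_assoc]

lemma Theta_WD {d : ℕ} {a : RR} (ha : 0 ≤ a) (Φ : (Ed d) → RR → CC) (z : RR) (x : Ed d) (t : RR) :
    ThetaStar d a Φ (x, z) t = I * WD d a (Measure.dirac 0) (fun Y τ => Φ Y.1 τ) z x t := by
  rw [ThetaStar, ii_eq, WD]
  congr 1
  refine integral_congr_ae (ae_of_all _ fun τ => ?_)
  simp only []
  congr 1
  unfold BD VF
  rw [integral_dirac, ← integral_const_mul]
  simp only [Sa0_eq ha, mul_assoc]

lemma numerics {d : ℕ} (hd : 1 ≤ d) {a q r : RR} (ha₁ : 0 ≤ a) (hr : 2 ≤ r)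
    (hadm : 2 / q + (d : RR) / r = ((d : RR) + a + 1) / 2)
    (hsub : 0 < (d : RR) + a - 1 → r < 2 * d / ((d : RR) + a - 1)) :
    2 < q ∧ lamE d a (r/(r-1)) = 2/q ∧ 1 < r/(r-1) ∧ r/(r-1) ≤ 2 := by
  have hr0 : 0 < r := by linarith
  have hd1 : (1:RR) ≤ d := by exact_mod_cast hd
  have h1 : (d:RR)/r ≤ d/2 := by gcongr
  have h2 : 0 < 2/q := by linarith
  have hq0 : 0 < q := by
    by_contra h
    exact absurd h2 (not_lt.2 (div_nonpos_of_nonneg_of_nonpos two_pos.le (not_lt.1 h)))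
  have h3 : ((d:RR) + a - 1)/2 < d/r := by
    rcases eq_or_lt_of_le (show 0 ≤ (d:RR) + a - 1 by linarith) with h | h
    · rw [← h, zero_div]; positivity
    · have := (lt_div_iff₀ h).1 (hsub h)
      rw [div_lt_div_iff₀ two_pos hr0]; linarith
  have h4 : 2/q < 1 := by linarith
  refine ⟨by rwa [div_lt_one hq0] at h4, ?_, ?_, ?_⟩
  · have : 2/(r/(r-1)) - 1 = 1 - 2/r := by
      have : r - 1 ≠ 0 := by linarith
      field_simp; ring
    rw [lamE, this]
    have : (d:RR)/2*(1-2/r) = d/2 - d/r := by field_simp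
    linarith
  · rw [lt_div_iff₀ (by linarith)]; linarith
  · rw [div_le_iff₀ (by linarith)]; linarith

lemma lint_ma {a : RR} (f : RR → ℝ≥0∞) : ∫⁻ ζ, f ζ ∂(ma a) = ∫⁻ ζ in Set.Ioi (0:RR), f ζ * eo (ζ ^ a) := by
  unfold ma
  rw [lintegral_withDensity_eq_lintegral_mul_non_measurable _ (by fun_prop) (ae_of_all _ fun _ => ENNReal.ofReal_lt_top)]
  refine lintegral_congr fun ζ => ?_
  simp [mul_comm]

lemma mix_I {d : ℕ} (q r : RR) (A : (Ed d) → RR → CC) : mixNorm d q r (fun x t => I * A x t) = mixNorm d q r A := by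
  unfold mixNorm
  simp

lemma sum3_le {K A B D A' B' D' K1 K2 K3 : ℝ≥0∞} (h1 : A ≤ K1 * A') (h2 : B ≤ K2 * B') (h3 : D ≤ K3 * D') (k1 : K1 ≤ K) (k2 : K2 ≤ K) (k3 : K3 ≤ K) :
    A + B + D ≤ K * (A' + B' + D') := by
  rw [mul_add, mul_add]
  exact add_le_add (add_le_add (h1.trans (mul_le_mul_left k1 _)) (h2.trans (mul_le_mul_left k2 _))) (h3.trans (mul_le_mul_left k3 _))

end helpers

/-- Full Strichartz estimates, `0 ≤ a < 1`: if `r ≥ 2`,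
`2/q + d/r = (d+a+1)/2`, with `r < 2d/(d+a-1)` when `d+a-1 > 0` and `q ≠ 2` when
`d+a-1 = 0`, then the solution `U = 𝕋_a^*(u₀) + 𝔻_a(F) + Θ_a^*(Φ)` satisfies
`‖U‖_{L^∞_t L²_a} ≤ C[‖u₀‖_{L²_a} + ‖F‖_{L¹_tL²_a} + ‖Φ‖_{L^{q'}_tL^{r'}_x}]` and
`sup_{z>0} ‖U(·,z,·)‖_{L^q_tL^r_x}
  ≤ C[‖u₀‖_{L²_a} + ‖F‖_{L¹_{a,z}L^{q'}_tL^{r'}_x} + ‖Φ‖_{L^{q'}_tL^{r'}_x}]`. -/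
theorem strichartz_nonhomogeneous_neumann_nonneg
    (d : ℕ) (hd : 1 ≤ d) (a : ℝ) (ha₁ : 0 ≤ a) (ha₂ : a < 1)
    (q r : ℝ) (hr : 2 ≤ r)
    (hadm : 2 / q + (d : ℝ) / r = ((d : ℝ) + a + 1) / 2)
    (hsub : 0 < (d : ℝ) + a - 1 → r < 2 * d / ((d : ℝ) + a - 1))
    (hend : (d : ℝ) + a - 1 = 0 → q ≠ 2) :
    ∃ C > (0 : ℝ), ∀ (u₀ : SchwartzMap ((Fin d → ℝ) × ℝ) ℂ)
      (F : SchwartzMap (((Fin d → ℝ) × ℝ) × ℝ) ℂ)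
      (Φ : SchwartzMap ((Fin d → ℝ) × ℝ) ℂ),
      (⨆ t : ℝ,
          eLpNorm (fun X =>
            Tstar d a (fun Y => u₀ Y) X t + Dop d a (fun Y τ => F (Y, τ)) X t
              + ThetaStar d a (fun y τ => Φ (y, τ)) X t) 2 (ωa d a))
        ≤ ENNReal.ofReal C *
          (eLpNorm (fun X => u₀ X) 2 (ωa d a)
            + (∫⁻ t : ℝ, eLpNorm (fun Y => F (Y, t)) 2 (ωa d a))
            + mixNorm d (q / (q - 1)) (r / (r - 1)) (fun y τ => Φ (y, τ))) ∧
      (⨆ (z : ℝ) (_ : 0 < z),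
          mixNorm d q r (fun x t =>
            Tstar d a (fun Y => u₀ Y) (x, z) t + Dop d a (fun Y τ => F (Y, τ)) (x, z) t
              + ThetaStar d a (fun y τ => Φ (y, τ)) (x, z) t))
        ≤ ENNReal.ofReal C *
          (eLpNorm (fun X => u₀ X) 2 (ωa d a)
            + (∫⁻ ζ in Set.Ioi (0 : ℝ),
                mixNorm d (q / (q - 1)) (r / (r - 1)) (fun x t => F ((x, ζ), t)) *
                  ENNReal.ofReal (ζ ^ a))
            + mixNorm d (q / (q - 1)) (r / (r - 1)) (fun y τ => Φ (y, τ))) := by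
  obtain ⟨hq2, hlam, hp, hp2⟩ := numerics hd ha₁ hr hadm hsub
  set p := r/(r-1) with hpr
  set pt := q/(q-1) with hqpt
  have hq0 : 0 < q := by linarith
  have h0 : 0 < lamE d a p := by rw [hlam]; positivity
  have h1 : lamE d a p < 1 := by rw [hlam, div_lt_one hq0]; exact hq2
  have hpt : pt = 2/(2-lamE d a p) := by
    rw [hlam, hqpt]
    have e1 : q - 1 ≠ 0 := by linarith
    have e2 : 2 - 2/q ≠ 0 := by
      have : 2/q < 1 := by rwa [hlam] at h1
      linarith
    rw [div_eq_div_iff e1 e2]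
    field_simp
  let K1 : ℝ≥0∞ := 1 + ENNReal.ofReal (CT a) ^ (1/2:ℝ)
  let K2 : ℝ≥0∞ := ENNReal.ofReal (CM d a p) ^ (1/2:ℝ)
  let K3 : ℝ≥0∞ := CW d a p
  have hK1 : K1 ≠ ⊤ := ENNReal.add_ne_top.2 ⟨ENNReal.one_ne_top, ENNReal.rpow_ne_top_of_nonneg (by norm_num) ENNReal.ofReal_ne_top⟩
  have hK2 : K2 ≠ ⊤ := ENNReal.rpow_ne_top_of_nonneg (by norm_num) ENNReal.ofReal_ne_top
  have hK3 : K3 ≠ ⊤ := ENNReal.mul_ne_top ENNReal.ofReal_ne_top ENNReal.ofReal_ne_top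
  have hK : K1 + K2 + K3 ≠ ⊤ := ENNReal.add_ne_top.2 ⟨ENNReal.add_ne_top.2 ⟨hK1, hK2⟩, hK3⟩
  refine ⟨(K1 + K2 + K3).toReal + 1, by positivity, fun u₀ F Φ => ?_⟩
  have hKC : K1 + K2 + K3 ≤ ENNReal.ofReal ((K1 + K2 + K3).toReal + 1) := by
    rw [← ENNReal.ofReal_toReal hK]
    refine ENNReal.ofReal_le_ofReal ?_
    rw [ENNReal.toReal_ofReal ENNReal.toReal_nonneg]; linarith
  generalize ENNReal.ofReal ((K1 + K2 + K3).toReal + 1) = C at hKC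
  have k1 : K1 ≤ C := (le_self_add.trans le_self_add).trans hKC
  have k1' : ENNReal.ofReal (CT a) ^ (1/2:ℝ) ≤ C := le_add_self.trans k1
  have k2 : K2 ≤ C := (le_add_self.trans le_self_add).trans hKC
  have k3 : K3 ≤ C := le_add_self.trans hKC
  have hu : Measurable fun Y => u₀ Y := u₀.continuous.measurable
  have hF : Measurable (Function.uncurry fun (Y : (Fin d → ℝ) × ℝ) (τ : ℝ) => F (Y, τ)) := F.continuous.measurable
  have hΦ : Measurable (Function.uncurry fun (y : Fin d → ℝ) (τ : ℝ) => Φ (y, τ)) := Φ.continuous.measurable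
  obtain ⟨Cu, hCu, bu⟩ := schw_u u₀ 3
  obtain ⟨CF, hCF, bF⟩ := schw_F F
  obtain ⟨CΦ, hCΦ, bΦ⟩ := schw_u Φ 2
  have hui : Integrable (fun Y => u₀ Y) (ωa d a) := int_ωa_of_bd ha₁ ha₂ _ hu bu
  have hFi : ∀ τ, Integrable (fun Y => F (Y, τ)) (ωa d a) := fun τ => by
    have hm : Measurable fun Y : (Fin d → ℝ) × ℝ => F (Y, τ) := (F.continuous.comp (by fun_prop : Continuous fun Y : (Fin d → ℝ) × ℝ => (Y, τ))).measurable
    refine int_ωa_of_bd (C := CF * wd 2 τ) ha₁ ha₂ _ hm fun x z => (bF x z τ).trans (le_of_eq (by ring))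
  constructor
  · refine iSup_le fun t => ?_
    obtain ⟨mT, eT⟩ := est1_T hd ha₁ (fun Y => u₀ Y) hu hui t
    obtain ⟨mD, eD⟩ := est1_D hd ha₁ (fun Y τ => F (Y, τ)) hF hFi t
    obtain ⟨mΘ, eΘ⟩ := est1_Θ hd ha₁ hp hp2 h0 h1 hpt (fun y τ => Φ (y, τ)) hΦ bΦ t
    refine le_trans ?_ (sum3_le eT eD eΘ k1 k1' k2)
    refine (eLpNorm_add_le (mT.add mD) mΘ (by norm_num)).trans (add_le_add_left ?_ _)
    exact eLpNorm_add_le mT mD (by norm_num)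
  · refine iSup_le fun z => iSup_le fun hz => ?_
    have hΦ' : Measurable (Function.uncurry fun (Y : (Fin d → ℝ) × ℝ) (τ : ℝ) => Φ (Y.1, τ)) :=
      (Φ.continuous.comp (by fun_prop : Continuous fun Y : ((Fin d → ℝ) × ℝ) × ℝ => (Y.1.1, Y.2))).measurable
    have eT := est2_T hd ha₁ (by linarith) hr hpr hqpt hp hp2 h0 h1 hpt z (fun Y => u₀ Y) hu hui
    have eD := est2_W hd ha₁ (by linarith) hr hpr hqpt hp hp2 h0 h1 hpt (ma a) (fun Y τ => F (Y, τ)) hF (g := fun ζ => CF * wd 3 ζ)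
      (fun ζ => mul_nonneg hCF.le (wd_pos _ _).le) ((wd_int_ma ha₁ ha₂).const_mul _) (fun y ζ τ => (bF y ζ τ).trans (le_of_eq (by ring))) z
    have eΘ := est2_W hd ha₁ (by linarith) hr hpr hqpt hp hp2 h0 h1 hpt (Measure.dirac 0) (fun Y τ => Φ (Y.1, τ)) hΦ' (g := fun ζ => CΦ)
      (fun ζ => hCΦ.le) (integrable_const _) (fun y ζ τ => (bΦ y τ).trans (le_of_eq (by ring))) z
    rw [lint_ma] at eD
    rw [lintegral_dirac] at eΘ
    rw [← mix_I] at eΘ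
    refine le_trans ?_ (sum3_le eT eD eΘ k2 k3 k3)
    have hmT : Measurable (Function.uncurry fun (x : Fin d → ℝ) t => AD d a (fun Y _ => u₀ Y) (x, z) t 0) :=
      AD_measurable (h := fun _ => 0) ha₁ (fun Y _ => u₀ Y) (hu.comp measurable_fst) (measurable_fst.prodMk measurable_const) measurable_snd measurable_const
    have hmD := WD_measurable ha₁ (ma a) (fun Y τ => F (Y, τ)) hF z
    have hmΘ : Measurable (Function.uncurry fun x t => I * WD d a (Measure.dirac 0) (fun Y τ => Φ (Y.1, τ)) z x t) :=
      (WD_measurable ha₁ (Measure.dirac 0) (fun Y τ => Φ (Y.1, τ)) hΦ' z).const_mul I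
    refine le_trans (le_of_eq (mix_congr _ (fun x t => AD d a (fun Y _ => u₀ Y) (x, z) t 0 + WD d a (ma a) (fun Y τ => F (Y, τ)) z x t + I * WD d a (Measure.dirac 0) (fun Y τ => Φ (Y.1, τ)) z x t) ?_)) ?_
    · filter_upwards [compl_mem_ae_iff.2 (measure_singleton (0:ℝ))] with t ht x
      rw [Tstar_eq ha₁ (fun Y => u₀ Y) hz (by simpa using ht), Dop_WD hd ha₁ (fun Y τ => F (Y, τ)) hF hFi hz, Theta_WD ha₁]
    · have hmTD : Measurable (Function.uncurry fun (x : Fin d → ℝ) t => AD d a (fun Y _ => u₀ Y) (x, z) t 0 + WD d a (ma a) (fun Y τ => F (Y, τ)) z x t) := hmT.add hmD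
      refine (mix_add (by linarith) (by linarith) _ _ hmTD hmΘ).trans (add_le_add_left ?_ _)
      exact mix_add (by linarith) (by linarith) _ _ hmT hmD

end
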